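/- arXiv:1809.00422 — 3 statements merged into one kernel-verified Lean document; each statement's English description precedes it below -/
import Mathlib

section
/- Let X be a standard Borel space and let μ be a σ-finite Borel measure on X. If F is a μ-amenable countable Borel equivalence relation on X and E is a countable Borel equivalence relation on X with E ⊆ F, then E is μ-amenable. -/
open MeasureTheory

/-- E is *μ-amenable* if there is an E-invariant μ-measurable assignment x ↦ ν_x of finitely
additive probability measures with ν_x([x]_E) = 1. -/
def MuAmenable {X : Type*} [MeasurableSpace X] (μ : Measure X) (E : X → X → Prop) : Prop :=
  ∃ ν : X → Set X → ℝ,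
    (∀ x A, 0 ≤ ν x A) ∧
    (∀ x, ν x Set.univ = 1) ∧
    (∀ x A B, Disjoint A B → ν x (A ∪ B) = ν x A + ν x B) ∧
    (∀ x, ν x {y | E x y} = 1) ∧
    (∀ x y, E x y → ν x = ν y) ∧
    (∀ A : Set (X × X), MeasurableSet A →
      AEMeasurable (fun x => ν x {y | (x, y) ∈ A}) μ)

/-- A family `𝓐` of subsets of `Z` is *small* for `a : Z → X` if, off countably many Borel sets on
which `a` is injective, no fibre of `a` meets all members of `𝓐`. -/
def FiberSmall {Z X : Type*} [MeasurableSpace Z] (a : Z → X) (𝓐 : Set (Set Z)) : Prop :=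
  ∃ 𝒢 : Set (Set Z), 𝒢.Countable ∧ (∀ G ∈ 𝒢, MeasurableSet G ∧ Set.InjOn a G) ∧
    ∀ x, ∃ A ∈ 𝓐, A ∩ a ⁻¹' {x} ⊆ ⋃₀ 𝒢

/-- If a Borel map is injective on the part of a Borel set lying over an analytic set, then that
part is contained in a Borel set on which the map is injective. -/
theorem exists_measurable_superset_injOn {Z X : Type*} [MeasurableSpace Z] [StandardBorelSpace Z]
    [TopologicalSpace X] [PolishSpace X] [MeasurableSpace X] [BorelSpace X]
    {a : Z → X} (ha : Measurable a) {Q : Set Z} (hQ : MeasurableSet Q) {D : Set X}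
    (hD : AnalyticSet D) (hinj : Set.InjOn a (Q ∩ a ⁻¹' D)) :
    ∃ G, MeasurableSet G ∧ Q ∩ a ⁻¹' D ⊆ G ∧ Set.InjOn a G := by
  obtain ⟨U, hU, hsep⟩ := exists_seq_separating Z (p := MeasurableSet) MeasurableSet.empty Set.univ
  have analytic (s : Set Z) (hs : MeasurableSet s) : AnalyticSet (a '' s ∩ D) := by
    rw [Set.inter_eq_iInter]
    refine AnalyticSet.iInter fun b => ?_
    cases b
    · exact hD
    · exact hs.analyticSet_image ha
  have separated (n : ℕ) :
      MeasurablySeparable (a '' (Q ∩ U n) ∩ D) (a '' (Q \ U n) ∩ D) := by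
    refine (analytic _ (hQ.inter (hU n))).measurablySeparable (analytic _ (hQ.diff (hU n))) ?_
    rw [Set.disjoint_left]
    rintro _ ⟨⟨z, ⟨hzQ, hzU⟩, rfl⟩, hzD⟩ ⟨⟨w, ⟨hwQ, hwU⟩, hwz⟩, -⟩
    have : w = z := hinj ⟨hwQ, by simpa [hwz] using hzD⟩ ⟨hzQ, hzD⟩ hwz
    exact hwU (this ▸ hzU)
  choose C hUC hCU hC using separated
  refine ⟨⋂ n, {z | z ∈ U n ↔ z ∈ a ⁻¹' C n}, ?_, ?_, ?_⟩
  · exact MeasurableSet.iInter fun n =>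
      measurableSet_setOfPred.2 ((measurableSet_setOfPred.1 (hU n)).iff
        (measurableSet_setOfPred.1 (ha (hC n))))
  · rintro z ⟨hzQ, hzD⟩
    refine Set.mem_iInter.2 fun n => ⟨fun hz => hUC n ⟨⟨z, ⟨hzQ, hz⟩, rfl⟩, hzD⟩, fun hz => ?_⟩
    by_contra hzU
    exact Set.disjoint_left.1 (hCU n) ⟨⟨z, ⟨hzQ, hzU⟩, rfl⟩, hzD⟩ hz
  · intro z hz w hw hzw
    refine hsep z trivial w trivial fun n => ?_
    have h₁ := Set.mem_iInter.1 hz n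
    have h₂ := Set.mem_iInter.1 hw n
    simp only [Set.mem_ofPred_eq, Set.mem_preimage] at h₁ h₂
    rw [h₁, h₂, hzw]

/-- Distinct points of a separable metric space have disjoint neighbourhoods of small diameter in
a fixed countable family of closed sets. -/
theorem exists_countable_closed_separating (Z : Type*) [MetricSpace Z] [SecondCountableTopology Z]
    {ε : ENNReal} (hε : 0 < ε) :
    ∃ 𝒞 : Set (Set Z), 𝒞.Countable ∧ (∀ C ∈ 𝒞, IsClosed C ∧ Metric.ediam C ≤ ε) ∧
      ∀ z w, z ≠ w → ∃ C ∈ 𝒞, ∃ C' ∈ 𝒞, z ∈ C ∧ w ∈ C' ∧ Disjoint C C' := by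
  obtain ⟨b, hbc, -, hb⟩ := TopologicalSpace.exists_countable_basis Z
  refine ⟨closure '' {u ∈ b | Metric.ediam u ≤ ε}, (hbc.mono (Set.sep_subset _ _)).image _, ?_, ?_⟩
  · rintro _ ⟨u, ⟨-, hu⟩, rfl⟩
    exact ⟨isClosed_closure, by rwa [Metric.ediam_closure]⟩
  · intro z w hzw
    have small (x : Z) (r : ENNReal) (hr : 0 < r) :
        ∃ u ∈ {u ∈ b | Metric.ediam u ≤ ε}, x ∈ u ∧ closure u ⊆ Metric.closedEBall x r := by
      have hpos : 0 < min r (ε / 2) := lt_min hr (ENNReal.half_pos hε.ne')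
      obtain ⟨u, hub, hxu, hu⟩ := hb.exists_subset_of_mem_open
        (Metric.mem_eball_self hpos) Metric.isOpen_eball
      refine ⟨u, ⟨hub, ?_⟩, hxu, ?_⟩
      · calc Metric.ediam u ≤ Metric.ediam (Metric.eball x (ε / 2)) :=
              Metric.ediam_mono (hu.trans (Metric.eball_subset_eball (min_le_right _ _)))
          _ ≤ 2 * (ε / 2) := Metric.ediam_eball_le
          _ = ε := ENNReal.mul_div_cancel (by simp) (by simp)
      · exact closure_minimal (hu.trans ((Metric.eball_subset_eball (min_le_left _ _)).trans
          Metric.eball_subset_closedEBall)) Metric.isClosed_closedEBall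
    have hr : 0 < edist z w / 3 := ENNReal.div_pos (edist_pos.2 hzw).ne' (by simp)
    obtain ⟨u, hu, hzu, huz⟩ := small z _ hr
    obtain ⟨v, hv, hwv, hvw⟩ := small w _ hr
    refine ⟨_, ⟨u, hu, rfl⟩, _, ⟨v, hv, rfl⟩, subset_closure hzu, subset_closure hwv, ?_⟩
    rw [Set.disjoint_left]
    intro y hyu hyv
    have h₁ : edist y z ≤ edist z w / 3 := huz hyu
    have h₂ : edist y w ≤ edist z w / 3 := hvw hyv
    rw [edist_dist, edist_dist, show (3 : ENNReal) = ENNReal.ofReal 3 by simp,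
      ← ENNReal.ofReal_div_of_pos (by norm_num),
      ENNReal.ofReal_le_ofReal_iff (by positivity)] at h₁ h₂
    have := dist_triangle_left z w y
    have := dist_pos.2 hzw
    linarith

section Splitting

variable {Z X : Type*} [MetricSpace Z] [CompleteSpace Z] [SecondCountableTopology Z]
  [MeasurableSpace Z] [BorelSpace Z]
  [TopologicalSpace X] [PolishSpace X] [MeasurableSpace X] [BorelSpace X] {a : Z → X}

/-- One member of a family that is not small can be split into two disjoint pieces of small
diameter so that the new family is still not small. -/
theorem exists_split_not_fiberSmall (ha : Continuous a) {ε : ENNReal} (hε : 0 < ε)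
    {A : Set Z} (hA : IsClosed A) {𝓑 : Set (Set Z)} (h𝓑c : 𝓑.Countable)
    (h𝓑 : ∀ B ∈ 𝓑, IsClosed B) (hns : ¬ FiberSmall a (insert A 𝓑)) :
    ∃ U V, (IsClosed U ∧ U ⊆ A ∧ Metric.ediam U ≤ ε) ∧ (IsClosed V ∧ V ⊆ A ∧ Metric.ediam V ≤ ε) ∧
      Disjoint U V ∧ ¬ FiberSmall a (insert U (insert V 𝓑)) := by
  obtain ⟨𝒞, h𝒞c, h𝒞, hsep⟩ := exists_countable_closed_separating Z hε
  by_contra! hcon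
  have pieces (p : {p : 𝒞 × 𝒞 // Disjoint p.1.1 p.2.1}) :
      FiberSmall a (insert (A ∩ p.1.1.1) (insert (A ∩ p.1.2.1) 𝓑)) :=
    hcon _ _ ⟨hA.inter (h𝒞 _ p.1.1.2).1, Set.inter_subset_left,
        (Metric.ediam_mono Set.inter_subset_right).trans (h𝒞 _ p.1.1.2).2⟩
      ⟨hA.inter (h𝒞 _ p.1.2.2).1, Set.inter_subset_left,
        (Metric.ediam_mono Set.inter_subset_right).trans (h𝒞 _ p.1.2.2).2⟩
      (p.2.mono Set.inter_subset_right Set.inter_subset_right)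
  choose 𝒢 h𝒢c h𝒢 hcover using pieces
  have : Countable 𝒞 := h𝒞c.to_subtype
  set 𝒢' := ⋃ p, 𝒢 p
  have h𝒢'c : 𝒢'.Countable := Set.countable_iUnion h𝒢c
  have h𝒢'G : ∀ G ∈ 𝒢', MeasurableSet G ∧ Set.InjOn a G := by
    intro G hG
    obtain ⟨p, hp⟩ := Set.mem_iUnion.1 hG
    exact h𝒢 p G hp
  have hS : MeasurableSet (⋃₀ 𝒢') := MeasurableSet.sUnion h𝒢'c fun G hG => (h𝒢'G G hG).1
  set D : Set X := ⋂ B : (insert A 𝓑 : Set (Set Z)), a '' (B.1 \ ⋃₀ 𝒢')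
  have hD : AnalyticSet D := by
    have : Countable (insert A 𝓑 : Set (Set Z)) := (h𝓑c.insert A).to_subtype
    have : Nonempty (insert A 𝓑 : Set (Set Z)) := ⟨⟨A, Set.mem_insert _ _⟩⟩
    refine AnalyticSet.iInter fun B => ?_
    have hB : IsClosed B.1 := by
      rcases B.2 with h | h
      · rwa [h]
      · exact h𝓑 _ h
    exact (hB.measurableSet.diff hS).analyticSet_image ha.measurable
  have hinj : Set.InjOn a ((A \ ⋃₀ 𝒢') ∩ a ⁻¹' D) := by
    rintro z ⟨⟨hzA, hzS⟩, hzD⟩ w ⟨⟨hwA, hwS⟩, -⟩ hzw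
    by_contra hne
    obtain ⟨C, hC, C', hC', hzC, hwC', hdis⟩ := hsep z w hne
    obtain ⟨B, hB, hBsub⟩ := hcover ⟨(⟨C, hC⟩, ⟨C', hC'⟩), hdis⟩ (a z)
    have hBS : B ∩ a ⁻¹' {a z} ⊆ ⋃₀ 𝒢' :=
      hBsub.trans (Set.sUnion_subset_sUnion (Set.subset_iUnion 𝒢 _))
    rcases hB with rfl | rfl | hB
    · exact hzS (hBS ⟨⟨hzA, hzC⟩, rfl⟩)
    · exact hwS (hBS ⟨⟨hwA, hwC'⟩, hzw.symm⟩)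
    · obtain ⟨y, ⟨hyB, hyS⟩, hy⟩ := Set.mem_iInter.1 hzD ⟨B, Set.mem_insert_of_mem _ hB⟩
      exact hyS (hBS ⟨hyB, hy⟩)
  obtain ⟨G, hG, hsubG, hGinj⟩ :=
    exists_measurable_superset_injOn ha.measurable (hA.measurableSet.diff hS) hD hinj
  refine hns ⟨insert G 𝒢', h𝒢'c.insert G, ?_, fun x => ?_⟩
  · rintro H (rfl | hH)
    · exact ⟨hG, hGinj⟩
    · exact h𝒢'G H hH
  · rw [Set.sUnion_insert]
    by_cases hx : x ∈ D
    · refine ⟨A, Set.mem_insert _ _, ?_⟩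
      rintro z ⟨hzA, rfl⟩
      by_cases hz : z ∈ ⋃₀ 𝒢'
      · exact Or.inr hz
      · exact Or.inl (hsubG ⟨⟨hzA, hz⟩, hx⟩)
    · obtain ⟨B, hB⟩ := not_forall.1 (fun h => hx (Set.mem_iInter.2 h))
      refine ⟨B.1, B.2, ?_⟩
      rintro z ⟨hzB, hz⟩
      by_contra hzS
      exact hB ⟨z, ⟨hzB, fun h => hzS (Or.inr h)⟩, hz⟩

/-- All members of a finite subfamily can be split simultaneously. -/
theorem exists_split_finset_not_fiberSmall (ha : Continuous a) {ε : ENNReal} (hε : 0 < ε)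
    {ι : Type*} [DecidableEq ι] (A : ι → Set Z) (t : Finset ι) :
    (∀ i ∈ t, IsClosed (A i)) → ∀ 𝓑 : Set (Set Z), 𝓑.Countable → (∀ B ∈ 𝓑, IsClosed B) →
      ¬ FiberSmall a (A '' t ∪ 𝓑) →
      ∃ U : Bool → ι → Set Z,
        (∀ i ∈ t, (∀ b, IsClosed (U b i) ∧ U b i ⊆ A i ∧ Metric.ediam (U b i) ≤ ε) ∧
          Disjoint (U true i) (U false i)) ∧
        ¬ FiberSmall a (U true '' t ∪ U false '' t ∪ 𝓑) := by
  induction t using Finset.induction_on with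
  | empty =>
    intro _ 𝓑 _ _ hns
    exact ⟨fun _ _ => ∅, by simp, by simpa using hns⟩
  | insert i t hi ih =>
    intro hA 𝓑 h𝓑c h𝓑 hns
    have hAt : ∀ j ∈ t, IsClosed (A j) := fun j hj => hA j (Finset.mem_insert_of_mem hj)
    rw [Finset.coe_insert, Set.image_insert_eq, Set.insert_union] at hns
    obtain ⟨V, W, hV, hW, hVW, hns⟩ := exists_split_not_fiberSmall ha hε
      (hA i (Finset.mem_insert_self _ _)) ((t.countable_toSet.image A).union h𝓑c)
      (by
        rintro B (⟨j, hj, rfl⟩ | hB)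
        · exact hAt j hj
        · exact h𝓑 B hB) hns
    obtain ⟨U, hU, hns⟩ := ih hAt (insert V (insert W 𝓑)) ((h𝓑c.insert W).insert V)
      (by
        rintro B (rfl | rfl | hB)
        · exact hV.1
        · exact hW.1
        · exact h𝓑 B hB)
      (by simpa only [Set.union_insert] using hns)
    have himage (b : Bool) (S : Set Z) :
        Function.update (U b) i S '' (insert i t : Finset ι) = insert S (U b '' t) := by
      rw [Finset.coe_insert, Set.image_insert_eq, Function.update_self]
      congr 1
      refine Set.image_congr fun j hj => Function.update_of_ne ?_ _ _
      rintro rfl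
      exact hi hj
    refine ⟨fun b => Function.update (U b) i (if b then V else W), ?_, ?_⟩
    · intro j hj
      by_cases hji : j = i
      · subst hji
        simpa using ⟨⟨hW, hV⟩, hVW⟩
      · simpa [Function.update_of_ne hji] using hU j (Finset.mem_of_mem_insert_of_ne hj hji)
    · rw [himage, himage]
      convert hns using 2
      ext B
      simp only [Set.mem_union, Set.mem_insert_iff, if_true, Bool.false_eq_true, if_false]
      tauto

/-- A continuous map whose whole domain forms a family that is not small has an uncountable
fibre. -/
theorem exists_not_countable_fiber (ha : Continuous a) (hns : ¬ FiberSmall a {Set.univ}) :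
    ∃ x, ¬ (a ⁻¹' {x}).Countable := by
  classical
  let Level (n : ℕ) : Type _ := {T : List Bool → Set Z //
    (∀ l, l.length = n → IsClosed (T l)) ∧ ¬ FiberSmall a (T '' {l | l.length = n})}
  have step (n : ℕ) (T : Level n) : ∃ T' : Level (n + 1), ∀ l, l.length = n →
      (∀ b, T'.1 (b :: l) ⊆ T.1 l ∧ Metric.ediam (T'.1 (b :: l)) ≤ (n : ENNReal)⁻¹) ∧
      Disjoint (T'.1 (true :: l)) (T'.1 (false :: l)) := by
    obtain ⟨T, hTc, hTns⟩ := T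
    have hfin := List.finite_length_eq Bool n
    obtain ⟨U, hU, hUns⟩ := exists_split_finset_not_fiberSmall ha
      (ε := (n : ENNReal)⁻¹) (by simp) T hfin.toFinset
      (by simpa using hTc) ∅ Set.countable_empty (by simp) (by simpa using hTns)
    simp only [Set.Finite.mem_toFinset, Set.mem_ofPred_eq, Set.Finite.coe_toFinset,
      Set.union_empty] at hU hUns
    refine ⟨⟨fun l => U (l.headD true) l.tail, ?_, ?_⟩, ?_⟩
    · rintro (_ | ⟨b, l⟩) hl
      · simp at hl
      · exact ((hU l (by simpa using hl)).1 b).1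
    · convert hUns using 2
      ext B
      constructor
      · rintro ⟨_ | ⟨b, l⟩, hl, rfl⟩
        · simp at hl
        · cases b
          · exact Or.inr ⟨l, by simpa using hl, rfl⟩
          · exact Or.inl ⟨l, by simpa using hl, rfl⟩
      · rintro (⟨l, hl, rfl⟩ | ⟨l, hl, rfl⟩)
        · exact ⟨true :: l, by simpa using hl, rfl⟩
        · exact ⟨false :: l, by simpa using hl, rfl⟩
    · exact fun l hl => ⟨fun b => ((hU l hl).1 b).2, (hU l hl).2⟩
  choose next hnext using step
  let T : (n : ℕ) → Level n := fun n => Nat.rec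
    ⟨fun _ => Set.univ, fun _ _ => isClosed_univ, by simpa using hns⟩ next n
  let A : List Bool → Set Z := fun l => (T l.length).1 l
  have hA (b : Bool) (l : List Bool) : A (b :: l) = (next l.length (T l.length)).1 (b :: l) := rfl
  have hanti : CantorScheme.ClosureAntitone A := by
    refine CantorScheme.Antitone.closureAntitone (fun l b => ?_) fun l => (T l.length).2.1 l rfl
    rw [hA]
    exact ((hnext _ _ l rfl).1 b).1
  have hdiam : CantorScheme.VanishingDiam A := by
    intro x
    rw [← Filter.tendsto_add_atTop_iff_nat 1]
    refine tendsto_of_tendsto_of_tendsto_of_le_of_le tendsto_const_nhds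
      ENNReal.tendsto_inv_nat_nhds_zero (fun _ => zero_le) fun n => ?_
    have := ((hnext _ (T (PiNat.res x n).length) (PiNat.res x n) rfl).1 (x n)).2
    rw [← hA, PiNat.res_length] at this
    exact this
  have hdis : CantorScheme.Disjoint A := by
    intro l b c hbc
    have := (hnext _ (T l.length) l rfl).2
    cases b <;> cases c
    · exact absurd rfl hbc
    · exact this.symm
    · exact this
    · exact absurd rfl hbc
  have hcommon (n : ℕ) : ∃ x, ∀ l, l.length = n → ∃ z ∈ A l, a z = x := by
    by_contra! hcon
    refine (T n).2.2 ⟨∅, Set.countable_empty, by simp, fun x => ?_⟩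
    obtain ⟨l, rfl, hl⟩ := hcon x
    exact ⟨_, ⟨l, rfl, rfl⟩, fun z hz => absurd hz.2 (hl z hz.1)⟩
  have hne (l : List Bool) : (A l).Nonempty := by
    obtain ⟨x, hx⟩ := hcommon l.length
    obtain ⟨z, hz, -⟩ := hx l rfl
    exact ⟨z, hz⟩
  have htotal := hanti.map_of_vanishingDiam hdiam hne
  let φ : (ℕ → Bool) → Z := fun x => (CantorScheme.inducedMap A).2 ⟨x, htotal ▸ Set.mem_univ x⟩
  have hφinj : Function.Injective φ := fun x y hxy => congrArg Subtype.val (hdis.map_injective hxy)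
  have hφmem (x : ℕ → Bool) (n : ℕ) : φ x ∈ A (PiNat.res x n) := CantorScheme.map_mem _ n
  choose c hc using hcommon
  have hlim (x : ℕ → Bool) : Filter.Tendsto c Filter.atTop (nhds (a (φ x))) := by
    choose z hz hzc using fun n => hc n (PiNat.res x n) (PiNat.res_length x n)
    have : Filter.Tendsto z Filter.atTop (nhds (φ x)) := by
      rw [tendsto_iff_edist_tendsto_0]
      exact tendsto_of_tendsto_of_tendsto_of_le_of_le tendsto_const_nhds (hdiam x)
        (fun _ => zero_le) fun n => Metric.edist_le_ediam_of_mem (hz n) (hφmem x n)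
    simpa only [Function.comp_def, hzc] using (ha.tendsto _).comp this
  refine ⟨a (φ fun _ => true), fun hcount => ?_⟩
  have : (Set.univ : Set (ℕ → Bool)).Countable :=
    (hcount.preimage hφinj).mono fun x _ => tendsto_nhds_unique (hlim x) (hlim _)
  have hcantor : Countable (ℕ → Bool) := Set.countable_univ_iff.1 this
  refine (Cardinal.mk_le_aleph0_iff.2 hcantor).not_gt ?_
  rw [← Cardinal.power_def, Cardinal.mk_bool, Cardinal.mk_nat]
  exact Cardinal.cantor Cardinal.aleph0

end Splitting

/-- **Lusin–Novikov theorem**: a countable-to-one Borel map between standard Borel spaces is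
injective on each of countably many Borel sets covering its domain. -/
theorem exists_measurable_cover_injOn {Z X : Type*} [MeasurableSpace Z] [StandardBorelSpace Z]
    [MeasurableSpace X] [StandardBorelSpace X] {a : Z → X} (ha : Measurable a)
    (hcount : ∀ x, (a ⁻¹' {x}).Countable) :
    ∃ G : ℕ → Set Z, (∀ n, MeasurableSet (G n)) ∧ (∀ n, Set.InjOn a (G n)) ∧
      ⋃ n, G n = Set.univ := by
  let := upgradeStandardBorel X
  have hsmall : FiberSmall a {Set.univ} := by
    obtain ⟨τ, hτ, hτp⟩ := StandardBorelSpace.polish (α := Z)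
    obtain ⟨τ', hle, hcont, hpol⟩ := ha.exists_continuous
    have hborel : @BorelSpace Z τ' _ :=
      ⟨by rw [hτ.measurable_eq]; exact (borel_eq_borel_of_le hpol hτp hle).symm⟩
    let := τ'
    let := TopologicalSpace.upgradeIsCompletelyMetrizable Z
    by_contra hns
    obtain ⟨x, hx⟩ := exists_not_countable_fiber hcont hns
    exact hx (hcount x)
  obtain ⟨𝒢, h𝒢c, h𝒢, hcover⟩ := hsmall
  obtain ⟨G, hG⟩ := (h𝒢c.insert ∅).exists_eq_range (Set.insert_nonempty _ _)
  have hGn (n : ℕ) : MeasurableSet (G n) ∧ Set.InjOn a (G n) := by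
    have : G n ∈ insert ∅ 𝒢 := hG ▸ Set.mem_range_self n
    rcases this with h | h
    · simp [h]
    · exact h𝒢 _ h
  refine ⟨G, fun n => (hGn n).1, fun n => (hGn n).2, Set.eq_univ_of_forall fun z => ?_⟩
  obtain ⟨A, rfl, hA⟩ := hcover (a z)
  obtain ⟨H, hH, hz⟩ := hA ⟨Set.mem_univ z, rfl⟩
  obtain ⟨n, rfl⟩ : H ∈ Set.range G := hG ▸ Set.mem_insert_of_mem _ hH
  exact Set.mem_iUnion.2 ⟨n, hz⟩

/-- A Borel set with countable sections is a countable union of Borel graphs of partial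
functions. -/
theorem exists_measurable_graphs_iUnion_eq {X Y : Type*} [MeasurableSpace X] [StandardBorelSpace X]
    [MeasurableSpace Y] [StandardBorelSpace Y] {P : Set (X × Y)} (hP : MeasurableSet P)
    (hcount : ∀ x, {y | (x, y) ∈ P}.Countable) :
    ∃ G : ℕ → Set (X × Y), (∀ n, MeasurableSet (G n)) ∧ (∀ n, Set.InjOn Prod.fst (G n)) ∧
      ⋃ n, G n = P := by
  have := hP.standardBorel
  obtain ⟨G, hG, hinj, hcover⟩ := exists_measurable_cover_injOn (a := fun p : P => p.1.1)
    (measurable_fst.comp measurable_subtype_coe) (fun x => by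
      refine Set.MapsTo.countable_of_injOn (f := fun p : P => p.1.2) (t := {y | (x, y) ∈ P})
        ?_ ?_ (hcount x)
      · rintro ⟨⟨x', y⟩, hp⟩ rfl
        exact hp
      · rintro ⟨⟨x₁, y₁⟩, h₁⟩ rfl ⟨⟨x₂, y₂⟩, h₂⟩ hx hy
        simp only [Set.mem_preimage, Set.mem_singleton_iff] at hx hy
        simp [hx, hy])
  refine ⟨fun n => Subtype.val '' G n, fun n => hP.subtype_image (hG n), fun n => ?_, ?_⟩
  · rintro _ ⟨p, hp, rfl⟩ _ ⟨q, hq, rfl⟩ hpq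
    exact congrArg _ (hinj n hp hq hpq)
  · rw [← Set.image_iUnion, hcover, Set.image_univ, Subtype.range_coe]

/-- The points `y` which are sent into `A` by the map taking `y` to its image, under the first
possible partial function with graph `G n`, in the `E`-class of `x`. -/
def firstHitSet {X : Type*} (G : ℕ → Set (X × X)) (E : X → X → Prop) (x : X) (A : Set X) : Set X :=
  {y | ∃ n, (∃ z, (y, z) ∈ G n ∧ E x z ∧ z ∈ A) ∧ ∀ m < n, ¬ ∃ z, (y, z) ∈ G m ∧ E x z}

theorem firstHitSet_union {X : Type*} (G : ℕ → Set (X × X)) (E : X → X → Prop) (x : X)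
    (A B : Set X) : firstHitSet G E x (A ∪ B) = firstHitSet G E x A ∪ firstHitSet G E x B := by
  ext y
  constructor
  · rintro ⟨n, ⟨z, hz, hE, hA | hB⟩, hn⟩
    · exact Or.inl ⟨n, ⟨z, hz, hE, hA⟩, hn⟩
    · exact Or.inr ⟨n, ⟨z, hz, hE, hB⟩, hn⟩
  · rintro (⟨n, ⟨z, hz, hE, hA⟩, hn⟩ | ⟨n, ⟨z, hz, hE, hB⟩, hn⟩)
    · exact ⟨n, ⟨z, hz, hE, Or.inl hA⟩, hn⟩
    · exact ⟨n, ⟨z, hz, hE, Or.inr hB⟩, hn⟩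

theorem disjoint_firstHitSet {X : Type*} {G : ℕ → Set (X × X)}
    (hG : ∀ n, Set.InjOn Prod.fst (G n)) (E : X → X → Prop) (x : X) {A B : Set X}
    (hAB : Disjoint A B) : Disjoint (firstHitSet G E x A) (firstHitSet G E x B) := by
  rw [Set.disjoint_left]
  rintro y ⟨n, ⟨z, hz, hE, hA⟩, hn⟩ ⟨m, ⟨w, hw, hE', hB⟩, hm⟩
  have hnm : n = m := le_antisymm (not_lt.1 fun h => hn m h ⟨w, hw, hE'⟩)
    (not_lt.1 fun h => hm n h ⟨z, hz, hE⟩)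
  subst hnm
  have : z = w := congrArg Prod.snd (hG n hz hw rfl)
  exact Set.disjoint_left.1 hAB hA (this ▸ hB)

theorem firstHitSet_eq_of_subset {X : Type*} {G : ℕ → Set (X × X)} {E : X → X → Prop} {x : X}
    {A : Set X} (hA : {y | E x y} ⊆ A) :
    firstHitSet G E x A = {y | ∃ z, (y, z) ∈ ⋃ n, G n ∧ E x z} := by
  classical
  ext y
  constructor
  · rintro ⟨n, ⟨z, hz, hE, -⟩, -⟩
    exact ⟨z, Set.mem_iUnion.2 ⟨n, hz⟩, hE⟩
  · rintro ⟨z, hz, hE⟩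
    obtain ⟨n, hn⟩ := Set.mem_iUnion.1 hz
    have hex : ∃ n, ∃ z, (y, z) ∈ G n ∧ E x z := ⟨n, z, hn, hE⟩
    obtain ⟨w, hw, hEw⟩ := Nat.find_spec hex
    exact ⟨Nat.find hex, ⟨w, hw, hEw, hA hEw⟩, fun m hm => Nat.find_min hex hm⟩

theorem measurableSet_firstHitSet {X : Type*} [MeasurableSpace X] [StandardBorelSpace X]
    {G : ℕ → Set (X × X)} (hGm : ∀ n, MeasurableSet (G n)) (hG : ∀ n, Set.InjOn Prod.fst (G n))
    {E : X → X → Prop} (hE : MeasurableSet {p : X × X | E p.1 p.2}) {A : Set (X × X)}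
    (hA : MeasurableSet A) :
    MeasurableSet {p : X × X | p.2 ∈ firstHitSet G E p.1 {z | (p.1, z) ∈ A}} := by
  have hit (n : ℕ) (B : Set (X × X)) (hB : MeasurableSet B) :
      MeasurableSet {p : X × X | ∃ z, (p.2, z) ∈ G n ∧ E p.1 z ∧ (p.1, z) ∈ B} := by
    have hmeas : MeasurableSet {q : (X × X) × X |
        (q.1.2, q.2) ∈ G n ∧ E q.1.1 q.2 ∧ (q.1.1, q.2) ∈ B} :=
      ((measurable_snd.comp measurable_fst).prodMk measurable_snd (hGm n)).inter
        (((measurable_fst.comp measurable_fst).prodMk measurable_snd hE).inter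
          ((measurable_fst.comp measurable_fst).prodMk measurable_snd hB))
    convert hmeas.image_of_measurable_injOn measurable_fst ?_
    · ext p
      simp
    · rintro ⟨p, z⟩ ⟨hz, -⟩ ⟨q, w⟩ ⟨hw, -⟩ (rfl : p = q)
      have : (p.2, z) = (p.2, w) := hG n hz hw rfl
      exact congrArg (Prod.mk p) (Prod.ext_iff.1 this).2
  have : {p : X × X | p.2 ∈ firstHitSet G E p.1 {z | (p.1, z) ∈ A}} =
      ⋃ n, ({p : X × X | ∃ z, (p.2, z) ∈ G n ∧ E p.1 z ∧ (p.1, z) ∈ A} ∩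
        ⋂ m, ⋂ (_ : m < n),
          {p : X × X | ∃ z, (p.2, z) ∈ G m ∧ E p.1 z ∧ (p.1, z) ∈ Set.univ}ᶜ) := by
    ext p
    simp [firstHitSet]
  rw [this]
  exact MeasurableSet.iUnion fun n => (hit n A hA).inter <| MeasurableSet.iInter fun m =>
    MeasurableSet.iInter fun _ => (hit m _ MeasurableSet.univ).compl

/-- A countable Borel subequivalence relation of a μ-amenable countable Borel
equivalence relation is μ-amenable. -/
theorem mu_amenable_of_subrelation
    {X : Type*} [MeasurableSpace X] [StandardBorelSpace X]
    (μ : Measure X) [SigmaFinite μ]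
    (F : X → X → Prop) (hFEquiv : Equivalence F)
    (hFBorel : MeasurableSet {p : X × X | F p.1 p.2})
    (hFCtble : ∀ x, {y | F x y}.Countable)
    (E : X → X → Prop) (hEEquiv : Equivalence E)
    (hEBorel : MeasurableSet {p : X × X | E p.1 p.2})
    (hECtble : ∀ x, {y | E x y}.Countable)
    (hsub : ∀ x y, E x y → F x y)
    (hF : MuAmenable μ F) :
    MuAmenable μ E := by
  obtain ⟨G, hGm, hG, hGF⟩ := exists_measurable_graphs_iUnion_eq hFBorel hFCtble
  obtain ⟨ν, hnonneg, -, hadd, hclass, hinv, hmeas⟩ := hF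
  have hfull (x : X) (A : Set X) (hA : {y | E x y} ⊆ A) : ν x (firstHitSet G E x A) = 1 := by
    rw [firstHitSet_eq_of_subset hA, hGF, ← hclass x]
    congr 1
    ext y
    constructor
    · rintro ⟨z, hyz, hxz⟩
      exact hFEquiv.trans (hsub _ _ hxz) (hFEquiv.symm hyz)
    · exact fun hxy => ⟨x, hFEquiv.symm hxy, hEEquiv.refl x⟩
  refine ⟨fun x A => ν x (firstHitSet G E x A), fun x A => hnonneg _ _,
    fun x => hfull x _ (Set.subset_univ _), fun x A B hAB => ?_, fun x => hfull x _ subset_rfl,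
    fun x y hxy => ?_, fun A hA => ?_⟩
  · simp only [firstHitSet_union, hadd _ _ _ (disjoint_firstHitSet hG E x hAB)]
  · have hExy : E x = E y := funext fun z =>
      propext ⟨hEEquiv.trans (hEEquiv.symm hxy), hEEquiv.trans hxy⟩
    funext A
    simp only [firstHitSet, hinv x y (hsub x y hxy), hExy]
  · exact hmeas _ (measurableSet_firstHitSet hGm hG hEBorel hA)
end

section
/- (Ghys–Carrière) Every nondiscrete subgroup of PSL₂(ℝ) is either solvable or contains a nondiscrete free subgroup on two generators; that is, if Γ ≤ PSL₂(ℝ) is a subgroup that is not discrete in the subspace topology, then either Γ is solvable, or there exist a, b ∈ Γ such that the group homomorphism from the free group on two generators to PSL₂(ℝ) sending the generators to a and b is injective and its image is not discrete in the subspace topology. -/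
/-- SL₂(ℝ) topologized as a subspace of the space of 2 × 2 real matrices. -/
noncomputable instance : TopologicalSpace (Matrix.SpecialLinearGroup (Fin 2) ℝ) :=
  TopologicalSpace.induced (fun g => (g : Matrix (Fin 2) (Fin 2) ℝ)) inferInstance

/-- PSL₂(ℝ): the quotient of SL₂(ℝ) by its center {±I}, with the quotient topology. -/
abbrev PSL2R : Type :=
  Matrix.SpecialLinearGroup (Fin 2) ℝ ⧸ Subgroup.center (Matrix.SpecialLinearGroup (Fin 2) ℝ)

open Matrix Filter Topology
open scoped MatrixGroups

local notation "M₂(" K ")" => Matrix (Fin 2) (Fin 2) K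

/-- The diagonal matrix with entries `u`, `u⁻¹`, as an element of `SL₂`. -/
def diagSL {K : Type*} [CommRing K] (u : Kˣ) : SL(2, K) :=
  ⟨!![(u : K), 0; 0, ((u⁻¹ : Kˣ) : K)], by simp [Matrix.det_fin_two]⟩

lemma coe_diagSL {K : Type*} [CommRing K] (u : Kˣ) :
    (diagSL u : Matrix (Fin 2) (Fin 2) K) = !![(u : K), 0; 0, ((u⁻¹ : Kˣ) : K)] := rfl

lemma diagSL_pow {K : Type*} [CommRing K] (u : Kˣ) (n : ℕ) : diagSL u ^ n = diagSL (u ^ n) := by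
  induction n with
  | zero => exact Subtype.ext (by simp [coe_diagSL, Matrix.one_fin_two])
  | succ n ih =>
    rw [pow_succ, ih]
    exact Subtype.ext (by
      simp [coe_diagSL, Matrix.SpecialLinearGroup.coe_mul, pow_succ, mul_comm])

lemma diagSL_inv {K : Type*} [CommRing K] (u : Kˣ) : (diagSL u)⁻¹ = diagSL u⁻¹ :=
  Subtype.ext (by
    simp [coe_diagSL, Matrix.SpecialLinearGroup.coe_inv, Matrix.adjugate_fin_two])

/-- `SL₂` acting on nonzero vectors. -/
@[reducible] def nonzeroVecAction (K : Type*) [Field K] :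
    MulAction SL(2, K) {v : Fin 2 → K // v ≠ 0} where
  smul g v := ⟨(g : Matrix (Fin 2) (Fin 2) K) *ᵥ v.1, fun h => v.2 <| by
    have : ((g⁻¹ : SL(2, K)) : Matrix (Fin 2) (Fin 2) K) *ᵥ
        ((g : Matrix (Fin 2) (Fin 2) K) *ᵥ v.1) = 0 := by rw [h, Matrix.mulVec_zero]
    rwa [Matrix.mulVec_mulVec, ← Matrix.SpecialLinearGroup.coe_mul, inv_mul_cancel,
      Matrix.SpecialLinearGroup.coe_one, Matrix.one_mulVec] at this⟩
  one_smul v := Subtype.ext (by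
    change ((1 : SL(2, K)) : Matrix (Fin 2) (Fin 2) K) *ᵥ v.1 = v.1
    simp)
  mul_smul g h v := Subtype.ext (by
    change ((g * h : SL(2, K)) : Matrix (Fin 2) (Fin 2) K) *ᵥ v.1 =
      (g : Matrix (Fin 2) (Fin 2) K) *ᵥ ((h : Matrix (Fin 2) (Fin 2) K) *ᵥ v.1)
    rw [Matrix.mulVec_mulVec, Matrix.SpecialLinearGroup.coe_mul])

section PingPong

variable {Ω : Type} [NormedField Ω]

/-- Two cones of radius `ε` around lines whose slopes are separated by `ε` do not meet. -/
lemma cone_disjoint {p q r s u w : Ω} {ε m M : ℝ} (hε : 0 < ε) (hε1 : ε ≤ 1) (hεM : 3 * (ε * M) ≤ m)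
    (hp : ‖p‖ ≤ M) (hq : ‖q‖ ≤ M) (hs : ‖s‖ ≤ M) (hr : m ≤ ‖r‖)
    (huw : ‖w‖ < ε * ‖u‖) (h : ‖r * u + s * w‖ < ε * ‖p * u + q * w‖) : False := by
  have hu : 0 < ‖u‖ := by
    by_contra h0
    have : ‖u‖ = 0 := le_antisymm (not_lt.1 h0) (norm_nonneg _)
    rw [this] at huw; simp at huw; exact absurd huw (not_lt.2 (norm_nonneg _))
  have hM : 0 ≤ M := (norm_nonneg _).trans hp
  have h1 : ‖r‖ * ‖u‖ ≤ ‖r * u + s * w‖ + ‖s‖ * ‖w‖ := by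
    rw [← norm_mul, ← norm_mul]
    calc ‖r * u‖ = ‖(r * u + s * w) - s * w‖ := by ring_nf
      _ ≤ _ := norm_sub_le _ _
  have h2 : ‖p * u + q * w‖ ≤ ‖p‖ * ‖u‖ + ‖q‖ * ‖w‖ := by
    rw [← norm_mul, ← norm_mul]; exact norm_add_le _ _
  have h3 : ‖s‖ * ‖w‖ ≤ M * (ε * ‖u‖) := by gcongr
  have h4 : ‖p‖ * ‖u‖ ≤ M * ‖u‖ := by gcongr
  have hwu : ‖w‖ ≤ ‖u‖ := huw.le.trans (by nlinarith)
  have h5 : ‖q‖ * ‖w‖ ≤ M * ‖u‖ := by gcongr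
  have h6 : m * ‖u‖ ≤ ‖r‖ * ‖u‖ := by gcongr
  have h7 : ε * ‖p * u + q * w‖ ≤ ε * (2 * (M * ‖u‖)) := by
    gcongr; linarith
  have h8 : 3 * (ε * M) * ‖u‖ ≤ m * ‖u‖ := by gcongr
  nlinarith

lemma exists_injective_lift_of_one_lt_norm (u : Ωˣ) (hu : 1 < ‖(u : Ω)‖) (g : SL(2, Ω))
    (hg : ∀ i j, g i j ≠ 0) :
    ∃ n : ℕ, 0 < n ∧ Function.Injective (FreeGroup.lift fun i : Bool =>
      if i then diagSL u ^ n else g * diagSL u ^ n * g⁻¹) := by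
  obtain ⟨m, hm, hmg⟩ : ∃ m > 0, ∀ i j, m ≤ ‖g i j‖ := by
    refine ⟨min (min ‖g 0 0‖ ‖g 0 1‖) (min ‖g 1 0‖ ‖g 1 1‖), ?_, ?_⟩
    · simp [hg]
    · intro i j; fin_cases i <;> fin_cases j <;> simp
  obtain ⟨M, hM, hMg⟩ : ∃ M > 0, ∀ i j, ‖g i j‖ ≤ M := by
    refine ⟨max (max ‖g 0 0‖ ‖g 0 1‖) (max ‖g 1 0‖ ‖g 1 1‖), ?_, ?_⟩
    · simp [hg]
    · intro i j; fin_cases i <;> fin_cases j <;> simp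
  obtain ⟨ε, hε, hε1, hεM⟩ : ∃ ε : ℝ, 0 < ε ∧ ε < 1 ∧ 3 * (ε * M) ≤ m := by
    refine ⟨min (1 / 2) (m / (3 * M)), by positivity, by
      exact (min_le_left _ _).trans_lt (by norm_num), ?_⟩
    have : min (1 / 2) (m / (3 * M)) * M ≤ m / (3 * M) * M := by gcongr; exact min_le_right _ _
    have h2 : 3 * (m / (3 * M) * M) = m := by field_simp
    linarith
  obtain ⟨n, hn⟩ := pow_unbounded_of_one_lt (1 / ε) hu
  have hn0 : 0 < n := by
    rcases Nat.eq_zero_or_pos n with rfl | h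
    · have := (div_lt_one hε).1 (hn.trans_eq (pow_zero _)); linarith
    · exact h
  refine ⟨n, hn0, ?_⟩
  rw [diagSL_pow]
  set v : Ωˣ := u ^ n with hv
  have hvn : 1 < ε * ‖(v : Ω)‖ := by
    rw [hv, Units.val_pow_eq_pow_val, norm_pow]
    rwa [div_lt_iff₀ hε, mul_comm] at hn
  let _ := nonzeroVecAction Ω
  let α := {v : Fin 2 → Ω // v ≠ 0}
  have smul_val (h : SL(2, Ω)) (x : α) : (h • x).1 = (h : Matrix (Fin 2) (Fin 2) Ω) *ᵥ x.1 := rfl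
  let XA : Set α := {x | ‖x.1 1‖ < ε * ‖x.1 0‖}
  let YA : Set α := {x | ‖x.1 0‖ < ε * ‖x.1 1‖}
  have key : ∀ x y : Ω, ¬ (x = 0 ∧ y = 0) → ¬ ‖x‖ < ε * ‖y‖ →
      ‖((v⁻¹ : Ωˣ) : Ω) * y‖ < ε * ‖(v : Ω) * x‖ := by
    intro x y h0 hxy
    have hx : 0 < ‖x‖ := by
      rw [norm_pos_iff]; rintro rfl
      refine hxy ?_
      have : 0 < ‖y‖ := by rw [norm_pos_iff]; rintro rfl; exact h0 ⟨rfl, rfl⟩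
      simp; positivity
    rw [norm_mul, norm_mul, Units.val_inv_eq_inv_val, norm_inv]
    have hv0 : 0 < ‖(v : Ω)‖ := by simp
    rw [inv_mul_lt_iff₀ hv0]
    push Not at hxy
    have h1 : ε * ‖y‖ < ε * (‖(v : Ω)‖ * (ε * (‖(v : Ω)‖ * ‖x‖))) := by
      calc ε * ‖y‖ ≤ 1 * 1 * ‖x‖ := by linarith
        _ < (ε * ‖(v : Ω)‖) * (ε * ‖(v : Ω)‖) * ‖x‖ := by gcongr
        _ = _ := by ring
    exact lt_of_mul_lt_mul_left h1 hε.le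
  have hA1 : ∀ x : α, x ∉ YA → diagSL v • x ∈ XA := by
    intro x hx
    have := key (x.1 0) (x.1 1) (fun h => x.2 (by ext i; fin_cases i; exacts [h.1, h.2])) hx
    simpa [XA, smul_val, coe_diagSL, Matrix.mulVec, dotProduct, Fin.sum_univ_two] using this
  have hA2 : ∀ x : α, x ∉ XA → (diagSL v)⁻¹ • x ∈ YA := by
    intro x hx
    have := key (x.1 1) (x.1 0) (fun h => x.2 (by ext i; fin_cases i; exacts [h.2, h.1])) hx
    rw [diagSL_inv]
    simpa [YA, smul_val, coe_diagSL, Matrix.mulVec, dotProduct, Fin.sum_univ_two] using this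
  have hXYA : ∀ x : α, x ∈ XA → x ∉ YA := by
    intro x h1 h2
    have h1 : ‖x.1 1‖ < ε * ‖x.1 0‖ := h1
    have h2 : ‖x.1 0‖ < ε * ‖x.1 1‖ := h2
    nlinarith [norm_nonneg (x.1 0), norm_nonneg (x.1 1)]
  have hgx : ∀ x : α, x.1 0 = g 0 0 * (g⁻¹ • x).1 0 + g 0 1 * (g⁻¹ • x).1 1 ∧
      x.1 1 = g 1 0 * (g⁻¹ • x).1 0 + g 1 1 * (g⁻¹ • x).1 1 := by
    intro x
    have h : x.1 = (g : Matrix (Fin 2) (Fin 2) Ω) *ᵥ (g⁻¹ • x).1 := by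
      rw [← smul_val, smul_inv_smul]
    constructor
    · conv_lhs => rw [h]
      simp [Matrix.mulVec, dotProduct, Fin.sum_univ_two]
    · conv_lhs => rw [h]
      simp [Matrix.mulVec, dotProduct, Fin.sum_univ_two]
  have hXX : ∀ x : α, x ∈ XA → g⁻¹ • x ∉ XA := by
    intro x h1 h2
    have h1 : ‖x.1 1‖ < ε * ‖x.1 0‖ := h1
    rw [(hgx x).1, (hgx x).2] at h1
    exact cone_disjoint hε hε1.le hεM (hMg 0 0) (hMg 0 1) (hMg 1 1) (hmg 1 0) h2 h1
  have hXY : ∀ x : α, x ∈ XA → g⁻¹ • x ∉ YA := by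
    intro x h1 h2
    have h1 : ‖x.1 1‖ < ε * ‖x.1 0‖ := h1
    rw [(hgx x).1, (hgx x).2, add_comm, add_comm (g 0 0 * _)] at h1
    exact cone_disjoint hε hε1.le hεM (hMg 0 1) (hMg 0 0) (hMg 1 0) (hmg 1 1) h2 h1
  have hYX : ∀ x : α, x ∈ YA → g⁻¹ • x ∉ XA := by
    intro x h1 h2
    have h1 : ‖x.1 0‖ < ε * ‖x.1 1‖ := h1
    rw [(hgx x).1, (hgx x).2] at h1
    exact cone_disjoint hε hε1.le hεM (hMg 1 0) (hMg 1 1) (hMg 0 1) (hmg 0 0) h2 h1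
  have hYY : ∀ x : α, x ∈ YA → g⁻¹ • x ∉ YA := by
    intro x h1 h2
    have h1 : ‖x.1 0‖ < ε * ‖x.1 1‖ := h1
    rw [(hgx x).1, (hgx x).2, add_comm, add_comm (g 1 0 * _)] at h1
    exact cone_disjoint hε hε1.le hεM (hMg 1 1) (hMg 1 0) (hMg 0 0) (hmg 0 1) h2 h1
  let e0 : α := ⟨![1, 0], fun h => by simpa using congrFun h 0⟩
  have he0 : e0 ∈ XA := by simp [XA, e0, hε]
  refine FreeGroup.injective_lift_of_ping_pong (α := α) _
    (fun i : Bool => if i then XA else {x | g⁻¹ • x ∈ XA})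
    (fun i : Bool => if i then YA else {x | g⁻¹ • x ∈ YA}) ?_ ?_ ?_ ?_ ?_ ?_
  · rintro (_ | _)
    · exact ⟨g • e0, by simpa using he0⟩
    · exact ⟨e0, by simpa using he0⟩
  · rintro (_ | _) (_ | _) hij
    · exact absurd rfl hij
    · exact Set.disjoint_left.2 fun x h1 h2 => hXX x (by simpa using h2) (by simpa using h1)
    · exact Set.disjoint_left.2 fun x h1 h2 => hXX x (by simpa using h1) (by simpa using h2)
    · exact absurd rfl hij
  · rintro (_ | _) (_ | _) hij
    · exact absurd rfl hij
    · exact Set.disjoint_left.2 fun x h1 h2 => hYY x (by simpa using h2) (by simpa using h1)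
    · exact Set.disjoint_left.2 fun x h1 h2 => hYY x (by simpa using h1) (by simpa using h2)
    · exact absurd rfl hij
  · rintro (_ | _) (_ | _)
    · exact Set.disjoint_left.2 fun x h1 h2 => hXYA _ (by simpa using h1) (by simpa using h2)
    · exact Set.disjoint_left.2 fun x h1 h2 => hYX x (by simpa using h2) (by simpa using h1)
    · exact Set.disjoint_left.2 fun x h1 h2 => hXY x (by simpa using h1) (by simpa using h2)
    · exact Set.disjoint_left.2 fun x h1 h2 => hXYA _ (by simpa using h1) (by simpa using h2)
  · rintro (_ | _) _ ⟨x, hx, rfl⟩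
    · have := hA1 (g⁻¹ • x) (by simpa using hx)
      simpa [mul_smul] using this
    · simpa using hA1 x (by simpa using hx)
  · rintro (_ | _) _ ⟨x, hx, rfl⟩
    · have := hA2 (g⁻¹ • x) (by simpa using hx)
      simpa [mul_smul, mul_assoc] using this
    · simpa using hA2 x (by simpa using hx)

end PingPong

lemma FreeGroup.injective_lift_of_inv {ι G : Type*} [Group G] {a : ι → G}
    (h : Function.Injective (FreeGroup.lift fun i => (a i)⁻¹)) :
    Function.Injective (FreeGroup.lift a) := by
  let θ : FreeGroup ι →* FreeGroup ι := FreeGroup.lift fun i => (FreeGroup.of i)⁻¹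
  have h2 : θ.comp θ = MonoidHom.id _ := by ext i; simp [θ]
  have hθ : Function.Injective θ :=
    Function.LeftInverse.injective (g := θ) fun x => DFunLike.congr_fun h2 x
  have h3 : FreeGroup.lift a = (FreeGroup.lift fun i => (a i)⁻¹).comp θ := by ext i; simp [θ]
  rw [h3]
  exact h.comp hθ

lemma exists_injective_lift_of_norm_ne_one {Ω : Type} [NormedField Ω] (u : Ωˣ)
    (hu : ‖(u : Ω)‖ ≠ 1) (g : SL(2, Ω)) (hg : ∀ i j, g i j ≠ 0) :
    ∃ n : ℕ, 0 < n ∧ Function.Injective (FreeGroup.lift fun i : Bool =>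
      if i then diagSL u ^ n else g * diagSL u ^ n * g⁻¹) := by
  rcases lt_or_gt_of_ne hu with h | h
  · have h' : 1 < ‖((u⁻¹ : Ωˣ) : Ω)‖ := by
      rw [Units.val_inv_eq_inv_val, norm_inv]
      exact (one_lt_inv₀ (by simp)).2 h
    obtain ⟨n, hn, hinj⟩ := exists_injective_lift_of_one_lt_norm u⁻¹ h' g hg
    refine ⟨n, hn, FreeGroup.injective_lift_of_inv ?_⟩
    convert hinj using 4 with i
    split_ifs <;> simp [← diagSL_inv, mul_assoc]
  · exact exists_injective_lift_of_one_lt_norm u h g hg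

lemma coeff_norm_le_one_of_roots {Ω : Type} [NormedField Ω] [IsUltrametricDist Ω]
    (s : Multiset Ω) (hs : ∀ r ∈ s, ‖r‖ ≤ 1) (i : ℕ) :
    ‖(s.map fun r => Polynomial.X - Polynomial.C r).prod.coeff i‖ ≤ 1 := by
  induction s using Multiset.induction_on generalizing i with
  | empty =>
    simp only [Multiset.map_zero, Multiset.prod_zero, Polynomial.coeff_one]
    split_ifs <;> simp
  | cons a s ih =>
    have ih' := ih fun r hr => hs r (Multiset.mem_cons_of_mem hr)
    have ha := hs a (Multiset.mem_cons_self a s)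
    rw [Multiset.map_cons, Multiset.prod_cons, sub_mul, Polynomial.coeff_sub,
      Polynomial.coeff_C_mul, sub_eq_add_neg]
    refine (IsUltrametricDist.norm_add_le_max _ _).trans (max_le ?_ ?_)
    · cases i with
      | zero => simp
      | succ i => rw [Polynomial.coeff_X_mul]; exact ih' i
    · rw [norm_neg, norm_mul]; exact mul_le_one₀ ha (norm_nonneg _) (ih' i)

lemma Rat.exists_int_of_padicNorm_le_one (c : ℚ)
    (h : ∀ (p : ℕ) [Fact p.Prime], ‖(c : ℚ_[p])‖ ≤ 1) : ∃ z : ℤ, (z : ℚ) = c := by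
  refine ⟨c.num, ?_⟩
  by_contra hne
  have hden : c.den ≠ 1 := fun h1 => hne (Rat.den_eq_one_iff c |>.1 h1)
  obtain ⟨p, hp, hpd⟩ := Nat.exists_prime_and_dvd hden
  have := Fact.mk hp
  have hmul : ((c.num : ℤ) : ℚ_[p]) = (c : ℚ_[p]) * ((c.den : ℤ) : ℚ_[p]) := by
    have := Rat.mul_den_eq_num c
    exact_mod_cast this.symm
  have hnum : ‖((c.num : ℤ) : ℚ_[p])‖ < 1 := by
    rw [hmul, norm_mul]
    have hlt := (Padic.norm_intCast_lt_one_iff (p := p) (k := (c.den : ℤ))).2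
      (by exact_mod_cast hpd)
    nlinarith [h p, norm_nonneg ((c.den : ℤ) : ℚ_[p]), norm_nonneg (c : ℚ_[p])]
  have hpn := (Padic.norm_intCast_lt_one_iff (p := p) (k := c.num)).1 hnum
  exact hp.one_lt.ne' (Nat.eq_one_of_dvd_coprimes c.reduced (Int.natCast_dvd.1 hpn) hpd)

/-- An algebraic number that is bounded by `1` in every `p`-adic embedding is integral. -/
lemma isIntegral_of_padic_norm_le_one (K : Type) [Field K] [NumberField K] (x : K)
    (h : ∀ (p : ℕ) [Fact p.Prime] (φ : K →+* PadicAlgCl p), ‖φ x‖ ≤ 1) : IsIntegral ℤ x := by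
  have hxint : IsIntegral ℚ x := Algebra.IsIntegral.isIntegral x
  have hc : ∀ i, ∃ z : ℤ, (z : ℚ) = (minpoly ℚ x).coeff i := by
    intro i
    refine Rat.exists_int_of_padicNorm_le_one _ fun p _ => ?_
    have hsplit := IsAlgClosed.splits ((minpoly ℚ x).map (algebraMap ℚ (PadicAlgCl p)))
    have hmonic := (minpoly.monic hxint).map (algebraMap ℚ (PadicAlgCl p))
    have heq := hsplit.eq_prod_roots_of_monic hmonic
    have hr : ∀ r ∈ ((minpoly ℚ x).map (algebraMap ℚ (PadicAlgCl p))).roots, ‖r‖ ≤ 1 := by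
      intro r hr
      have hroot : Polynomial.aeval r (minpoly ℚ x) = 0 := by
        have := Polynomial.isRoot_of_mem_roots hr
        rwa [Polynomial.IsRoot, Polynomial.eval_map_algebraMap] at this
      obtain ⟨φ, hφ⟩ : ∃ φ : K →ₐ[ℚ] PadicAlgCl p, φ x = r := by
        have := (Algebra.IsAlgebraic.range_eval_eq_rootSet_minpoly (F := ℚ) (K := K)
          (PadicAlgCl p) x)
        have hmem : r ∈ (minpoly ℚ x).rootSet (PadicAlgCl p) :=
          (Polynomial.mem_rootSet_of_ne (minpoly.ne_zero hxint)).2 hroot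
        rw [← this] at hmem
        exact hmem
      rw [← hφ]; exact h p φ.toRingHom
    have := coeff_norm_le_one_of_roots _ hr i
    rw [← heq, Polynomial.coeff_map] at this
    rw [← PadicAlgCl.norm_extends]
    simpa using this
  choose z hz using hc
  have hlift : minpoly ℚ x ∈ Polynomial.lifts (Int.castRingHom ℚ) :=
    (Polynomial.lifts_iff_coeff_lifts _).2 fun i => ⟨z i, hz i⟩
  obtain ⟨q, hq, -, hqm⟩ := Polynomial.lifts_and_degree_eq_and_monic hlift (minpoly.monic hxint)
  refine ⟨q, hqm, ?_⟩
  have h0 : Polynomial.aeval x (minpoly ℚ x) = 0 := minpoly.aeval _ _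
  rw [← hq, Polynomial.aeval_def, Polynomial.eval₂_map] at h0
  rwa [RingHom.ext_int (algebraMap ℤ K) ((algebraMap ℚ K).comp (Int.castRingHom ℚ))]

/-- A complex number of modulus one which is not a root of unity can be moved off the unit
circle by an embedding into some algebraically closed normed field. -/
lemma exists_embedding_norm_ne_one (l : ℂ) (hl : ‖l‖ = 1) (hroot : ∀ n : ℕ, 0 < n → l ^ n ≠ 1) :
    ∃ (k : Type) (_ : Field k) (f : k →+* ℂ) (x : k) (Ω : Type) (_ : NormedField Ω)
      (_ : IsAlgClosed Ω) (φ : k →+* Ω), f x = l ∧ ‖φ x‖ ≠ 1 := by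
  by_cases hal : IsAlgebraic ℚ l
  · have hxint : IsIntegral ℚ l := hal.isIntegral
    let K := IntermediateField.adjoin ℚ {l}
    have : FiniteDimensional ℚ K := IntermediateField.adjoin.finiteDimensional hxint
    have : NumberField K := ⟨⟩
    let x : K := IntermediateField.AdjoinSimple.gen ℚ l
    have hx : algebraMap K ℂ x = l := IntermediateField.AdjoinSimple.algebraMap_gen ℚ l
    by_cases hp : ∀ (p : ℕ) [Fact p.Prime] (φ : K →+* PadicAlgCl p), ‖φ x‖ ≤ 1
    · have hxi := isIntegral_of_padic_norm_le_one K x hp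
      by_contra hcon
      push Not at hcon
      obtain ⟨n, hn, hxn⟩ := NumberField.Embeddings.pow_eq_one_of_norm_eq_one K ℂ hxi fun φ =>
        hcon K inferInstance (algebraMap K ℂ) x ℂ inferInstance inferInstance φ hx
      exact hroot n hn (by rw [← hx, ← map_pow, hxn, map_one])
    · push Not at hp
      obtain ⟨p, hpp, φ, hφ⟩ := hp
      exact ⟨K, inferInstance, algebraMap K ℂ, x, PadicAlgCl p, inferInstance,
        inferInstanceAs (IsAlgClosed (AlgebraicClosure ℚ_[p])), φ, hx, hφ.ne'⟩
  · have htr : ∀ c : ℂ, Transcendental ℚ c → ∃ f : RatFunc ℚ →+* ℂ, f RatFunc.X = c := by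
      intro c hc
      have hinj : Function.Injective (Polynomial.aeval (R := ℚ) c) :=
        transcendental_iff_injective.1 hc
      refine ⟨RatFunc.liftRingHom (Polynomial.aeval c).toRingHom
        (nonZeroDivisors_le_comap_nonZeroDivisors_of_injective _ hinj), ?_⟩
      rw [RatFunc.liftRingHom_X]
      exact Polynomial.aeval_X c
    obtain ⟨f, hf⟩ := htr l hal
    have h2 : Transcendental ℚ (2 * l) := by
      intro h
      apply hal
      have : l = algebraMap ℚ ℂ (1 / 2) * (2 * l) := by simp
      rw [this]
      exact (isAlgebraic_algebraMap _).mul h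
    obtain ⟨φ, hφ⟩ := htr (2 * l) h2
    refine ⟨RatFunc ℚ, inferInstance, f, RatFunc.X, ℂ, inferInstance, inferInstance, φ, hf, ?_⟩
    rw [hφ, norm_mul, hl]; norm_num

lemma exists_algHom_of_finiteType {k F Ω : Type} [Field k] [Field F] [Field Ω] [IsAlgClosed Ω]
    [Algebra k F] [Algebra k Ω] [Algebra.FiniteType k F] : Nonempty (F →ₐ[k] Ω) := by
  have : Module.Finite k F := finite_of_finite_type_of_isJacobsonRing _ _
  exact ⟨IsAlgClosed.lift⟩

/-- A finitely generated subring of a field extension specializes to the algebraic closure. -/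
lemma exists_ringHom_of_finiteType {k A Ω : Type} [Field k] [CommRing A] [Nontrivial A] [Field Ω]
    [IsAlgClosed Ω] [Algebra k A] [Algebra.FiniteType k A] (φ : k →+* Ω) :
    ∃ ψ : A →+* Ω, ∀ c : k, ψ (algebraMap k A c) = φ c := by
  let _ := φ.toAlgebra
  obtain ⟨m, hm⟩ := Ideal.exists_maximal A
  let _ := Ideal.Quotient.field m
  obtain ⟨θ⟩ := exists_algHom_of_finiteType (k := k) (F := A ⧸ m) (Ω := Ω)
  exact ⟨θ.toRingHom.comp (Ideal.Quotient.mk m), fun c => θ.commutes c⟩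

theorem exists_injective_lift_diagSL (u : ℂˣ) (hu : ‖(u : ℂ)‖ = 1)
    (hroot : ∀ n : ℕ, 0 < n → (u : ℂ) ^ n ≠ 1) (g : SL(2, ℂ)) (hg : ∀ i j, g i j ≠ 0) :
    ∃ n : ℕ, 0 < n ∧ Function.Injective (FreeGroup.lift fun i : Bool =>
      if i then diagSL u ^ n else g * diagSL u ^ n * g⁻¹) := by
  obtain ⟨k, _, f, x, Ω, _, _, φ, hfx, hφx⟩ := exists_embedding_norm_ne_one u hu hroot
  let _ := f.toAlgebra
  let S : Set ℂ := Set.range (fun ij : Fin 2 × Fin 2 => g ij.1 ij.2) ∪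
    Set.range (fun ij : Fin 2 × Fin 2 => (g ij.1 ij.2)⁻¹)
  have hS : S.Finite := (Set.finite_range _).union (Set.finite_range _)
  let B := Algebra.adjoin k S
  have : Algebra.FiniteType k B := Algebra.FiniteType.adjoin_of_finite hS
  obtain ⟨ψ, hψ⟩ := exists_ringHom_of_finiteType (A := B) φ
  have hx0 : x ≠ 0 := by rintro rfl; rw [map_zero] at hfx; exact u.ne_zero hfx.symm
  let uk : kˣ := Units.mk0 x hx0
  let uB : Bˣ := Units.map (algebraMap k B).toMonoidHom uk
  let ι : B →+* ℂ := B.val.toRingHom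
  have hι : Function.Injective ι := Subtype.val_injective
  have huB : Units.map (ι : B →* ℂ) uB = u := Units.ext hfx
  let gB : SL(2, B) := ⟨Matrix.of fun i j => ⟨g i j, Algebra.subset_adjoin (.inl ⟨(i, j), rfl⟩)⟩, by
    apply hι
    rw [RingHom.map_det, map_one]
    exact g.det_coe⟩
  have hgB : Matrix.SpecialLinearGroup.map ι gB = g := rfl
  have hdiag : ∀ {C : Type} [CommRing C] (θ : B →+* C),
      Matrix.SpecialLinearGroup.map θ (diagSL uB) = diagSL (Units.map θ.toMonoidHom uB) := by
    intro C _ θ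
    ext i j; fin_cases i <;> fin_cases j <;> simp [coe_diagSL]
  have hunit : ∀ i j, IsUnit (gB i j) := fun i j =>
    IsUnit.of_mul_eq_one (⟨(g i j)⁻¹, Algebra.subset_adjoin (.inr ⟨(i, j), rfl⟩)⟩ : B)
      (Subtype.ext (mul_inv_cancel₀ (hg i j)))
  obtain ⟨n, hn, hinj⟩ := exists_injective_lift_of_norm_ne_one (Units.map ψ.toMonoidHom uB)
    (by change ‖ψ (algebraMap k B x)‖ ≠ 1; rwa [hψ]) (Matrix.SpecialLinearGroup.map ψ gB)
    (fun i j => ((hunit i j).map ψ).ne_zero)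
  refine ⟨n, hn, ?_⟩
  let F : FreeGroup Bool →* SL(2, B) := FreeGroup.lift fun i : Bool =>
      if i then diagSL uB ^ n else gB * diagSL uB ^ n * gB⁻¹
  have hF : Function.Injective F := by
    refine Function.Injective.of_comp (f := Matrix.SpecialLinearGroup.map ψ) ?_
    rw [← MonoidHom.coe_comp]
    convert hinj using 2
    ext1 i
    simp only [F, MonoidHom.comp_apply, FreeGroup.lift_apply_of]
    split_ifs <;> simp [hdiag]
  have hmap : Function.Injective (Matrix.SpecialLinearGroup.map (n := Fin 2) ι) := by
    intro a b hab
    ext i j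
    have := congrArg (fun M : SL(2, ℂ) => M i j) hab
    exact congrArg Subtype.val (hι this)
  have : (FreeGroup.lift fun i : Bool => if i then diagSL u ^ n else g * diagSL u ^ n * g⁻¹) =
      (Matrix.SpecialLinearGroup.map ι).comp F := by
    ext1 i
    simp only [F, MonoidHom.comp_apply, FreeGroup.lift_apply_of]
    split_ifs <;> simp [hdiag, hgB] <;> rw [huB]
  rw [this]
  exact hmap.comp hF

lemma coe_mul_coe_inv {K : Type*} [CommRing K] (γ : SL(2, K)) :
    (γ : M₂(K)) * (↑(γ⁻¹) : M₂(K)) = 1 := by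
  rw [← Matrix.SpecialLinearGroup.coe_mul, mul_inv_cancel, Matrix.SpecialLinearGroup.coe_one]

lemma coe_inv_mul_coe {K : Type*} [CommRing K] (γ : SL(2, K)) :
    (↑(γ⁻¹) : M₂(K)) * (γ : M₂(K)) = 1 := by
  rw [← Matrix.SpecialLinearGroup.coe_mul, inv_mul_cancel, Matrix.SpecialLinearGroup.coe_one]

/-- The commutant of a nonscalar `2 × 2` matrix `X` is spanned by `1` and `X`. -/
lemma exists_eq_smul_add_smul_of_commute {K : Type*} [Field K] {X A : Matrix (Fin 2) (Fin 2) K}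
    (hX : ∀ c : K, X ≠ c • 1) (h : A * X = X * A) : ∃ p q : K, A = p • 1 + q • X := by
  have h00 := congrFun (congrFun h 0) 0
  have h01 := congrFun (congrFun h 0) 1
  have h10 := congrFun (congrFun h 1) 0
  simp only [mul_apply, Fin.sum_univ_two] at h00 h01 h10
  have key : ∀ p q : K, A 0 0 = p + q * X 0 0 → A 0 1 = q * X 0 1 → A 1 0 = q * X 1 0 →
      A 1 1 = p + q * X 1 1 → ∃ p q : K, A = p • 1 + q • X := by
    intro p q h1 h2 h3 h4
    refine ⟨p, q, ?_⟩
    ext i j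
    fin_cases i <;> fin_cases j <;> simp [h1, h2, h3, h4]
  by_cases hb : X 0 1 = 0
  · by_cases hc : X 1 0 = 0
    · have hd : X 0 0 - X 1 1 ≠ 0 := by
        intro hd
        refine hX (X 0 0) ?_
        ext i j
        fin_cases i <;> fin_cases j <;> simp [hb, hc]
        linear_combination -hd
      have e1 : A 0 1 = 0 := by
        refine (mul_eq_zero.1 ?_).resolve_right hd
        rw [hb] at h01
        linear_combination -h01
      have e2 : A 1 0 = 0 := by
        refine (mul_eq_zero.1 ?_).resolve_right hd
        rw [hc] at h10
        linear_combination h10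
      refine key (A 0 0 - (A 0 0 - A 1 1) / (X 0 0 - X 1 1) * X 0 0)
        ((A 0 0 - A 1 1) / (X 0 0 - X 1 1)) (by ring) (by simp [e1, hb]) (by simp [e2, hc]) ?_
      field_simp
      ring
    · refine key (A 0 0 - A 1 0 / X 1 0 * X 0 0) (A 1 0 / X 1 0) (by ring) ?_ (by field_simp) ?_
      · field_simp
        linear_combination h00
      · field_simp
        linear_combination h10
  · refine key (A 0 0 - A 0 1 / X 0 1 * X 0 0) (A 0 1 / X 0 1) (by ring) (by field_simp) ?_ ?_
    · field_simp
      linear_combination -h00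
    · field_simp
      linear_combination -h01

open scoped commutatorElement in
/-- A group of matrices of determinant one that preserves the line spanned by a nonzero traceless
matrix `X`, up to matrices commuting with `X`, is solvable. -/
lemma isSolvable_of_conj_commute {K : Type*} [Field K] [NeZero (2 : K)]
    {H : Subgroup SL(2, K)} {X : Matrix (Fin 2) (Fin 2) K}
    (hX : X ≠ 0) (htr : X.trace = 0)
    (h : ∀ γ ∈ H, ((γ : M₂(K)) * X * (↑(γ⁻¹) : M₂(K))) * X =
      X * ((γ : M₂(K)) * X * (↑(γ⁻¹) : M₂(K)))) : Group.IsSolvable H := by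
  have h2 : (2 : K) ≠ 0 := NeZero.ne 2
  have hns : ∀ c : K, X ≠ c • 1 := by
    rintro c rfl
    simp at htr
    rcases htr with rfl | htr
    · simp at hX
    · exact h2 htr
  have hq : ∀ γ ∈ H, ∃ q : K, (γ : M₂(K)) * X = q • (X * (γ : M₂(K))) := by
    intro γ hγ
    obtain ⟨p, q, hpq⟩ := exists_eq_smul_add_smul_of_commute hns (h γ hγ)
    have ht : ((γ : M₂(K)) * X * (↑(γ⁻¹) : M₂(K))).trace = 0 := by
      rw [trace_mul_comm, ← mul_assoc, coe_inv_mul_coe, one_mul, htr]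
    have hp : p = 0 := by
      rw [hpq, trace_add, trace_smul, trace_smul, htr] at ht
      simpa [h2] using ht
    refine ⟨q, ?_⟩
    have := congrArg (· * (γ : M₂(K))) hpq
    simpa [hp, mul_assoc, coe_inv_mul_coe, -Matrix.SpecialLinearGroup.coe_inv] using this
  choose! q hq using hq
  -- commutators commute with `X`
  have hcomm : ∀ a ∈ H, ∀ b ∈ H, (↑(⁅a, b⁆) : M₂(K)) * X = X * (↑(⁅a, b⁆) : M₂(K)) := by
    intro a ha b hb
    have hab : (↑(a * b) : M₂(K)) * X = (q a * q b) • (X * (↑(a * b) : M₂(K))) := by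
      rw [Matrix.SpecialLinearGroup.coe_mul, mul_assoc, hq b hb, mul_smul_comm, ← mul_assoc,
        hq a ha,
        smul_mul_assoc, smul_smul, mul_assoc, mul_comm (q a)]
    have hba : (↑(b * a) : M₂(K)) * X = (q a * q b) • (X * (↑(b * a) : M₂(K))) := by
      rw [Matrix.SpecialLinearGroup.coe_mul, mul_assoc, hq a ha, mul_smul_comm, ← mul_assoc,
        hq b hb,
        smul_mul_assoc, smul_smul, mul_assoc]
    have hba' : (↑(a * b) : M₂(K)) * (↑((b * a)⁻¹) : M₂(K)) = (↑(⁅a, b⁆) : M₂(K)) := by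
      rw [← Matrix.SpecialLinearGroup.coe_mul, commutatorElement_def]
      simp only [_root_.mul_inv_rev, mul_assoc]
    have hr : q a * q b ≠ 0 := by
      intro h0
      rw [h0, zero_smul] at hab
      apply hX
      have := congrArg ((↑((a * b)⁻¹) : M₂(K)) * ·) hab
      simpa [← mul_assoc, -_root_.mul_inv_rev, -Matrix.SpecialLinearGroup.coe_inv,
        -Matrix.SpecialLinearGroup.coe_mul, coe_inv_mul_coe] using this
    have hba2 : (q a * q b) • ((↑((b * a)⁻¹) : M₂(K)) * X) = X * (↑((b * a)⁻¹) : M₂(K)) := by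
      have := congrArg (fun Y => (↑((b * a)⁻¹) : M₂(K)) * Y * (↑((b * a)⁻¹) : M₂(K))) hba
      simp only [mul_assoc, coe_mul_coe_inv, mul_smul_comm, smul_mul_assoc, mul_one] at this
      rw [← mul_assoc, coe_inv_mul_coe, one_mul] at this
      exact this.symm
    rw [← hba', mul_assoc, ← mul_assoc X]
    refine smul_right_injective _ hr ?_
    change (q a * q b) • _ = (q a * q b) • _
    rw [← mul_smul_comm, hba2, ← smul_mul_assoc, ← hab, mul_assoc]
  have hcl : ∀ g ∈ ⁅H, H⁆, (g : M₂(K)) * X = X * (g : M₂(K)) := by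
    intro g hg
    rw [Subgroup.commutator_def] at hg
    refine Subgroup.closure_induction ?_ ?_ ?_ ?_ hg
    · rintro x ⟨a, ha, b, hb, rfl⟩
      exact hcomm a ha b hb
    · simp
    · intro x y _ _ hx hy
      rw [Matrix.SpecialLinearGroup.coe_mul, mul_assoc, hy, ← mul_assoc, hx, mul_assoc]
    · intro x _ hx
      have := congrArg (fun Y => (↑(x⁻¹) : M₂(K)) * Y * (↑(x⁻¹) : M₂(K))) hx
      simp only [mul_assoc, coe_mul_coe_inv, mul_one] at this
      rw [← mul_assoc (↑(x⁻¹) : M₂(K)) (x : M₂(K)), coe_inv_mul_coe, one_mul] at this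
      exact this.symm
  have hab : ∀ a ∈ ⁅H, H⁆, ∀ b ∈ ⁅H, H⁆, a * b = b * a := by
    intro a ha b hb
    obtain ⟨p, r, hp⟩ := exists_eq_smul_add_smul_of_commute hns (hcl a ha)
    apply Subtype.ext
    change (a : M₂(K)) * (b : M₂(K)) = (b : M₂(K)) * (a : M₂(K))
    rw [hp, add_mul, mul_add, smul_mul_assoc, smul_mul_assoc, mul_smul_comm, mul_smul_comm,
      hcl b hb, one_mul, mul_one]
  refine ⟨2, ?_⟩
  have hd1 : derivedSeries H 1 = ⁅(⊤ : Subgroup H), ⊤⁆ := by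
    rw [derivedSeries_succ, derivedSeries_zero]
  rw [derivedSeries_succ, hd1, eq_bot_iff, Subgroup.commutator_le]
  have hmap : ∀ x ∈ ⁅(⊤ : Subgroup H), (⊤ : Subgroup H)⁆, (x : SL(2, K)) ∈ ⁅H, H⁆ := by
    intro x hx
    have := Subgroup.mem_map_of_mem H.subtype hx
    rw [Subgroup.map_commutator] at this
    simpa [← MonoidHom.range_eq_map] using this
  intro x hx y hy
  rw [Subgroup.mem_bot, commutatorElement_eq_one_iff_mul_comm]
  exact Subtype.ext (hab _ (hmap x hx) _ (hmap y hy))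

lemma ne_smul_one_of_trace_eq_zero {K : Type*} [Field K] [NeZero (2 : K)] {X : M₂(K)}
    (hX : X ≠ 0) (htr : X.trace = 0) (c : K) : X ≠ c • 1 := by
  rintro rfl
  simp at htr
  rcases htr with rfl | htr
  · simp at hX
  · exact NeZero.ne (2 : K) htr

/-- A traceless matrix orthogonal to `X` and `Y` for the trace form commutes with their
commutator. -/
lemma commute_commutator_of_trace_mul_eq_zero {K : Type*} [Field K] {X Y E : M₂(K)}
    (hX : X.trace = 0) (hY : Y.trace = 0) (hE : E.trace = 0)
    (hEX : (E * X).trace = 0) (hEY : (E * Y).trace = 0) :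
    E * (X * Y - Y * X) = (X * Y - Y * X) * E := by
  rw [trace_fin_two] at hX hY hE
  have hX' : X 1 1 = -X 0 0 := by linear_combination hX
  have hY' : Y 1 1 = -Y 0 0 := by linear_combination hY
  have hE' : E 1 1 = -E 0 0 := by linear_combination hE
  simp only [trace_fin_two, mul_apply, Fin.sum_univ_two, hX', hY', hE'] at hEX hEY
  ext i j
  fin_cases i <;> fin_cases j <;>
    simp only [Fin.zero_eta, Fin.mk_one, Fin.isValue, mul_apply, Matrix.sub_apply, Fin.sum_univ_two,
      hX', hY', hE']
  · linear_combination 2 * Y 0 0 * hEX - 2 * X 0 0 * hEY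
  · linear_combination 2 * Y 0 1 * hEX - 2 * X 0 1 * hEY
  · linear_combination 2 * Y 1 0 * hEX - 2 * X 1 0 * hEY
  · linear_combination -2 * Y 0 0 * hEX + 2 * X 0 0 * hEY

/-- A nonsolvable subgroup of `SL₂(K)` acts irreducibly on traceless matrices by conjugation. -/
lemma submodule_eq_top_of_not_isSolvable {K : Type*} [Field K] [NeZero (2 : K)]
    {H : Subgroup SL(2, K)} (hH : ¬ Group.IsSolvable H)
    (P : Submodule K M₂(K))
    (hP : ∀ γ ∈ H, ∀ A ∈ P, (γ : M₂(K)) * A * (↑(γ⁻¹) : M₂(K)) ∈ P) (h1 : 1 ∈ P)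
    {X : M₂(K)} (hX : X ≠ 0) (htr : X.trace = 0) (hXP : X ∈ P) : P = ⊤ := by
  by_contra hne
  obtain ⟨f, hf, hPf⟩ := Submodule.exists_le_ker_of_lt_top P (lt_top_iff_ne_top.2 hne)
  let E : M₂(K) := of fun i j => f (single j i 1)
  have hfE : ∀ A, f A = (E * A).trace := by
    intro A
    conv_lhs => rw [matrix_eq_sum_single A]
    simp only [Fin.sum_univ_two, map_add, trace_fin_two, mul_apply, E, of_apply]
    have hs : ∀ (i j : Fin 2) (c : K), f (single i j c) = c * f (single i j 1) := by
      intro i j c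
      rw [← smul_eq_mul, ← map_smul, smul_single, smul_eq_mul, mul_one]
    rw [hs 0 0 (A 0 0), hs 0 1 (A 0 1), hs 1 0 (A 1 0), hs 1 1 (A 1 1)]
    ring
  have hkill : ∀ A ∈ P, (E * A).trace = 0 := fun A hA => by
    rw [← hfE]; exact hPf hA
  have hE0 : E ≠ 0 := by
    intro h0
    apply hf
    ext1 A
    simp [hfE, h0]
  have hEtr : E.trace = 0 := by simpa using hkill 1 h1
  have hconj : ∀ {Z : M₂(K)}, Z.trace = 0 → ∀ γ : SL(2, K),
      ((γ : M₂(K)) * Z * (↑(γ⁻¹) : M₂(K))).trace = 0 := by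
    intro Z hZ γ
    rw [trace_mul_comm, ← mul_assoc, coe_inv_mul_coe, one_mul, hZ]
  have hex : ∀ {Z : M₂(K)}, Z ≠ 0 → Z.trace = 0 → ∃ γ ∈ H,
      ((γ : M₂(K)) * Z * (↑(γ⁻¹) : M₂(K))) * Z ≠ Z * ((γ : M₂(K)) * Z * (↑(γ⁻¹) : M₂(K))) := by
    intro Z hZ hZt
    by_contra! hcon
    exact hH (isSolvable_of_conj_commute hZ hZt hcon)
  obtain ⟨γ, hγ, hγE⟩ := hex hE0 hEtr
  obtain ⟨δ, hδ, hδX⟩ := hex hX htr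
  set E' : M₂(K) := (γ : M₂(K)) * E * (↑(γ⁻¹) : M₂(K)) with hE'
  set X' : M₂(K) := (δ : M₂(K)) * X * (↑(δ⁻¹) : M₂(K)) with hX'
  have hkill' : ∀ A ∈ P, (E' * A).trace = 0 := by
    intro A hA
    have := hkill _ (hP γ⁻¹ (H.inv_mem hγ) A hA)
    rw [inv_inv] at this
    rw [hE', mul_assoc, mul_assoc, trace_mul_comm, ← this]
    simp only [mul_assoc]
  have hX'P : X' ∈ P := hP δ hδ X hXP
  have hN : X' * X - X * X' ≠ 0 := sub_ne_zero.2 hδX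
  have hNt : (X' * X - X * X').trace = 0 := by rw [trace_sub, trace_mul_comm, sub_self]
  obtain ⟨p, q, hpq⟩ := exists_eq_smul_add_smul_of_commute
    (ne_smul_one_of_trace_eq_zero hN hNt)
    (commute_commutator_of_trace_mul_eq_zero (hconj htr δ) htr hEtr (hkill _ hX'P) (hkill _ hXP))
  have hc' := commute_commutator_of_trace_mul_eq_zero (hconj htr δ) htr (hconj hEtr γ)
    (hkill' _ hX'P) (hkill' _ hXP)
  apply hγE
  rw [hpq, mul_add, add_mul, mul_smul_comm, mul_smul_comm, smul_mul_assoc, smul_mul_assoc,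
    hc', one_mul, mul_one]

/-- The vectors on which a family of functionals is bounded. -/
def boundedSubmodule {ι V : Type*} [AddCommGroup V] [Module ℝ V] (φ : ι → V →ₗ[ℝ] ℝ) :
    Submodule ℝ V where
  carrier := {A | ∃ C : ℝ, ∀ i, |φ i A| ≤ C}
  zero_mem' := ⟨0, by simp⟩
  add_mem' := by
    rintro A B ⟨C, hC⟩ ⟨D, hD⟩
    refine ⟨C + D, fun i => ?_⟩
    rw [map_add]
    exact (abs_add_le _ _).trans (add_le_add (hC i) (hD i))
  smul_mem' := by
    rintro c A ⟨C, hC⟩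
    refine ⟨|c| * C, fun i => ?_⟩
    rw [map_smul, smul_eq_mul, abs_mul]
    exact mul_le_mul_of_nonneg_left (hC i) (abs_nonneg c)

/-- If one nonzero traceless matrix has bounded matrix coefficient under conjugation, then a
nonsolvable group of matrices is bounded. -/
lemma exists_abs_le_of_trace_conj_bounded {H : Subgroup SL(2, ℝ)} (hH : ¬ Group.IsSolvable H)
    {X : M₂(ℝ)} (hX : X ≠ 0) (htr : X.trace = 0) {c : ℝ}
    (hb : ∀ γ ∈ H, |(X * ((γ : M₂(ℝ)) * X * (↑(γ⁻¹) : M₂(ℝ)))).trace| ≤ c) :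
    ∃ C : ℝ, ∀ γ ∈ H, ∀ i j, |γ i j| ≤ C := by
  have htc : ∀ γ : SL(2, ℝ), ((γ : M₂(ℝ)) * X * (↑(γ⁻¹) : M₂(ℝ))).trace = 0 := by
    intro γ
    rw [trace_mul_comm, ← mul_assoc, coe_inv_mul_coe, one_mul, htr]
  let φ : H → M₂(ℝ) →ₗ[ℝ] ℝ := fun γ =>
    traceLinearMap (Fin 2) ℝ ℝ ∘ₗ
      LinearMap.mulRight ℝ (((γ : SL(2, ℝ)) : M₂(ℝ)) * X * (↑((γ : SL(2, ℝ))⁻¹) : M₂(ℝ)))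
  have hP : boundedSubmodule φ = ⊤ := by
    refine submodule_eq_top_of_not_isSolvable hH _ ?_ ⟨0, ?_⟩ hX htr ⟨c, ?_⟩
    · rintro δ hδ A ⟨C, hC⟩
      refine ⟨C, fun γ => ?_⟩
      have := hC (⟨δ, hδ⟩⁻¹ * γ)
      simp only [φ, LinearMap.comp_apply, LinearMap.mulRight_apply, traceLinearMap_apply,
        Subgroup.coe_mul, Subgroup.coe_inv, _root_.mul_inv_rev, inv_inv,
        Matrix.SpecialLinearGroup.coe_mul] at this ⊢
      rw [show ((δ : M₂(ℝ)) * A * (↑(δ⁻¹) : M₂(ℝ)) * (((γ : SL(2, ℝ)) : M₂(ℝ)) * X *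
        (↑((γ : SL(2, ℝ))⁻¹) : M₂(ℝ)))).trace = (A * ((↑(δ⁻¹) : M₂(ℝ)) * ((γ : SL(2, ℝ)) : M₂(ℝ)) *
        X * ((↑((γ : SL(2, ℝ))⁻¹) : M₂(ℝ)) * (δ : M₂(ℝ))))).trace by
          rw [mul_assoc, mul_assoc, trace_mul_comm]; simp only [mul_assoc]]
      exact this
    · intro γ
      simp only [φ, LinearMap.comp_apply, LinearMap.mulRight_apply, traceLinearMap_apply, one_mul]
      rw [htc, abs_zero]
    · intro γ
      exact hb γ γ.2
  let ψ : M₂(ℝ) → H → M₂(ℝ) →ₗ[ℝ] ℝ := fun B γ =>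
    traceLinearMap (Fin 2) ℝ ℝ ∘ₗ
      LinearMap.mulLeft ℝ (B * ((γ : SL(2, ℝ)) : M₂(ℝ))) ∘ₗ
        LinearMap.mulRight ℝ (↑((γ : SL(2, ℝ))⁻¹) : M₂(ℝ))
  have hψ : ∀ B γ A, ψ B γ A =
      (B * ((γ : SL(2, ℝ)) : M₂(ℝ)) * (A * (↑((γ : SL(2, ℝ))⁻¹) : M₂(ℝ)))).trace :=
    fun _ _ _ => rfl
  have hP' : (⨅ B, boundedSubmodule (ψ B)) = ⊤ := by
    refine submodule_eq_top_of_not_isSolvable hH _ ?_ ?_ hX htr ?_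
    · intro δ hδ A hA
      rw [Submodule.mem_iInf] at hA ⊢
      intro B
      obtain ⟨C, hC⟩ := hA B
      refine ⟨C, fun γ => ?_⟩
      have := hC (γ * ⟨δ, hδ⟩)
      rw [hψ] at this ⊢
      simpa only [Subgroup.coe_mul, Subgroup.coe_inv, _root_.mul_inv_rev,
        Matrix.SpecialLinearGroup.coe_mul, mul_assoc] using this
    · rw [Submodule.mem_iInf]
      intro B
      refine ⟨|B.trace|, fun γ => ?_⟩
      rw [hψ, one_mul, mul_assoc, coe_mul_coe_inv, mul_one]
    · rw [Submodule.mem_iInf]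
      intro B
      obtain ⟨C, hC⟩ : B ∈ boundedSubmodule φ := hP ▸ Submodule.mem_top
      refine ⟨C, fun γ => ?_⟩
      have := hC γ
      simp only [φ, LinearMap.comp_apply, LinearMap.mulRight_apply, traceLinearMap_apply] at this
      rw [hψ]
      simpa only [mul_assoc] using this
  have hall : ∀ A B, ∃ C : ℝ, ∀ γ : H, |ψ B γ A| ≤ C := by
    intro A B
    have : A ∈ ⨅ B, boundedSubmodule (ψ B) := hP' ▸ Submodule.mem_top
    exact (Submodule.mem_iInf _).1 this B
  obtain ⟨C₁, h₁⟩ := hall !![0, 1; 0, 0] !![0, 0; 1, 0]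
  obtain ⟨C₂, h₂⟩ := hall !![0, 1; 0, 0] !![0, 1; 0, 0]
  obtain ⟨C₃, h₃⟩ := hall !![0, 0; 1, 0] !![0, 0; 1, 0]
  obtain ⟨C₄, h₄⟩ := hall !![0, 0; 1, 0] !![0, 1; 0, 0]
  have sq_le : ∀ {x C : ℝ}, |x ^ 2| ≤ C → |x| ≤ 1 + C := by
    intro x C hx
    rw [abs_of_nonneg (sq_nonneg x)] at hx
    nlinarith [sq_abs x, sq_nonneg (|x| - 1), abs_nonneg x]
  refine ⟨(1 + C₁) + (1 + C₂) + (1 + C₃) + (1 + C₄), fun γ hγ => ?_⟩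
  replace h₁ := h₁ ⟨γ, hγ⟩
  replace h₂ := h₂ ⟨γ, hγ⟩
  replace h₃ := h₃ ⟨γ, hγ⟩
  replace h₄ := h₄ ⟨γ, hγ⟩
  rw [hψ] at h₁ h₂ h₃ h₄
  simp only [Matrix.SpecialLinearGroup.coe_inv, adjugate_fin_two, trace_fin_two, mul_apply,
    Fin.sum_univ_two] at h₁ h₂ h₃ h₄
  simp [-abs_mul] at h₁ h₂ h₃ h₄
  simp only [← sq] at h₁ h₂ h₃ h₄
  have e₁ := sq_le h₁
  have e₂ := sq_le h₂
  have e₃ := sq_le h₃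
  have e₄ := sq_le h₄
  have n₁ := (abs_nonneg _).trans e₁
  have n₂ := (abs_nonneg _).trans e₂
  have n₃ := (abs_nonneg _).trans e₃
  have n₄ := (abs_nonneg _).trans e₄
  intro i j
  fin_cases i <;> fin_cases j <;> simp only [Fin.zero_eta, Fin.mk_one, Fin.isValue] <;> linarith

/-- The powers of a nontrivial element of trace at least two are unbounded. -/
lemma exists_pow_entry_gt {h : SL(2, ℝ)} (h1 : h ≠ 1) (htr : 2 ≤ (h : M₂(ℝ)).trace) (C : ℝ) :
    ∃ (n : ℕ) (i j : Fin 2), C < |(h ^ n) i j| := by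
  set T := (h : M₂(ℝ)).trace / 2 with hT
  set X : M₂(ℝ) := (h : M₂(ℝ)) - T • 1 with hXdef
  have hdet : h 0 0 * h 1 1 - h 0 1 * h 1 0 = 1 := by
    rw [← det_fin_two]; exact h.2
  have hT1 : 1 ≤ T := by linarith
  have hXX : X * X = (T ^ 2 - 1) • 1 := by
    ext i j
    fin_cases i <;> fin_cases j <;>
      simp [hXdef, hT, mul_apply, Fin.sum_univ_two, trace_fin_two]
    · linear_combination -hdet
    · ring
    · ring
    · linear_combination -hdet
  have hpow : ∀ k : ℕ, ∃ t s : ℝ, 1 ≤ t ∧ 2 ^ k ≤ s ∧ (↑(h ^ 2 ^ k) : M₂(ℝ)) = t • 1 + s • X := by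
    intro k
    induction k with
    | zero => exact ⟨T, 1, hT1, by simp, by simp [hXdef]⟩
    | succ k ih =>
      obtain ⟨t, s, ht, hs, he⟩ := ih
      refine ⟨t ^ 2 + s ^ 2 * (T ^ 2 - 1), 2 * t * s, ?_, ?_, ?_⟩
      · have : 0 ≤ s ^ 2 * (T ^ 2 - 1) := mul_nonneg (sq_nonneg s) (by nlinarith)
        nlinarith
      · have : (0 : ℝ) < 2 ^ k := by positivity
        rw [pow_succ]
        nlinarith
      · rw [pow_succ, pow_mul, sq, Matrix.SpecialLinearGroup.coe_mul, he]
        simp only [add_mul, mul_add, smul_mul_assoc, mul_smul_comm, one_mul, mul_one, hXX,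
          smul_smul]
        module
  by_contra! hcon
  have hX0 : X = 0 := by
    have key : ∀ {x : ℝ}, (∀ k : ℕ, ∃ s : ℝ, 2 ^ k ≤ s ∧ |s * x| ≤ C) → x = 0 := by
      intro x hx
      by_contra hx0
      have hpos := abs_pos.2 hx0
      obtain ⟨k, hk⟩ := pow_unbounded_of_one_lt (C / |x|) (one_lt_two (α := ℝ))
      obtain ⟨s, hs, hsx⟩ := hx k
      rw [abs_mul] at hsx
      rw [div_lt_iff₀ hpos] at hk
      nlinarith [le_abs_self s]
    have h01 : X 0 1 = 0 := key fun k => by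
      obtain ⟨t, s, -, hs, he⟩ := hpow k
      exact ⟨s, hs, by simpa [he] using hcon (2 ^ k) 0 1⟩
    have h10 : X 1 0 = 0 := key fun k => by
      obtain ⟨t, s, -, hs, he⟩ := hpow k
      exact ⟨s, hs, by simpa [he] using hcon (2 ^ k) 1 0⟩
    have h11 : X 1 1 = - X 0 0 := by
      simp [hXdef, hT, trace_fin_two]; ring
    have h00 : X 0 0 = 0 := key fun k => by
      obtain ⟨t, s, -, hs, he⟩ := hpow k
      refine ⟨s, hs, ?_⟩
      have e0 := hcon (2 ^ k) 0 0
      have e1 := hcon (2 ^ k) 1 1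
      simp only [he] at e0 e1
      simp [h11] at e0 e1
      rw [abs_le] at *
      constructor <;> linarith
    ext i j
    fin_cases i <;> fin_cases j <;> simp [h00, h01, h10, h11]
  have hh : (h : M₂(ℝ)) = T • 1 := sub_eq_zero.1 hX0
  have hT2 : T = 1 := by
    rw [hX0, mul_zero] at hXX
    have := congrFun (congrFun hXX 0) 0
    simp at this
    nlinarith
  exact h1 (Subtype.ext (by rw [hh, hT2, one_smul, Matrix.SpecialLinearGroup.coe_one]))

/-- A nondiscrete nonsolvable subgroup of `SL₂(ℝ)` has elliptic elements arbitrarily close to the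
identity. -/
lemma exists_elliptic_of_not_isSolvable {H : Subgroup SL(2, ℝ)} (hH : ¬ Group.IsSolvable H)
    (hnd : ∀ U ∈ 𝓝 (1 : M₂(ℝ)), ∃ g ∈ H, g ≠ 1 ∧ (g : M₂(ℝ)) ∈ U)
    {U : Set M₂(ℝ)} (hU : U ∈ 𝓝 1) :
    ∃ e ∈ H, (e : M₂(ℝ)) ∈ U ∧ |(e : M₂(ℝ)).trace| < 2 := by
  by_contra! hcon
  have htrc : Continuous fun A : M₂(ℝ) => A.trace := continuous_id.matrix_trace
  have hV : U ∩ {A | 0 < A.trace} ∈ 𝓝 (1 : M₂(ℝ)) :=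
    inter_mem hU ((isOpen_lt continuous_const htrc).mem_nhds (by simp))
  set V := U ∩ {A : M₂(ℝ) | 0 < A.trace}
  replace hcon : ∀ e ∈ H, (e : M₂(ℝ)) ∈ V → 2 ≤ (e : M₂(ℝ)).trace := fun e he heV => by
    have := hcon e he heV.1
    rwa [abs_of_pos heV.2] at this
  let F : Filter SL(2, ℝ) :=
    comap (fun g : SL(2, ℝ) => (g : M₂(ℝ))) (𝓝 1) ⊓ 𝓟 {g | g ∈ H ∧ g ≠ 1}
  have hFne : F.NeBot := by
    refine inf_principal_neBot_iff.2 ?_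
    rintro W ⟨t, ht, htW⟩
    obtain ⟨g, hg, hg1, hgt⟩ := hnd t ht
    exact ⟨g, htW hgt, hg, hg1⟩
  have hF : Tendsto (fun g : SL(2, ℝ) => (g : M₂(ℝ))) F (𝓝 1) :=
    tendsto_comap.mono_left inf_le_left
  have hFH : ∀ᶠ g in F, g ∈ H ∧ g ≠ 1 := mem_inf_of_right (mem_principal_self _)
  have hFinv : Tendsto (fun g : SL(2, ℝ) => (↑(g⁻¹) : M₂(ℝ))) F (𝓝 1) := by
    have hc : Continuous fun A : M₂(ℝ) => A.adjugate := continuous_id.matrix_adjugate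
    have := (hc.tendsto 1).comp hF
    rwa [adjugate_one] at this
  have hmul : ∀ {f₁ f₂ : SL(2, ℝ) → M₂(ℝ)} {a b : M₂(ℝ)}, Tendsto f₁ F (𝓝 a) →
      Tendsto f₂ F (𝓝 b) → Tendsto (fun g => f₁ g * f₂ g) F (𝓝 (a * b)) :=
    fun h₁ h₂ => h₁.mul h₂
  let X : SL(2, ℝ) → M₂(ℝ) := fun g => (g : M₂(ℝ)) - ((g : M₂(ℝ)).trace / 2) • 1
  have hXtr : ∀ g, (X g).trace = 0 := fun g => by simp [X]
  -- the trace inequality coming from the absence of elliptic elements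
  have hineq : ∀ γ ∈ H, ∀ᶠ g in F,
      |(X g * ((γ : M₂(ℝ)) * X g * (↑(γ⁻¹) : M₂(ℝ)))).trace| ≤ (X g * X g).trace := by
    intro γ hγ
    have hV₁ : ∀ᶠ g : SL(2, ℝ) in F, (↑(g * γ * g * γ⁻¹) : M₂(ℝ)) ∈ V := by
      have := hmul (hmul (hmul hF tendsto_const_nhds) hF)
        (tendsto_const_nhds (x := (↑(γ⁻¹) : M₂(ℝ))))
        (a := 1 * (γ : M₂(ℝ)) * 1)
      rw [one_mul, mul_one, coe_mul_coe_inv] at this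
      filter_upwards [this hV] with g hg
      exact hg
    have hV₂ : ∀ᶠ g : SL(2, ℝ) in F, (↑(g * γ * g⁻¹ * γ⁻¹) : M₂(ℝ)) ∈ V := by
      have := hmul (hmul (hmul hF tendsto_const_nhds) hFinv)
        (tendsto_const_nhds (x := (↑(γ⁻¹) : M₂(ℝ)))) (a := 1 * (γ : M₂(ℝ)) * 1)
      rw [one_mul, mul_one, coe_mul_coe_inv] at this
      filter_upwards [this hV] with g hg
      exact hg
    filter_upwards [hV₁, hV₂, hFH] with g h₁ h₂ hg
    have i₁ := hcon _ (H.mul_mem (H.mul_mem (H.mul_mem hg.1 hγ) hg.1) (H.inv_mem hγ)) h₁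
    have i₂ := hcon _ (H.mul_mem (H.mul_mem (H.mul_mem hg.1 hγ) (H.inv_mem hg.1))
      (H.inv_mem hγ)) h₂
    set t := (g : M₂(ℝ)).trace / 2 with ht
    have eg : (g : M₂(ℝ)) = t • 1 + X g := by simp [X, ht]
    have hdet : g 0 0 * g 1 1 - g 0 1 * g 1 0 = 1 := by
      rw [← det_fin_two]; exact g.2
    have eg' : (↑(g⁻¹) : M₂(ℝ)) = t • 1 - X g := by
      rw [Matrix.SpecialLinearGroup.coe_inv, adjugate_fin_two]
      ext i j
      fin_cases i <;> fin_cases j <;> simp [X, ht, trace_fin_two] <;> ring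
    have hXX : (X g * X g).trace = 2 * t ^ 2 - 2 := by
      simp [X, ht, trace_fin_two, mul_apply, Fin.sum_univ_two]
      linear_combination -2 * hdet
    have hconj : ((γ : M₂(ℝ)) * (X g * (↑(γ⁻¹) : M₂(ℝ)))).trace = 0 := by
      rw [trace_mul_comm, mul_assoc, coe_inv_mul_coe, mul_one, hXtr]
    simp only [Matrix.SpecialLinearGroup.coe_mul, eg', eg, mul_assoc, add_mul, mul_add, sub_mul,
      mul_sub, smul_mul_assoc, mul_smul_comm, one_mul, mul_one, coe_mul_coe_inv, trace_add,
      trace_sub, trace_smul, hconj, hXtr, smul_zero, trace_one] at i₁ i₂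
    simp [-Matrix.SpecialLinearGroup.coe_inv] at i₁ i₂
    rw [hXX, mul_assoc, abs_le]
    constructor <;> nlinarith
  -- normalize and pass to a cluster point
  let N : M₂(ℝ) → ℝ := fun A => |A 0 0| + |A 0 1| + |A 1 0|
  have hNc : Continuous N := by
    have := fun i j => (continuous_apply_apply i j : Continuous fun A : M₂(ℝ) => A i j)
    exact ((this 0 0).abs.add (this 0 1).abs).add (this 1 0).abs
  have hNs : ∀ (c : ℝ) A, N (c • A) = |c| * N A := fun c A => by
    simp [N, abs_mul]; ring
  have hNX : ∀ᶠ g in F, 0 < N (X g) := by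
    filter_upwards [hFH, hF hV] with g hg hgV
    refine lt_of_le_of_ne (by positivity) fun h0 => hg.2 ?_
    have z₁ := abs_nonneg (X g 0 0)
    have z₂ := abs_nonneg (X g 0 1)
    have z₃ := abs_nonneg (X g 1 0)
    have h00 : X g 0 0 = 0 := abs_eq_zero.1 (by simp only [N] at h0; linarith)
    have h01 : X g 0 1 = 0 := abs_eq_zero.1 (by simp only [N] at h0; linarith)
    have h10 : X g 1 0 = 0 := abs_eq_zero.1 (by simp only [N] at h0; linarith)
    have hdet : g 0 0 * g 1 1 - g 0 1 * g 1 0 = 1 := by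
      rw [← det_fin_two]; exact g.2
    have hpos : 0 < g 0 0 + g 1 1 := by simpa [trace_fin_two] using hgV.2
    simp [X, trace_fin_two] at h00 h01 h10
    have e : g 1 1 = g 0 0 := by linarith
    have e1 : g 0 0 = 1 := by
      rw [e, h01] at hdet
      nlinarith
    apply Subtype.ext
    change (g : M₂(ℝ)) = 1
    ext i j
    fin_cases i <;> fin_cases j <;> simp [h01, h10, e, e1]
  let Y : SL(2, ℝ) → M₂(ℝ) := fun g => (N (X g))⁻¹ • X g
  let K : Set M₂(ℝ) := Set.univ.pi fun _ => Set.univ.pi fun _ => Set.Icc (-1) 1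
  have hK : IsCompact K := isCompact_univ_pi fun _ => isCompact_univ_pi fun _ => isCompact_Icc
  have hYN : ∀ᶠ g in F, N (Y g) = 1 := by
    filter_upwards [hNX] with g hg
    rw [hNs, abs_inv, abs_of_pos hg, inv_mul_cancel₀ hg.ne']
  have hYtr : ∀ g, (Y g).trace = 0 := fun g => by simp [Y, hXtr]
  have hYK : ∀ᶠ g in F, Y g ∈ K := by
    filter_upwards [hYN] with g hg i _ j _
    have z₁ := abs_nonneg (Y g 0 0)
    have z₂ := abs_nonneg (Y g 0 1)
    have z₃ := abs_nonneg (Y g 1 0)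
    have h11 : Y g 1 1 = - Y g 0 0 := by
      have := hYtr g
      rw [trace_fin_two] at this
      linarith
    rw [Set.mem_Icc, ← abs_le]
    simp only [N] at hg
    fin_cases i <;> fin_cases j <;> simp only [Fin.zero_eta, Fin.mk_one, Fin.isValue, h11, abs_neg]
      <;> linarith
  obtain ⟨Z, -, hZ⟩ := hK.exists_mapClusterPt_of_frequently hYK.frequently
  have hcl : ∀ {S : Set M₂(ℝ)}, IsClosed S → (∀ᶠ g in F, Y g ∈ S) → Z ∈ S := by
    intro S hS hev
    exact hS.closure_eq ▸ hZ.mem_closure_of_mem _ hev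
  have hZN : N Z = 1 := hcl (isClosed_eq hNc continuous_const) hYN
  have hZtr : Z.trace = 0 := hcl (isClosed_eq htrc continuous_const) (.of_forall hYtr)
  have hZ0 : Z ≠ 0 := by
    rintro rfl
    simp [N] at hZN
  have hZb : ∀ γ ∈ H, |(Z * ((γ : M₂(ℝ)) * Z * (↑(γ⁻¹) : M₂(ℝ)))).trace| ≤ (Z * Z).trace := by
    intro γ hγ
    refine hcl (S := {A | |(A * ((γ : M₂(ℝ)) * A * (↑(γ⁻¹) : M₂(ℝ)))).trace| ≤ (A * A).trace})
      (isClosed_le ?_ ?_) ?_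
    · exact (htrc.comp (continuous_id.mul
        ((continuous_const.mul continuous_id).mul continuous_const))).abs
    · exact htrc.comp (continuous_id.mul continuous_id)
    · filter_upwards [hineq γ hγ, hNX] with g hg hN
      simp only [Y, smul_mul_assoc, mul_smul_comm, trace_smul, smul_smul]
      rw [smul_eq_mul, smul_eq_mul, abs_mul, abs_of_pos (by positivity)]
      exact mul_le_mul_of_nonneg_left hg (by positivity)
  obtain ⟨C, hC⟩ := exists_abs_le_of_trace_conj_bounded hH hZ0 hZtr hZb
  obtain ⟨h, hhH, hh1, hhV⟩ := hnd V hV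
  obtain ⟨n, i, j, hlt⟩ := exists_pow_entry_gt hh1 (hcon h hhH hhV) C
  exact (hC _ (H.pow_mem hhH n) i j).not_gt hlt

lemma Int.isJacobsonRing : IsJacobsonRing ℤ := by
  rw [isJacobsonRing_iff_prime_eq]
  intro P hP
  rcases eq_or_ne P ⊥ with rfl | hne
  · refine le_antisymm (fun x hx => ?_) Ideal.le_jacobson
    rw [Ideal.mem_jacobson_bot] at hx
    by_contra hx0
    rcases Int.isUnit_iff.1 (hx x) with h | h
    · exact hx0 (by simpa using h)
    · nlinarith [mul_self_nonneg x]
  · have := hP.isMaximal hne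
    exact Ideal.jacobson_eq_self_of_isMaximal

/-- A nontrivial finitely generated commutative ring maps to a finite field. -/
lemma exists_maximal_ideal_finite_quotient (A : Type*) [CommRing A] [Nontrivial A]
    [Algebra.FiniteType ℤ A] : ∃ m : Ideal A, m.IsMaximal ∧ Finite (A ⧸ m) := by
  have := Int.isJacobsonRing
  obtain ⟨m, hm⟩ := Ideal.exists_maximal A
  refine ⟨m, hm, ?_⟩
  let _ : Field (A ⧸ m) := Ideal.Quotient.field m
  have : Algebra.FiniteType ℤ (A ⧸ m) := inferInstance
  have hfin : Module.Finite ℤ (A ⧸ m) := finite_of_finite_type_of_isJacobsonRing ℤ (A ⧸ m)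
  obtain ⟨p, hp⟩ := CharP.exists (A ⧸ m)
  have hp0 : p ≠ 0 := by
    rintro rfl
    have := CharP.charP_to_charZero (A ⧸ m)
    have hinj : Function.Injective (algebraMap ℤ (A ⧸ m)) :=
      fun x y hxy => Int.cast_injective (α := A ⧸ m) (by simpa using hxy)
    have := isField_of_isIntegral_of_isField hinj (Field.toIsField (A ⧸ m))
    exact Int.not_isField this
  have : NeZero p := ⟨hp0⟩
  let _ : Algebra (ZMod p) (A ⧸ m) := ZMod.algebra _ p
  have : IsScalarTower ℤ (ZMod p) (A ⧸ m) := IsScalarTower.of_algebraMap_eq fun x => by simp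
  have : Module.Finite (ZMod p) (A ⧸ m) := Module.Finite.of_restrictScalars_finite ℤ _ _
  exact Module.finite_of_finite (ZMod p)

/-- An element of a congruence subgroup has no torsion of order invertible in the residue field. -/
lemma eq_one_of_map_eq_one {R k : Type*} [CommRing R] [IsDomain R] [Field k] (φ : R →+* k)
    {g : SL(2, R)} (hg : Matrix.SpecialLinearGroup.map φ g = 1) {n : ℕ} (hn : (n : k) ≠ 0)
    (hgn : g ^ n = 1) : g = 1 := by
  set S : M₂(R) := ∑ i ∈ Finset.range n, (g : M₂(R)) ^ i with hS
  have hmul : S * ((g : M₂(R)) - 1) = 0 := by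
    rw [hS, geom_sum_mul, ← Matrix.SpecialLinearGroup.coe_pow, hgn,
      Matrix.SpecialLinearGroup.coe_one, sub_self]
  have hgφ : φ.mapMatrix (g : M₂(R)) = 1 := congrArg (fun x : SL(2, k) => (x : M₂(k))) hg
  have hdet : S.det ≠ 0 := by
    intro h0
    have h1 : (φ.mapMatrix S).det = 0 := by rw [← RingHom.map_det, h0, map_zero]
    rw [hS, map_sum] at h1
    simp only [map_pow, hgφ, one_pow, Finset.sum_const, Finset.card_range] at h1
    rw [nsmul_one, ← diagonal_natCast, det_diagonal] at h1
    simp [hn] at h1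
  have h2 := congrArg (S.adjugate * ·) hmul
  simp only [← mul_assoc, adjugate_mul, mul_zero, smul_mul_assoc, one_mul] at h2
  have h3 := (smul_eq_zero.1 h2).resolve_left hdet
  exact Subtype.ext (sub_eq_zero.1 h3)

lemma exists_pow_eq_one_of_isOfFinOrder (R : Type*) [CommRing R] [IsDomain R] [CharZero R]
    [Algebra.FiniteType ℤ R] :
    ∃ N : ℕ, 0 < N ∧ ∀ g : SL(2, R), IsOfFinOrder g → g ^ N = 1 := by
  obtain ⟨m, hm, hfin⟩ := exists_maximal_ideal_finite_quotient R
  let _ : Field (R ⧸ m) := Ideal.Quotient.field m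
  obtain ⟨p, hp⟩ := CharP.exists (R ⧸ m)
  have hp0 : p ≠ 0 := CharP.char_ne_zero_of_finite (R ⧸ m) p
  have hpp : p.Prime := (CharP.char_is_prime_or_zero (R ⧸ m) p).resolve_right hp0
  have hpR : (p : R) ≠ 0 := by exact_mod_cast hp0
  obtain ⟨A, _, _, _⟩ : ∃ (A : Type _) (_ : CommRing A) (_ : Algebra R A),
      IsLocalization.Away (p : R) A := ⟨Localization.Away (p : R), _, _, inferInstance⟩
  have : Nontrivial A := (IsLocalization.injective A
    (powers_le_nonZeroDivisors_of_noZeroDivisors hpR)).nontrivial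
  have : Algebra.FiniteType R A :=
    IsLocalization.finiteType_of_monoid_fg (Submonoid.powers (p : R)) A
  have : Algebra.FiniteType ℤ A := Algebra.FiniteType.trans (S := R) inferInstance inferInstance
  obtain ⟨m', hm', hfin'⟩ := exists_maximal_ideal_finite_quotient A
  let _ : Field (A ⧸ m') := Ideal.Quotient.field m'
  let φ : R →+* R ⧸ m := Ideal.Quotient.mk m
  let φ' : R →+* A ⧸ m' := (Ideal.Quotient.mk m').comp (algebraMap R A)
  have hp' : (p : A ⧸ m') ≠ 0 := by
    have hu : IsUnit (algebraMap R A p) := IsLocalization.Away.algebraMap_isUnit (p : R)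
    have := (hu.map (Ideal.Quotient.mk m')).ne_zero
    simpa using this
  refine ⟨Nat.card SL(2, R ⧸ m) * Nat.card SL(2, A ⧸ m'),
    Nat.mul_pos Nat.card_pos Nat.card_pos, fun g hg => ?_⟩
  obtain ⟨n, hn, hgn⟩ := isOfFinOrder_iff_pow_eq_one.1 hg
  set h := g ^ (Nat.card SL(2, R ⧸ m) * Nat.card SL(2, A ⧸ m')) with hh
  have hφ : Matrix.SpecialLinearGroup.map φ h = 1 := by
    rw [hh, map_pow, pow_mul, pow_card_eq_one', one_pow]
  have hφ' : Matrix.SpecialLinearGroup.map φ' h = 1 := by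
    rw [hh, map_pow, mul_comm, pow_mul, pow_card_eq_one', one_pow]
  have hhn : h ^ n = 1 := by rw [hh, ← pow_mul, mul_comm, pow_mul, hgn, one_pow]
  obtain ⟨a, n', hn', rfl⟩ := Nat.exists_eq_pow_mul_and_not_dvd hn.ne' p hpp.ne_one
  have h1 : h ^ p ^ a = 1 := by
    refine eq_one_of_map_eq_one φ (n := n') (by rw [map_pow, hφ, one_pow]) ?_
      (by rw [← pow_mul, hhn])
    rwa [Ne, CharP.cast_eq_zero_iff (R ⧸ m) p]
  exact eq_one_of_map_eq_one φ' hφ' (n := p ^ a) (by push_cast; exact pow_ne_zero _ hp') h1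

/-- The torsion of a finitely generated group of `2 × 2` matrices has bounded exponent. -/
lemma exists_pow_eq_one_of_mem_closure {K : Type*} [Field K] [CharZero K] {S : Set SL(2, K)}
    (hS : S.Finite) :
    ∃ N : ℕ, 0 < N ∧ ∀ g ∈ Subgroup.closure S, IsOfFinOrder g → g ^ N = 1 := by
  let T : Set K := ⋃ s ∈ S, Set.range fun ij : Fin 2 × Fin 2 => s ij.1 ij.2
  have hT : T.Finite := hS.biUnion fun _ _ => Set.finite_range _
  let R := Algebra.adjoin ℤ T
  have : Algebra.FiniteType ℤ R := (Subalgebra.fg_iff_finiteType R).1 ⟨hT.toFinset, by simp [R]⟩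
  have : CharZero R := ⟨fun a b hab => by exact_mod_cast congrArg (Subtype.val : R → K) hab⟩
  obtain ⟨N, hN, h⟩ := exists_pow_eq_one_of_isOfFinOrder R
  refine ⟨N, hN, fun g hg hfin => ?_⟩
  let ι : SL(2, R) →* SL(2, K) := Matrix.SpecialLinearGroup.map R.val.toRingHom
  have hι : Function.Injective ι := by
    intro x y hxy
    apply Subtype.ext
    ext i j
    exact congrFun (congrFun (congrArg (fun x : SL(2, K) => (x : M₂(K))) hxy) i) j
  have hle : Subgroup.closure S ≤ ι.range := by
    rw [Subgroup.closure_le]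
    intro s hs
    have hmem : ∀ i j, s i j ∈ R := fun i j =>
      Algebra.subset_adjoin (Set.mem_biUnion hs ⟨(i, j), rfl⟩)
    refine ⟨⟨of fun i j => ⟨s i j, hmem i j⟩, ?_⟩, ?_⟩
    · have := s.2
      rw [det_fin_two] at this ⊢
      exact Subtype.ext this
    · apply Subtype.ext
      ext i j
      rfl
  obtain ⟨x, rfl⟩ := hle hg
  rw [← map_pow, h x (hι.isOfFinOrder_iff.1 hfin), map_one]

lemma trace_commutator_eq {K : Type*} [CommRing K] (e w : SL(2, K)) :
    (↑(e * w * e⁻¹ * w⁻¹) : M₂(K)).trace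
      = 2 - ((e : M₂(K)) * w - (w : M₂(K)) * e).det := by
  have h : ((e : M₂(K)) * w * (e : M₂(K)).adjugate * (w : M₂(K)).adjugate).trace
      = 2 * ((e : M₂(K)).det * (w : M₂(K)).det) - ((e : M₂(K)) * w - (w : M₂(K)) * e).det := by
    simp only [trace_fin_two, det_fin_two, adjugate_fin_two, mul_apply, Fin.sum_univ_two,
      Matrix.sub_apply, of_apply, cons_val_zero, cons_val_one, cons_val', cons_val_fin_one]
    ring
  simpa [Matrix.SpecialLinearGroup.coe_mul, Matrix.SpecialLinearGroup.coe_inv] using h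

lemma two_lt_trace_commutator {e w : SL(2, ℝ)} (he : |(e : M₂(ℝ)).trace| < 2)
    (h : e * w ≠ w * e) : 2 < (↑(e * w * e⁻¹ * w⁻¹) : M₂(ℝ)).trace := by
  rw [trace_commutator_eq]
  have hdet : e 0 0 * e 1 1 - e 0 1 * e 1 0 = 1 := by
    rw [← det_fin_two]; exact e.2
  rw [trace_fin_two, abs_lt] at he
  set Z : M₂(ℝ) := (e : M₂(ℝ)) * w - (w : M₂(ℝ)) * e with hZ
  have hZ0 : Z ≠ 0 := by
    intro h0
    apply h
    apply Subtype.ext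
    simpa [Z, sub_eq_zero] using h0
  have htr : Z 1 1 = - Z 0 0 := by
    simp only [Z, Matrix.sub_apply, mul_apply, Fin.sum_univ_two]
    ring
  have horth : Z 0 0 * (e 0 0 - e 1 1) + Z 0 1 * e 1 0 + Z 1 0 * e 0 1 = 0 := by
    simp only [Z, Matrix.sub_apply, mul_apply, Fin.sum_univ_two]
    ring
  have hdisc : (e 0 0 - e 1 1) ^ 2 + 4 * (e 0 1 * e 1 0) < 0 := by nlinarith
  suffices 0 < Z 0 0 ^ 2 + Z 0 1 * Z 1 0 by
    rw [det_fin_two, htr]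
    linarith
  clear_value Z
  have hbc : e 0 1 * e 1 0 < 0 := by nlinarith [sq_nonneg (e 0 0 - e 1 1)]
  have hsq : 4 * ((Z 0 1 * Z 1 0) * (e 0 1 * e 1 0)) ≤ Z 0 0 ^ 2 * (e 0 0 - e 1 1) ^ 2 := by
    have : (Z 0 1 * e 1 0 + Z 1 0 * e 0 1) ^ 2 = Z 0 0 ^ 2 * (e 0 0 - e 1 1) ^ 2 := by
      have : Z 0 1 * e 1 0 + Z 1 0 * e 0 1 = - (Z 0 0 * (e 0 0 - e 1 1)) := by linarith
      rw [this]; ring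
    nlinarith [sq_nonneg (Z 0 1 * e 1 0 - Z 1 0 * e 0 1)]
  by_cases hz : Z 0 0 = 0
  · rw [hz] at horth ⊢
    by_contra hcon
    have hb : e 0 1 ≠ 0 := by rintro h0; simp [h0] at hbc
    have hc : e 1 0 ≠ 0 := by rintro h0; simp [h0] at hbc
    have hxy : Z 0 1 * e 1 0 = - (Z 1 0 * e 0 1) := by linarith
    have h1 : Z 0 1 ^ 2 * (e 1 0) ^ 2 ≤ 0 := by
      have : Z 0 1 ^ 2 * (e 1 0) ^ 2 = - ((Z 0 1 * Z 1 0) * (e 0 1 * e 1 0)) := by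
        linear_combination Z 0 1 * e 1 0 * hxy
      rw [this]
      nlinarith
    have h01 : Z 0 1 = 0 := by
      by_contra h0
      have : 0 < Z 0 1 ^ 2 * (e 1 0) ^ 2 := by positivity
      linarith
    have h10 : Z 1 0 = 0 := by
      rw [h01] at hxy
      have : Z 1 0 * e 0 1 = 0 := by linarith
      exact (mul_eq_zero.1 this).resolve_right hb
    apply hZ0
    ext i j
    fin_cases i <;> fin_cases j <;> simp [h01, h10, htr, hz]
  · have : 0 < Z 0 0 ^ 2 := by positivity
    by_contra hcon
    push Not at hcon
    nlinarith

lemma exists_coeff_of_commute {e w : SL(2, ℝ)} (he : |(e : M₂(ℝ)).trace| < 2)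
    (h : e * w = w * e) : ∃ p q : ℝ, (w : M₂(ℝ)) = p • 1 + q • (e : M₂(ℝ)) ∧
      p ^ 2 + p * q * (e : M₂(ℝ)).trace + q ^ 2 = 1 := by
  have hdet : e 0 0 * e 1 1 - e 0 1 * e 1 0 = 1 := by
    rw [← det_fin_two]; exact e.2
  have hns : ∀ c : ℝ, (e : M₂(ℝ)) ≠ c • 1 := by
    intro c hc
    rw [hc] at he
    have := e.2
    rw [hc] at this
    simp at this
    simp [abs_lt] at he
    rcases this with h | h <;> linarith
  obtain ⟨p, q, hpq⟩ := exists_eq_smul_add_smul_of_commute hns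
    (A := (w : M₂(ℝ))) (by
      have := congrArg (fun g : SL(2, ℝ) => (g : M₂(ℝ))) h
      simpa using this.symm)
  refine ⟨p, q, hpq, ?_⟩
  have hw := w.2
  rw [hpq] at hw
  simp [det_fin_two] at hw
  rw [trace_fin_two]
  linear_combination hw - q ^ 2 * hdet

lemma abs_trace_le_two_of_commute {e w : SL(2, ℝ)} (he : |(e : M₂(ℝ)).trace| < 2)
    (h : e * w = w * e) : |(w : M₂(ℝ)).trace| ≤ 2 := by
  obtain ⟨p, q, hpq, hdet⟩ := exists_coeff_of_commute he h
  have htr : (w : M₂(ℝ)).trace = 2 * p + q * (e : M₂(ℝ)).trace := by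
    rw [hpq]
    simp [mul_comm]
  rw [htr]
  have : (e : M₂(ℝ)).trace ^ 2 < 4 := by
    rw [abs_lt] at he
    nlinarith
  refine abs_le_of_sq_le_sq (by nlinarith [sq_nonneg q]) zero_le_two

lemma exists_conj_not_commute {H : Subgroup SL(2, ℝ)} (hH : ¬ Group.IsSolvable H)
    {e : SL(2, ℝ)} (he : |(e : M₂(ℝ)).trace| < 2) :
    ∃ δ ∈ H, e * (δ * e * δ⁻¹) ≠ (δ * e * δ⁻¹) * e := by
  by_contra! hcon
  set X : M₂(ℝ) := (e : M₂(ℝ)) - ((e : M₂(ℝ)).trace / 2) • 1 with hX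
  refine hH (isSolvable_of_conj_commute (X := X) ?_ ?_ ?_)
  · intro h0
    have hc : (e : M₂(ℝ)) = ((e : M₂(ℝ)).trace / 2) • 1 := sub_eq_zero.1 h0
    have hdet := e.2
    rw [hc] at hdet
    simp only [det_smul, Fintype.card_fin, det_one] at hdet
    rw [abs_lt] at he
    nlinarith
  · simp [X, trace_sub]
  · intro γ hγ
    have hc := congrArg (fun g : SL(2, ℝ) => (g : M₂(ℝ))) (hcon γ hγ)
    simp only [Matrix.SpecialLinearGroup.coe_mul] at hc
    have : (γ : M₂(ℝ)) * X * (↑(γ⁻¹) : M₂(ℝ))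
        = (γ : M₂(ℝ)) * e * (↑(γ⁻¹) : M₂(ℝ)) - ((e : M₂(ℝ)).trace / 2) • 1 := by
      rw [hX, mul_sub, sub_mul, mul_smul_comm, smul_mul_assoc, mul_one, coe_mul_coe_inv]
    rw [this, hX]
    simp only [mul_sub, sub_mul, hc, mul_smul_comm, smul_mul_assoc, mul_one, one_mul]
    module

lemma trace_pow_eq_eval {K : Type*} [CommRing K] (g : SL(2, K)) (n : ℕ) :
    (↑(g ^ n) : M₂(K)).trace = (Polynomial.Chebyshev.C K n).eval (g : M₂(K)).trace := by
  have hrec : ∀ n : ℕ, (↑(g ^ (n + 2)) : M₂(K)).trace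
      = (g : M₂(K)).trace * (↑(g ^ (n + 1)) : M₂(K)).trace - (↑(g ^ n) : M₂(K)).trace := by
    intro n
    have hdet : g 0 0 * g 1 1 - g 0 1 * g 1 0 = 1 := by
      rw [← det_fin_two]; exact g.2
    rw [pow_succ, pow_succ]
    simp only [Matrix.SpecialLinearGroup.coe_mul]
    generalize (↑(g ^ n) : M₂(K)) = A
    simp only [trace_fin_two, mul_apply, Fin.sum_univ_two]
    linear_combination (- A 0 0 - A 1 1) * hdet
  induction n using Nat.twoStepInduction with
  | zero => simp
  | one => simp
  | more n h1 h2 =>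
    rw [hrec, h1, h2]
    push_cast
    rw [Polynomial.Chebyshev.C_add_two]
    simp

lemma finite_trace_of_pow_eq_one {N : ℕ} (hN : 0 < N) :
    {t : ℝ | ∃ g : SL(2, ℝ), g ^ N = 1 ∧ (g : M₂(ℝ)).trace = t}.Finite := by
  have hgrow : ∀ n : ℕ, 2 ≤ (Polynomial.Chebyshev.C ℝ n).eval 3 ∧
      (Polynomial.Chebyshev.C ℝ n).eval 3 < (Polynomial.Chebyshev.C ℝ (n + 1 : ℕ)).eval 3 := by
    intro n
    induction n with
    | zero => simp; norm_num
    | succ n ih =>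
      refine ⟨by linarith, ?_⟩
      have : (Polynomial.Chebyshev.C ℝ (n + 1 + 1 : ℕ)).eval 3
          = 3 * (Polynomial.Chebyshev.C ℝ (n + 1 : ℕ)).eval 3
            - (Polynomial.Chebyshev.C ℝ n).eval 3 := by
        push_cast
        rw [add_assoc, one_add_one_eq_two, Polynomial.Chebyshev.C_add_two]
        simp
      rw [this]
      linarith
  have hne : Polynomial.Chebyshev.C ℝ N - Polynomial.C 2 ≠ 0 := by
    intro h0
    obtain ⟨n, rfl⟩ := Nat.exists_eq_succ_of_ne_zero hN.ne'
    have h1 := congrArg (Polynomial.eval 3) h0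
    have h2 := hgrow n
    simp only [Polynomial.eval_sub, Polynomial.eval_C, Polynomial.eval_zero, Nat.succ_eq_add_one]
      at h1 h2
    linarith
  refine (Polynomial.finite_setOfPred_isRoot hne).subset ?_
  rintro t ⟨g, hg, rfl⟩
  have := trace_pow_eq_eval g N
  rw [hg] at this
  simp [Polynomial.IsRoot.def, ← this]

section Contraction

attribute [local instance] Matrix.linftyOpNormedRing Matrix.linftyOpNormedAlgebra

lemma norm_coe_inv_le (w : SL(2, ℝ)) :
    ‖(↑(w⁻¹) : M₂(ℝ))‖ ≤ 1 + 3 * ‖(w : M₂(ℝ)) - 1‖ := by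
  have hentry : ∀ (A : M₂(ℝ)) (i j : Fin 2), |A i j| ≤ ‖A‖ := by
    intro A i j
    rw [linfty_opNorm_def, ← Real.norm_eq_abs, ← coe_nnnorm, NNReal.coe_le_coe]
    exact (Finset.single_le_sum (f := fun j => ‖A i j‖₊) (fun _ _ => zero_le)
      (Finset.mem_univ j)).trans
      (Finset.le_sup (f := fun i => ∑ j, ‖A i j‖₊) (Finset.mem_univ i))
  set B : M₂(ℝ) := (w : M₂(ℝ)) - 1 with hB
  have hinv : (↑(w⁻¹) : M₂(ℝ)) = 1 + B.trace • 1 - B := by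
    rw [Matrix.SpecialLinearGroup.coe_inv, adjugate_fin_two, hB]
    ext i j
    fin_cases i <;> fin_cases j <;> simp [trace_fin_two]
    · ring
    · ring
  have htr : |B.trace| ≤ 2 * ‖B‖ := by
    rw [trace_fin_two]
    linarith [abs_add_le (B 0 0) (B 1 1), hentry B 0 0, hentry B 1 1]
  have h1 : ‖(1 : M₂(ℝ))‖ = 1 := norm_one
  have h2 : ‖B.trace • (1 : M₂(ℝ))‖ = |B.trace| := by
    rw [norm_smul, h1, mul_one, Real.norm_eq_abs]
  rw [hinv]
  have h3 := norm_sub_le (1 + B.trace • (1 : M₂(ℝ))) B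
  have h4 := norm_add_le (1 : M₂(ℝ)) (B.trace • (1 : M₂(ℝ)))
  linarith

lemma norm_coe_commutator_sub_one_le (e w : SL(2, ℝ)) :
    ‖(↑(e * w * e⁻¹ * w⁻¹) : M₂(ℝ)) - 1‖ ≤
      2 * ‖(e : M₂(ℝ)) - 1‖ * ‖(w : M₂(ℝ)) - 1‖ *
        ((1 + 3 * ‖(e : M₂(ℝ)) - 1‖) * (1 + 3 * ‖(w : M₂(ℝ)) - 1‖)) := by
  have h : (↑(e * w * e⁻¹ * w⁻¹) : M₂(ℝ)) - 1
      = (((e : M₂(ℝ)) - 1) * ((w : M₂(ℝ)) - 1) - ((w : M₂(ℝ)) - 1) * ((e : M₂(ℝ)) - 1))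
        * ((↑(e⁻¹) : M₂(ℝ)) * (↑(w⁻¹) : M₂(ℝ))) := by
    have h1 : ((e : M₂(ℝ)) - 1) * ((w : M₂(ℝ)) - 1) - ((w : M₂(ℝ)) - 1) * ((e : M₂(ℝ)) - 1)
        = (e : M₂(ℝ)) * w - (w : M₂(ℝ)) * e := by noncomm_ring
    have h2 : (w : M₂(ℝ)) * e * ((↑(e⁻¹) : M₂(ℝ)) * (↑(w⁻¹) : M₂(ℝ))) = 1 := by
      rw [mul_assoc, ← mul_assoc (e : M₂(ℝ)), coe_mul_coe_inv, one_mul, coe_mul_coe_inv]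
    rw [h1, sub_mul, h2]
    simp only [Matrix.SpecialLinearGroup.coe_mul, mul_assoc]
  rw [h]
  refine (norm_mul_le _ _).trans (mul_le_mul ?_ ?_ (norm_nonneg _) (by positivity))
  · refine (norm_sub_le _ _).trans ?_
    have h1 := norm_mul_le ((e : M₂(ℝ)) - 1) ((w : M₂(ℝ)) - 1)
    have h2 := norm_mul_le ((w : M₂(ℝ)) - 1) ((e : M₂(ℝ)) - 1)
    linarith
  · exact (norm_mul_le _ _).trans
      (mul_le_mul (norm_coe_inv_le e) (norm_coe_inv_le w) (norm_nonneg _) (by positivity))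

/-- Iterated commutators with an element close to the identity converge to the identity. -/
lemma exists_nhds_tendsto_iterate_commutator (γ : SL(2, ℝ)) :
    ∃ U ∈ 𝓝 (1 : M₂(ℝ)), ∀ e : SL(2, ℝ), (e : M₂(ℝ)) ∈ U →
      Tendsto (fun n => (((fun w => e * w * e⁻¹ * w⁻¹)^[n] γ : SL(2, ℝ)) : M₂(ℝ))) atTop (𝓝 1) := by
  set R := ‖(γ : M₂(ℝ)) - 1‖ with hR
  have hR0 : 0 ≤ R := norm_nonneg _
  set ε : ℝ := (16 * (1 + 3 * R))⁻¹ with hε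
  have hε0 : 0 < ε := by positivity
  have hε1 : ε ≤ 1 := inv_le_one_of_one_le₀ (by linarith)
  refine ⟨Metric.ball 1 ε, Metric.ball_mem_nhds _ hε0, fun e he => ?_⟩
  rw [mem_ball_iff_norm] at he
  have hb : ∀ n, ‖(((fun w => e * w * e⁻¹ * w⁻¹)^[n] γ : SL(2, ℝ)) : M₂(ℝ)) - 1‖
      ≤ R * (1 / 2) ^ n := by
    intro n
    induction n with
    | zero => simp [hR]
    | succ n ih =>
      rw [Function.iterate_succ_apply']
      set w := (fun w => e * w * e⁻¹ * w⁻¹)^[n] γ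
      refine (norm_coe_commutator_sub_one_le e w).trans ?_
      have hwR : ‖(w : M₂(ℝ)) - 1‖ ≤ R :=
        ih.trans (mul_le_of_le_one_right hR0 (pow_le_one₀ (by norm_num) (by norm_num)))
      calc _ ≤ 2 * ε * (R * (1 / 2) ^ n) * ((1 + 3 * 1) * (1 + 3 * R)) := by
            gcongr
            exact he.le.trans hε1
        _ = (8 * (1 + 3 * R) * ε) * (R * (1 / 2) ^ n) := by ring
        _ = R * (1 / 2) ^ (n + 1) := by
            have : 8 * (1 + 3 * R) * ε = 1 / 2 := by
              rw [hε]
              field_simp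
              norm_num
            rw [this]; ring
  refine tendsto_iff_norm_sub_tendsto_zero.2 ?_
  refine squeeze_zero (fun _ => norm_nonneg _) hb ?_
  simpa using (tendsto_pow_atTop_nhds_zero_of_lt_one (r := (1 / 2 : ℝ)) (by norm_num)
    (by norm_num)).const_mul R

end Contraction

lemma exists_elliptic_not_isOfFinOrder {H : Subgroup SL(2, ℝ)} (hH : ¬ Group.IsSolvable H)
    (hnd : ∀ U ∈ 𝓝 (1 : M₂(ℝ)), ∃ g ∈ H, g ≠ 1 ∧ (g : M₂(ℝ)) ∈ U) :
    ∃ a ∈ H, |(a : M₂(ℝ)).trace| < 2 ∧ ¬ IsOfFinOrder a := by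
  by_contra! hcon
  have htrc : Continuous fun A : M₂(ℝ) => A.trace := continuous_id.matrix_trace
  obtain ⟨e₀, he₀H, -, he₀⟩ := exists_elliptic_of_not_isSolvable hH hnd univ_mem
  obtain ⟨δ, hδ, hne⟩ := exists_conj_not_commute hH he₀
  set γ := e₀ * (δ * e₀ * δ⁻¹) * e₀⁻¹ * (δ * e₀ * δ⁻¹)⁻¹ with hγ
  have hγ2 : 2 < (γ : M₂(ℝ)).trace := two_lt_trace_commutator he₀ hne
  have hγH : γ ∈ H := by
    have h1 := H.mul_mem (H.mul_mem hδ he₀H) (H.inv_mem hδ)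
    exact H.mul_mem (H.mul_mem (H.mul_mem he₀H h1) (H.inv_mem he₀H)) (H.inv_mem h1)
  obtain ⟨U, hU, hconv⟩ := exists_nhds_tendsto_iterate_commutator γ
  have hpos : {A : M₂(ℝ) | 0 < A.trace} ∈ 𝓝 1 :=
    (isOpen_lt continuous_const htrc).mem_nhds (by simp)
  obtain ⟨e, heH, ⟨heU, hetr⟩, he⟩ :=
    exists_elliptic_of_not_isSolvable hH hnd (inter_mem hU hpos)
  have hetr : 0 < (e : M₂(ℝ)).trace := hetr
  have hlim := hconv e heU
  set w : ℕ → SL(2, ℝ) := fun n => (fun w => e * w * e⁻¹ * w⁻¹)^[n] γ with hw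
  have hw2 : ∀ n, 2 < (w n : M₂(ℝ)).trace := by
    intro n
    induction n with
    | zero => exact hγ2
    | succ n ih =>
      simp only [hw, Function.iterate_succ_apply']
      refine two_lt_trace_commutator he fun hc => ?_
      exact ((le_abs_self _).trans (abs_trace_le_two_of_commute he hc)).not_gt ih
  set S : Set SL(2, ℝ) := {e, γ}
  have heS : e ∈ Subgroup.closure S := Subgroup.subset_closure (by simp [S])
  have hwS : ∀ n, w n ∈ Subgroup.closure S := by
    intro n
    induction n with
    | zero => exact Subgroup.subset_closure (by simp [S, hw])
    | succ n ih =>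
      simp only [hw, Function.iterate_succ_apply']
      exact mul_mem (mul_mem (mul_mem heS ih) (inv_mem heS)) (inv_mem ih)
  have hSH : Subgroup.closure S ≤ H := by
    rw [Subgroup.closure_le]
    rintro x (rfl | rfl) <;> assumption
  obtain ⟨N, hN, hNS⟩ := exists_pow_eq_one_of_mem_closure (S := S) (Set.toFinite _)
  set T := {t : ℝ | ∃ g : SL(2, ℝ), g ^ N = 1 ∧ (g : M₂(ℝ)).trace = t}
  have hT : T.Finite := finite_trace_of_pow_eq_one hN
  have hev : ∀ u ∈ Subgroup.closure S, (u : M₂(ℝ)).trace = (e : M₂(ℝ)).trace →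
      ∀ᶠ n in atTop, ((u : M₂(ℝ)) * w n).trace = (e : M₂(ℝ)).trace := by
    intro u hu hut
    have hl : Tendsto (fun n => ((u : M₂(ℝ)) * w n).trace) atTop (𝓝 (e : M₂(ℝ)).trace) := by
      have := (htrc.tendsto _).comp ((tendsto_const_nhds (x := (u : M₂(ℝ)))).mul hlim)
      rw [mul_one, hut] at this
      exact this
    have h1 : ∀ᶠ t in 𝓝 (e : M₂(ℝ)).trace, |t| < 2 :=
      (isOpen_lt continuous_abs continuous_const).mem_nhds he
    have h2 : ∀ᶠ t in 𝓝 (e : M₂(ℝ)).trace, t ∉ T \ {(e : M₂(ℝ)).trace} :=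
      (hT.subset Set.sdiff_subset).isClosed.isOpen_compl.mem_nhds (by simp)
    filter_upwards [hl.eventually h1, hl.eventually h2] with n hn1 hn2
    have hm : u * w n ∈ Subgroup.closure S := mul_mem hu (hwS n)
    have hfin := hcon (u * w n) (hSH hm) (by simpa using hn1)
    have hT' : ((u : M₂(ℝ)) * w n).trace ∈ T :=
      ⟨u * w n, hNS _ hm hfin, by rw [Matrix.SpecialLinearGroup.coe_mul]⟩
    by_contra hne
    exact hn2 ⟨hT', hne⟩
  have hinv : (↑(e⁻¹) : M₂(ℝ)).trace = (e : M₂(ℝ)).trace := by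
    rw [Matrix.SpecialLinearGroup.coe_inv, adjugate_fin_two, trace_fin_two, trace_fin_two]
    simp [add_comm]
  obtain ⟨n, hn1, hn2⟩ := ((hev e heS rfl).and (hev e⁻¹ (inv_mem heS) hinv)).exists
  have hsum : ((e : M₂(ℝ)) * w n).trace + ((↑(e⁻¹) : M₂(ℝ)) * w n).trace
      = (e : M₂(ℝ)).trace * (w n : M₂(ℝ)).trace := by
    rw [Matrix.SpecialLinearGroup.coe_inv]
    simp only [trace_fin_two, mul_apply, Fin.sum_univ_two, adjugate_fin_two, of_apply,
      cons_val_zero, cons_val_one, cons_val', cons_val_fin_one]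
    ring
  rw [hn1, hn2] at hsum
  have := hw2 n
  nlinarith

/-- The centralizer in `SL₂(ℝ)` of an elliptic element is relatively compact. -/
lemma exists_isCompact_of_commute {e : SL(2, ℝ)} (he : |(e : M₂(ℝ)).trace| < 2) :
    ∃ K : Set M₂(ℝ), IsCompact K ∧ ∀ w : SL(2, ℝ), e * w = w * e → (w : M₂(ℝ)) ∈ K := by
  set t := (e : M₂(ℝ)).trace with ht
  have ht4 : 0 < 4 - t ^ 2 := by
    rw [abs_lt] at he
    nlinarith
  set L : ℝ := 1 + 4 / (4 - t ^ 2) with hL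
  refine ⟨(fun x : ℝ × ℝ => x.1 • (1 : M₂(ℝ)) + x.2 • (e : M₂(ℝ))) ''
    (Set.Icc (-L) L ×ˢ Set.Icc (-L) L),
    (isCompact_Icc.prod isCompact_Icc).image (by fun_prop), fun w hw => ?_⟩
  obtain ⟨p, q, hpq, hdet⟩ := exists_coeff_of_commute he hw
  have hb : ∀ x y : ℝ, x ^ 2 + x * y * t + y ^ 2 = 1 → x ∈ Set.Icc (-L) L := by
    intro x y hxy
    have h1 : x ^ 2 ≤ 4 / (4 - t ^ 2) := by
      rw [le_div_iff₀ ht4]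
      nlinarith [sq_nonneg (2 * y + x * t)]
    rw [Set.mem_Icc, ← abs_le]
    have := sq_abs x
    nlinarith [sq_nonneg (|x| - 1), abs_nonneg x]
  exact ⟨(p, q), ⟨hb p q hdet, hb q p (by linarith)⟩, hpq.symm⟩

lemma exists_pow_mem_nhds_one {a : SL(2, ℝ)} (ha : |(a : M₂(ℝ)).trace| < 2)
    {U : Set M₂(ℝ)} (hU : U ∈ 𝓝 1) : ∃ k : ℕ, 0 < k ∧ (↑(a ^ k) : M₂(ℝ)) ∈ U := by
  obtain ⟨K, hK, hKa⟩ := exists_isCompact_of_commute ha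
  have : FirstCountableTopology M₂(ℝ) :=
    inferInstanceAs (FirstCountableTopology (Fin 2 → Fin 2 → ℝ))
  obtain ⟨A, -, φ, hφ, hlim⟩ := hK.tendsto_subseq (x := fun k : ℕ => (↑(a ^ k) : M₂(ℝ)))
    fun k => hKa _ (pow_mul_comm' a k).symm
  have hadj : Continuous fun B : M₂(ℝ) => B.adjugate := continuous_id.matrix_adjugate
  have hdet : A.det = 1 := by
    have h1 := ((continuous_id.matrix_det (A := fun B : M₂(ℝ) => B)).tendsto A).comp hlim
    refine tendsto_nhds_unique h1 (tendsto_const_nhds.congr fun k => ?_)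
    exact (a ^ φ k).2.symm
  have h2 := (hlim.comp (tendsto_add_atTop_nat 1)).mul ((hadj.tendsto A).comp hlim)
  rw [mul_adjugate, hdet, one_smul] at h2
  obtain ⟨k, hk⟩ := (h2.eventually hU).exists
  have hlt : φ k < φ (k + 1) := hφ (Nat.lt_succ_self k)
  refine ⟨φ (k + 1) - φ k, Nat.sub_pos_of_lt hlt, ?_⟩
  rw [pow_sub _ hlt.le, Matrix.SpecialLinearGroup.coe_mul, Matrix.SpecialLinearGroup.coe_inv]
  exact hk

/-- An elliptic element `a` of `SL₂(ℝ)` becomes diagonal in `SL₂(ℂ)`, in such a way that elements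
not commuting with `a` have no zero entry. -/
lemma exists_monoidHom_eq_diagSL {a γ : SL(2, ℝ)} (ha : |(a : M₂(ℝ)).trace| < 2)
    (hne : a * γ ≠ γ * a) :
    ∃ φ : SL(2, ℝ) →* SL(2, ℂ), Function.Injective φ ∧
      (∃ u : ℂˣ, ‖(u : ℂ)‖ = 1 ∧ φ a = diagSL u) ∧ ∀ i j, φ γ i j ≠ 0 := by
  have hdet : a 0 0 * a 1 1 - a 0 1 * a 1 0 = 1 := by
    rw [← det_fin_two]; exact a.2
  have hγdet : γ 0 0 * γ 1 1 - γ 0 1 * γ 1 0 = 1 := by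
    rw [← det_fin_two]; exact γ.2
  rw [trace_fin_two, abs_lt] at ha
  set α := a 0 0
  set β := a 0 1
  set δ := a 1 0
  set η := a 1 1
  set p := γ 0 0
  set q := γ 0 1
  set r := γ 1 0
  set s := γ 1 1
  have hβ : β ≠ 0 := by
    intro h0
    rw [h0] at hdet
    nlinarith [sq_nonneg (α - η)]
  set m := (η - α) / 2 with hm
  have hy2 : 0 < 1 - (α + η) ^ 2 / 4 := by nlinarith
  set y := √(1 - (α + η) ^ 2 / 4) with hy
  have hy0 : 0 < y := Real.sqrt_pos.2 hy2
  have hysq : y ^ 2 = 1 - (α + η) ^ 2 / 4 := Real.sq_sqrt hy2.le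
  have hmy : m ^ 2 + y ^ 2 = - (β * δ) := by
    rw [hysq, hm]; linear_combination -hdet
  set z : ℂ := ⟨m, y⟩ with hz
  set z' : ℂ := ⟨m, -y⟩ with hz'
  set l : ℂ := ⟨(α + η) / 2, y⟩ with hl
  set l' : ℂ := ⟨(α + η) / 2, -y⟩ with hl'
  have hll : l * l' = 1 := by
    apply Complex.ext <;> simp [hl, hl'] <;> nlinarith
  have hD : (β : ℂ) * (z' - z) ≠ 0 := by
    refine mul_ne_zero (by exact_mod_cast hβ) fun h0 => ?_
    have := congrArg Complex.im h0
    simp [hz, hz'] at this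
    linarith
  have hz'z : z' - z ≠ 0 := right_ne_zero_of_mul hD
  have hβ' : (β : ℂ) ≠ 0 := left_ne_zero_of_mul hD
  set D : ℂ := (β : ℂ) * (z' - z) with hDdef
  have hA : ∀ ε : ℝ, ε ^ 2 = 1 → (p * β * ⟨m, - (ε * y)⟩ + q * (⟨m, ε * y⟩ * ⟨m, - (ε * y)⟩)
      - r * β ^ 2 - s * β * ⟨m, ε * y⟩ : ℂ) ≠ 0 := by
    intro ε hε h0
    have hε0 : ε ≠ 0 := by rintro rfl; norm_num at hε
    have hre := congrArg Complex.re h0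
    have him := congrArg Complex.im h0
    simp [pow_two] at hre him
    have hs : s = - p := by
      have : (ε * y * β) * (s + p) = 0 := by linarith
      have := (mul_eq_zero.1 this).resolve_left (by positivity)
      linarith
    have hre' : β * (2 * p * m - q * δ - r * β) = 0 := by
      rw [hs] at hre
      have h2 : ε * y * (ε * y) = y ^ 2 := by linear_combination y ^ 2 * hε
      rw [h2] at hre
      linear_combination hre - q * hmy
    have h3 := (mul_eq_zero.1 hre').resolve_left hβ
    rw [hs] at hγdet
    have h4 : (r * β - p * m) ^ 2 + p ^ 2 * y ^ 2 + m ^ 2 + y ^ 2 = 0 := by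
      linear_combination (1 + p ^ 2) * hmy - r * β * h3 + β * δ * hγdet
    nlinarith [sq_nonneg (r * β - p * m), sq_nonneg (p * y), sq_nonneg m, pow_pos hy0 2]
  have hB : ∀ ε : ℝ, ε ^ 2 = 1 → (r * β ^ 2 + (s - p) * β * ⟨m, ε * y⟩
      - q * (⟨m, ε * y⟩ * ⟨m, ε * y⟩) : ℂ) ≠ 0 := by
    intro ε hε h0
    have hε0 : ε ≠ 0 := by rintro rfl; norm_num at hε
    have hre := congrArg Complex.re h0
    have him := congrArg Complex.im h0
    simp [pow_two] at hre him
    have h1 : (s - p) * β = q * (2 * m) := by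
      have : (ε * y) * ((s - p) * β - q * (2 * m)) = 0 := by linarith
      have := (mul_eq_zero.1 this).resolve_left (by positivity)
      linarith
    have h2 : r * β - q * δ = 0 := by
      have h2 : ε * y * (ε * y) = y ^ 2 := by linear_combination y ^ 2 * hε
      rw [h2] at hre
      have : β * (r * β - q * δ) = 0 := by linear_combination hre - m * h1 - q * hmy
      exact (mul_eq_zero.1 this).resolve_left hβ
    have h3 : (η - α) * r + δ * (p - s) = 0 := by
      have : β * ((η - α) * r + δ * (p - s)) = 0 := by
        linear_combination (η - α) * h2 - δ * h1 + 2 * q * δ * hm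
      exact (mul_eq_zero.1 this).resolve_left hβ
    apply hne
    apply Subtype.ext
    rw [Matrix.SpecialLinearGroup.coe_mul, Matrix.SpecialLinearGroup.coe_mul]
    ext i j
    fin_cases i <;> fin_cases j <;>
      simp only [Fin.zero_eta, Fin.mk_one, Fin.isValue, mul_apply, Fin.sum_univ_two]
    · change α * p + β * r = p * α + q * δ
      linear_combination h2
    · change α * q + β * s = p * β + q * η
      linear_combination h1 + 2 * q * hm
    · change δ * p + η * r = r * α + s * δ
      linear_combination h3
    · change δ * q + η * s = r * β + s * η
      linear_combination -h2
  have hA1 := hA 1 (by norm_num)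
  have hA2 := hA (-1) (by norm_num)
  have hB1 := hB 1 (by norm_num)
  have hB2 := hB (-1) (by norm_num)
  simp only [one_mul, neg_mul, neg_neg] at hA1 hA2 hB1 hB2
  rw [← hz, ← hz'] at hA1 hA2
  rw [← hz] at hB1
  rw [← hz'] at hB2
  let P : SL(2, ℂ) := ⟨!![(β : ℂ), β / D; z, z' / D], by
    rw [det_fin_two_of]
    field_simp
    exact hDdef.symm⟩
  have hPinv : (↑(P⁻¹) : M₂(ℂ)) = !![z' / D, - (β / D); - z, (β : ℂ)] := by
    rw [Matrix.SpecialLinearGroup.coe_inv, adjugate_fin_two]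
    rfl
  let ι := Matrix.SpecialLinearGroup.map (n := Fin 2) (algebraMap ℝ ℂ)
  have hι : Function.Injective ι := by
    intro g h hgh
    apply Subtype.ext
    ext i j
    have := congrArg (fun x : SL(2, ℂ) => x i j) hgh
    simpa [ι] using this
  refine ⟨(MulAut.conj P⁻¹).toMonoidHom.comp ι, (MulAut.conj P⁻¹).injective.comp hι,
    ⟨⟨l, l', hll, by rw [mul_comm, hll]⟩, ?_, ?_⟩, ?_⟩
  · change ‖l‖ = 1
    have h1 : ‖l‖ ^ 2 = 1 := by
      rw [Complex.sq_norm, Complex.normSq_mk]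
      nlinarith
    exact (pow_eq_one_iff_of_nonneg (norm_nonneg l) two_ne_zero).1 h1
  · change P⁻¹ * ι a * P⁻¹⁻¹ = _
    rw [inv_inv, mul_assoc, inv_mul_eq_iff_eq_mul]
    apply Subtype.ext
    rw [Matrix.SpecialLinearGroup.coe_mul, Matrix.SpecialLinearGroup.coe_mul, coe_diagSL]
    have hιa : (ι a : M₂(ℂ)) = !![(α : ℂ), (β : ℂ); (δ : ℂ), (η : ℂ)] := by
      ext i j
      fin_cases i <;> fin_cases j <;> rfl
    have hP : (P : M₂(ℂ)) = !![(β : ℂ), β / D; z, z' / D] := rfl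
    have e1 : (α : ℂ) + z = l := by
      apply Complex.ext <;> simp [hz, hl, hm]; ring
    have e2 : (α : ℂ) + z' = l' := by
      apply Complex.ext <;> simp [hz', hl', hm]; ring
    have e3 : (δ : ℂ) * β + η * z = z * l := by
      apply Complex.ext <;> simp [hz, hl]
      · linear_combination hmy - m * hm
      · rw [hm]; ring
    have e4 : (δ : ℂ) * β + η * z' = z' * l' := by
      apply Complex.ext <;> simp [hz', hl']
      · linear_combination hmy - m * hm
      · rw [hm]; ring
    rw [hιa, hP]
    ext i j
    fin_cases i <;> fin_cases j <;> simp [mul_apply, Fin.sum_univ_two]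
    · linear_combination (β : ℂ) * e1
    · linear_combination (β / D : ℂ) * e2
    · linear_combination e3
    · linear_combination (1 / D : ℂ) * e4
  · have hγ : (((MulAut.conj P⁻¹).toMonoidHom.comp ι) γ : M₂(ℂ))
        = !![z' / D, - (β / D); - z, (β : ℂ)] * !![(p : ℂ), (q : ℂ); (r : ℂ), (s : ℂ)]
          * !![(β : ℂ), β / D; z, z' / D] := by
      have hιγ : (ι γ : M₂(ℂ)) = !![(p : ℂ), (q : ℂ); (r : ℂ), (s : ℂ)] := by
        ext i j
        fin_cases i <;> fin_cases j <;> rfl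
      rw [← hPinv, ← hιγ]
      change (↑(P⁻¹ * ι γ * P⁻¹⁻¹) : M₂(ℂ)) = _
      rw [inv_inv, Matrix.SpecialLinearGroup.coe_mul, Matrix.SpecialLinearGroup.coe_mul]
    rw [hγ]
    intro i j h0
    fin_cases i <;> fin_cases j <;> simp [mul_apply, Fin.sum_univ_two] at h0
    · apply hA1
      field_simp at h0
      linear_combination h0
    · apply hB2
      field_simp at h0
      linear_combination -h0
    · apply hB1
      linear_combination h0
    · apply hA2
      field_simp at h0
      linear_combination -h0

lemma exists_injective_lift_pow {a γ : SL(2, ℝ)} (ha : |(a : M₂(ℝ)).trace| < 2)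
    (hinf : ¬ IsOfFinOrder a) (hne : a * γ ≠ γ * a) :
    ∃ n, 0 < n ∧ Function.Injective
      (FreeGroup.lift fun i : Bool => if i then a ^ n else γ * a ^ n * γ⁻¹) := by
  obtain ⟨φ, hφ, ⟨u, hu, hua⟩, hγ⟩ := exists_monoidHom_eq_diagSL ha hne
  have hroot : ∀ k, 0 < k → (u : ℂ) ^ k ≠ 1 := by
    intro k hk huk
    apply hinf
    rw [← hφ.isOfFinOrder_iff, isOfFinOrder_iff_pow_eq_one]
    refine ⟨k, hk, ?_⟩
    have : u ^ k = 1 := Units.ext (by simpa using huk)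
    rw [hua, diagSL_pow, this]
    exact Subtype.ext (by simp [coe_diagSL, one_fin_two])
  obtain ⟨n, hn, hinj⟩ := exists_injective_lift_diagSL u hu hroot (φ γ) hγ
  refine ⟨n, hn, .of_comp (f := φ) ?_⟩
  have : φ.comp (FreeGroup.lift fun i : Bool => if i then a ^ n else γ * a ^ n * γ⁻¹)
      = FreeGroup.lift fun i : Bool =>
        if i then diagSL u ^ n else φ γ * diagSL u ^ n * (φ γ)⁻¹ := by
    ext i
    cases i <;> simp [← hua]
  rw [← MonoidHom.coe_comp, this]
  exact hinj

instance : IsTopologicalGroup SL(2, ℝ) := Matrix.SpecialLinearGroup.topologicalGroup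

lemma sq_eq_one_of_mem_center {z : SL(2, ℝ)} (hz : z ∈ Subgroup.center SL(2, ℝ)) : z ^ 2 = 1 := by
  obtain ⟨r, hr, h⟩ := Matrix.SpecialLinearGroup.mem_center_iff.1 hz
  rw [Fintype.card_fin] at hr
  apply Subtype.ext
  rw [Matrix.SpecialLinearGroup.coe_pow, ← h, ← map_pow, hr, map_one,
    Matrix.SpecialLinearGroup.coe_one]

lemma FreeGroup.lift_injective_of_center {G α : Type*} [Group G] {f : α → G}
    (hG : ∀ z ∈ Subgroup.center G, z ^ 2 = 1) (hf : Function.Injective (FreeGroup.lift f)) :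
    Function.Injective (FreeGroup.lift fun i => (f i : G ⧸ Subgroup.center G)) := by
  have : FreeGroup.lift (fun i => (f i : G ⧸ Subgroup.center G))
      = (QuotientGroup.mk' (Subgroup.center G)).comp (FreeGroup.lift f) := by
    ext i
    simp
  rw [this, injective_iff_map_eq_one]
  intro w hw
  have h1 : FreeGroup.lift f w ∈ Subgroup.center G := (QuotientGroup.eq_one_iff _).1 hw
  have h2 : FreeGroup.lift f (w ^ 2) = 1 := by rw [map_pow, hG _ h1]
  have h3 : w ^ 2 = 1 := (injective_iff_map_eq_one _).1 hf _ h2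
  exact pow_left_injective two_ne_zero (by simpa using h3)

lemma exists_ne_one_mem_nhds_of_not_discrete {Γ : Subgroup PSL2R} (hΓ : ¬ DiscreteTopology Γ)
    {U : Set M₂(ℝ)} (hU : U ∈ 𝓝 1) :
    ∃ g ∈ Γ.comap (QuotientGroup.mk' _), g ≠ 1 ∧ (g : M₂(ℝ)) ∈ U := by
  by_contra! hcon
  apply hΓ
  apply discreteTopology_of_isOpen_singleton_one
  have hO : IsOpen {g : SL(2, ℝ) | (g : M₂(ℝ)) ∈ interior U} :=
    isOpen_interior.preimage continuous_induced_dom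
  have hmk := QuotientGroup.isOpenMap_coe (N := Subgroup.center SL(2, ℝ)) _ hO
  refine isOpen_induced_iff.2 ⟨_, hmk, ?_⟩
  ext ⟨x, hx⟩
  simp only [Set.mem_preimage, Set.mem_singleton_iff, Subgroup.mk_eq_one]
  constructor
  · rintro ⟨g, hg, rfl⟩
    by_contra hne
    refine hcon g hx ?_ (interior_subset hg)
    rintro rfl
    exact hne rfl
  · rintro rfl
    exact ⟨1, mem_interior_iff_mem_nhds.2 hU, rfl⟩

lemma not_discrete_of_pow_mem {a : SL(2, ℝ)} (ha : |(a : M₂(ℝ)).trace| < 2)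
    (hinf : ¬ IsOfFinOrder a) {n : ℕ} (hn : 0 < n) {Δ : Subgroup PSL2R}
    (hΔ : ((a ^ n : SL(2, ℝ)) : PSL2R) ∈ Δ) : ¬ DiscreteTopology Δ := by
  intro hdisc
  obtain ⟨V, hV, hV1⟩ := isOpen_induced_iff.1 (isOpen_discrete ({1} : Set Δ))
  obtain ⟨W, hW, hWV⟩ := isOpen_induced_iff.1 (hV.preimage
    (QuotientGroup.continuous_mk (N := Subgroup.center SL(2, ℝ))))
  have h1V : (1 : PSL2R) ∈ V := by
    have : (1 : Δ) ∈ Subtype.val ⁻¹' V := hV1 ▸ rfl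
    exact this
  have h1W : (1 : M₂(ℝ)) ∈ W := by
    have : (1 : SL(2, ℝ)) ∈ (fun g : SL(2, ℝ) => (g : M₂(ℝ))) ⁻¹' W := hWV ▸ h1V
    exact this
  have hpow : (fun A : M₂(ℝ) => A ^ n) ⁻¹' W ∈ 𝓝 1 :=
    (hW.preimage (continuous_pow n)).mem_nhds (by simpa using h1W)
  obtain ⟨k, hk, hkW⟩ := exists_pow_mem_nhds_one ha hpow
  have hmem : (a ^ k) ^ n ∈ (fun g : SL(2, ℝ) => (g : M₂(ℝ))) ⁻¹' W := by
    simpa using hkW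
  rw [hWV] at hmem
  have hΔk : (((a ^ k) ^ n : SL(2, ℝ)) : PSL2R) ∈ Δ := by
    rw [pow_right_comm]
    exact Δ.pow_mem hΔ k
  have h1 : (⟨_, hΔk⟩ : Δ) ∈ ({1} : Set Δ) := hV1 ▸ hmem
  have h2 : (((a ^ k) ^ n : SL(2, ℝ)) : PSL2R) = 1 := congrArg Subtype.val h1
  have h3 := sq_eq_one_of_mem_center ((QuotientGroup.eq_one_iff _).1 h2)
  rw [← pow_mul, ← pow_mul] at h3
  exact hinf (isOfFinOrder_iff_pow_eq_one.2 ⟨_, by positivity, h3⟩)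

/-- Ghys–Carrière: every nondiscrete subgroup of PSL₂(ℝ) is either solvable or
contains a nondiscrete free subgroup on two generators. -/
theorem nondiscrete_subgroup_solvable_or_contains_nondiscrete_free
    (Γ : Subgroup PSL2R) (hΓ : ¬ DiscreteTopology Γ) :
    IsSolvable Γ ∨
      ∃ a b : PSL2R, a ∈ Γ ∧ b ∈ Γ ∧
        Function.Injective (FreeGroup.lift fun i : Bool => if i then a else b) ∧
        ¬ DiscreteTopology (FreeGroup.lift fun i : Bool => if i then a else b).range := by
  set H : Subgroup SL(2, ℝ) := Γ.comap (QuotientGroup.mk' _)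
  by_cases hH : Group.IsSolvable H
  · left
    exact Group.isSolvable_of_surjective (f := (QuotientGroup.mk' _).subgroupComap Γ)
      (MonoidHom.subgroupComap_surjective_of_surjective _ _ (QuotientGroup.mk'_surjective _))
  right
  obtain ⟨a, haH, ha, hinf⟩ := exists_elliptic_not_isOfFinOrder hH
    fun U hU => exists_ne_one_mem_nhds_of_not_discrete hΓ hU
  obtain ⟨δ, hδ, hne⟩ := exists_conj_not_commute hH ha
  set γ := δ * a * δ⁻¹
  have hγ : γ ∈ H := H.mul_mem (H.mul_mem hδ haH) (H.inv_mem hδ)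
  obtain ⟨n, hn, hinj⟩ := exists_injective_lift_pow ha hinf hne
  have han : a ^ n ∈ H := H.pow_mem haH n
  have hfun : (fun i : Bool => if i then ((a ^ n : SL(2, ℝ)) : PSL2R)
      else ((γ * a ^ n * γ⁻¹ : SL(2, ℝ)) : PSL2R))
      = fun i : Bool => ((if i then a ^ n else γ * a ^ n * γ⁻¹ : SL(2, ℝ)) : PSL2R) := by
    funext i
    cases i <;> rfl
  refine ⟨_, _, han, H.mul_mem (H.mul_mem hγ han) (H.inv_mem hγ), ?_, ?_⟩
  · have := FreeGroup.lift_injective_of_center (fun z => sq_eq_one_of_mem_center) hinj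
    rw [← hfun] at this
    exact this
  · refine not_discrete_of_pow_mem ha hinf hn ⟨FreeGroup.of true, ?_⟩
    rw [FreeGroup.lift_apply_of]
    rfl
end

section
/- (Monod) Let H(ℝ) be the group (under composition) of increasing homeomorphisms h of ℝ for which there exist finitely many points x₁ < x₂ < ... < x_k in ℝ such that on each of the intervals (−∞, x₁), (x₁, x₂), ..., (x_{k−1}, x_k), (x_k, ∞), h agrees with a fractional linear transformation t ↦ (a·t + b)/(c·t + d) for some matrix [[a, b], [c, d]] ∈ SL₂(ℝ). Then for all f, g ∈ H(ℝ), either the subgroup generated by f and g is metabelian (its commutator subgroup is abelian), or the subgroup generated by f and g contains a subgroup isomorphic to the free abelian group of countably infinite rank ⨁_{n ∈ ℕ} ℤ. -/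
/-- h agrees on the set s with the fractional linear transformation coming from a matrix in
SL₂(ℝ). -/
def IsFracLinOn (h : ℝ → ℝ) (s : Set ℝ) : Prop :=
  ∃ g : Matrix.SpecialLinearGroup (Fin 2) ℝ, ∀ t ∈ s,
    h t = (g.1 0 0 * t + g.1 0 1) / (g.1 1 0 * t + g.1 1 1)

/-- h is piecewise PSL₂(ℝ): there are finitely many points x₀ < x₁ < ⋯ < x_k such that on
each of the intervals (−∞, x₀), (x₀, x₁), …, (x_{k−1}, x_k), (x_k, ∞), h agrees with a
fractional linear transformation coming from SL₂(ℝ). -/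
def PiecewisePSL (h : ℝ → ℝ) : Prop :=
  ∃ (k : ℕ) (x : Fin (k + 1) → ℝ), StrictMono x ∧
    IsFracLinOn h (Set.Iio (x 0)) ∧
    IsFracLinOn h (Set.Ioi (x (Fin.last k))) ∧
    ∀ i : Fin k, IsFracLinOn h (Set.Ioo (x i.castSucc) (x i.succ))

/-- Membership in Monod's group H(ℝ) of increasing piecewise-PSL₂(ℝ) homeomorphisms of ℝ. -/
def MemH (f : Equiv.Perm ℝ) : Prop :=
  StrictMono f ∧ PiecewisePSL f

section

open Filter Topology Set
open scoped commutatorElement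

/-! ### Germs that are affine in some coordinate -/

/-- The permutations that preserve the filter `L` and that, along `L`, are affine with nonzero
slope in the coordinate `u`. -/
def affineGerm {X : Type*} (L : Filter X) (u : X → ℝ) : Subgroup (Equiv.Perm X) where
  carrier := {p | map p L = L ∧ ∃ α β : ℝ, α ≠ 0 ∧ ∀ᶠ t in L, u (p t) = α * u t + β}
  one_mem' := ⟨map_id, 1, 0, one_ne_zero, by simp⟩
  mul_mem' := by
    rintro p q ⟨hp, α, β, hα, h⟩ ⟨hq, α', β', hα', h'⟩
    refine ⟨by rw [Equiv.Perm.coe_mul, ← map_map, hq, hp], α * α', α * β' + β,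
      mul_ne_zero hα hα', ?_⟩
    rw [← hq, eventually_map] at h
    filter_upwards [h, h'] with t ht ht'
    rw [Equiv.Perm.mul_apply, ht, ht']
    ring
  inv_mem' := by
    rintro p ⟨hp, α, β, hα, h⟩
    refine ⟨by conv_lhs => rw [← hp, map_map, ← Equiv.Perm.coe_mul, inv_mul_cancel]
               exact map_id, α⁻¹, -(α⁻¹ * β), inv_ne_zero hα, ?_⟩
    rw [← hp, eventually_map]
    filter_upwards [h] with t ht
    rw [← Equiv.Perm.mul_apply p⁻¹, inv_mul_cancel, Equiv.Perm.one_apply, ht]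
    field_simp
    ring

/-- The permutations that preserve the filter `L` and that, along `L`, are translations in the
coordinate `u`. -/
def translationGerm {X : Type*} (L : Filter X) (u : X → ℝ) : Subgroup (Equiv.Perm X) where
  carrier := {p | map p L = L ∧ ∃ β : ℝ, ∀ᶠ t in L, u (p t) = u t + β}
  one_mem' := ⟨map_id, 0, by simp⟩
  mul_mem' := by
    rintro p q ⟨hp, β, h⟩ ⟨hq, β', h'⟩
    refine ⟨by rw [Equiv.Perm.coe_mul, ← map_map, hq, hp], β' + β, ?_⟩
    rw [← hq, eventually_map] at h
    filter_upwards [h, h'] with t ht ht'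
    rw [Equiv.Perm.mul_apply, ht, ht']
    ring
  inv_mem' := by
    rintro p ⟨hp, β, h⟩
    refine ⟨by conv_lhs => rw [← hp, map_map, ← Equiv.Perm.coe_mul, inv_mul_cancel]
               exact map_id, -β, ?_⟩
    rw [← hp, eventually_map]
    filter_upwards [h] with t ht
    rw [← Equiv.Perm.mul_apply p⁻¹, inv_mul_cancel, Equiv.Perm.one_apply, ht]
    ring

/-- The permutations that are the identity along the filter `L`. -/
def trivialGerm {X : Type*} (L : Filter X) : Subgroup (Equiv.Perm X) where
  carrier := {p | ∀ᶠ t in L, p t = t}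
  one_mem' := by simp
  mul_mem' := by
    intro p q hp hq
    filter_upwards [hp, hq] with t ht ht'
    rw [Equiv.Perm.mul_apply, ht', ht]
  inv_mem' := by
    intro p hp
    filter_upwards [hp] with t ht
    rw [Equiv.Perm.inv_eq_iff_eq, ht]

lemma map_commutatorElement_eq {X : Type*} {L : Filter X} {p q : Equiv.Perm X}
    (hp : map p L = L) (hq : map q L = L) : map ⇑⁅p, q⁆ L = L := by
  have hqp : map ⇑(q * p) L = L := by rw [Equiv.Perm.coe_mul, ← map_map, hp, hq]
  conv_lhs => rw [← hqp, map_map, ← Equiv.Perm.coe_mul]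
  rw [show ⁅p, q⁆ * (q * p) = p * q by simp [commutatorElement_def, mul_assoc],
    Equiv.Perm.coe_mul, ← map_map, hq, hp]

lemma eventually_commutatorElement {X : Type*} {L : Filter X} {p q : Equiv.Perm X}
    (hp : map p L = L) (hq : map q L = L) {P : X → X → Prop}
    (h : ∀ᶠ t in L, P (q (p t)) (p (q t))) : ∀ᶠ t in L, P t (⁅p, q⁆ t) := by
  have hqp : map ⇑(q * p) L = L := by rw [Equiv.Perm.coe_mul, ← map_map, hp, hq]
  rw [← hqp, eventually_map]
  filter_upwards [h] with t ht
  rwa [← Equiv.Perm.mul_apply ⁅p, q⁆,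
    show ⁅p, q⁆ * (q * p) = p * q by simp [commutatorElement_def, mul_assoc]]

lemma commutator_affineGerm_le {X : Type*} (L : Filter X) (u : X → ℝ) :
    ⁅affineGerm L u, affineGerm L u⁆ ≤ translationGerm L u := by
  rw [Subgroup.commutator_le]
  rintro p ⟨hp, α, β, -, h⟩ q ⟨hq, α', β', -, h'⟩
  refine ⟨map_commutatorElement_eq hp hq, α * β' + β - α' * β - β', ?_⟩
  refine eventually_commutatorElement hp hq
    (P := fun s t => u t = u s + (α * β' + β - α' * β - β')) ?_
  have h₁ := h
  have h₂ := h'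
  rw [← hq, eventually_map] at h₁
  rw [← hp, eventually_map] at h₂
  filter_upwards [h, h', h₁, h₂] with t e₁ e₂ e₃ e₄
  rw [e₃, e₄, e₁, e₂]
  ring

lemma commutator_translationGerm_le {X : Type*} (L : Filter X) {u : X → ℝ}
    (hu : Function.Injective u) :
    ⁅translationGerm L u, translationGerm L u⁆ ≤ trivialGerm L := by
  rw [Subgroup.commutator_le]
  rintro p ⟨hp, β, h⟩ q ⟨hq, β', h'⟩
  refine eventually_commutatorElement hp hq (P := fun s t => t = s) ?_
  have h₁ := h
  have h₂ := h'
  rw [← hq, eventually_map] at h₁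
  rw [← hp, eventually_map] at h₂
  filter_upwards [h, h', h₁, h₂] with t e₁ e₂ e₃ e₄
  apply hu
  rw [e₃, e₄, e₁, e₂]
  ring

lemma second_commutator_le_trivialGerm {X : Type*} {L : Filter X} {u : X → ℝ}
    (hu : Function.Injective u) {G : Subgroup (Equiv.Perm X)} (hG : G ≤ affineGerm L u) :
    ⁅⁅G, G⁆, ⁅G, G⁆⁆ ≤ trivialGerm L := by
  have h : ⁅G, G⁆ ≤ translationGerm L u :=
    (Subgroup.commutator_mono hG hG).trans (commutator_affineGerm_le L u)
  exact (Subgroup.commutator_mono h h).trans (commutator_translationGerm_le L hu)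

/-! ### Germs of elements of `H(ℝ)` -/

lemma IsFracLinOn.mono {h : ℝ → ℝ} {s t : Set ℝ} (hs : IsFracLinOn h s) (hts : t ⊆ s) :
    IsFracLinOn h t :=
  let ⟨g, hg⟩ := hs
  ⟨g, fun x hx => hg x (hts hx)⟩

lemma Fin.last_or_exists_castSucc_not_succ {k : ℕ} {P : Fin (k + 1) → Prop} (h0 : P 0) :
    P (Fin.last k) ∨ ∃ i : Fin k, P i.castSucc ∧ ¬ P i.succ := by
  by_contra! H
  exact H.1 (Fin.induction (motive := P) h0 H.2 _)

lemma PiecewisePSL.exists_nhdsGT {h : ℝ → ℝ} (hh : PiecewisePSL h) (c : ℝ) :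
    ∃ s ∈ 𝓝[>] c, IsFracLinOn h s := by
  obtain ⟨k, x, -, h0, hl, hi⟩ := hh
  rcases lt_or_ge c (x 0) with hc | hc
  · exact ⟨_, mem_nhdsWithin_of_mem_nhds (Iio_mem_nhds hc), h0⟩
  rcases Fin.last_or_exists_castSucc_not_succ (P := fun i => x i ≤ c) hc with hc | ⟨i, h1, h2⟩
  · exact ⟨Ioi c, self_mem_nhdsWithin, hl.mono (Ioi_subset_Ioi hc)⟩
  · exact ⟨Ioo c (x i.succ), Ioo_mem_nhdsGT (not_le.1 h2), (hi i).mono (Ioo_subset_Ioo_left h1)⟩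

lemma PiecewisePSL.exists_nhdsLT {h : ℝ → ℝ} (hh : PiecewisePSL h) (c : ℝ) :
    ∃ s ∈ 𝓝[<] c, IsFracLinOn h s := by
  obtain ⟨k, x, -, h0, hl, hi⟩ := hh
  rcases le_or_gt c (x 0) with hc | hc
  · exact ⟨Iio c, self_mem_nhdsWithin, h0.mono (Iio_subset_Iio hc)⟩
  rcases Fin.last_or_exists_castSucc_not_succ (P := fun i => x i < c) hc with hc | ⟨i, h1, h2⟩
  · exact ⟨_, mem_nhdsWithin_of_mem_nhds (Ioi_mem_nhds hc), hl⟩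
  · exact ⟨Ioo (x i.castSucc) c, Ioo_mem_nhdsLT h1,
      (hi i).mono (Ioo_subset_Ioo_right (not_lt.1 h2))⟩

lemma Matrix.SpecialLinearGroup.fin_two_det_eq_one (g : Matrix.SpecialLinearGroup (Fin 2) ℝ) :
    g.1 0 0 * g.1 1 1 - g.1 0 1 * g.1 1 0 = 1 := by
  rw [← Matrix.det_fin_two]
  exact g.2

/-- A fractional linear germ fixing the point `c` is affine in the coordinate `(t - c)⁻¹`. -/
lemma IsFracLinOn.eventually_inv_sub {h : ℝ → ℝ} {c : ℝ} (hc : h c = c) (hcont : ContinuousAt h c)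
    {L : Filter ℝ} [L.NeBot] (hL : L ≤ 𝓝[≠] c) {s : Set ℝ} (hs : s ∈ L) (hh : IsFracLinOn h s) :
    ∃ α β : ℝ, α ≠ 0 ∧ ∀ᶠ t in L, (h t - c)⁻¹ = α * (t - c)⁻¹ + β := by
  obtain ⟨m, hm⟩ := hh
  have hdet := m.fin_two_det_eq_one
  generalize m.1 0 0 = a, m.1 0 1 = b, m.1 1 0 = γ, m.1 1 1 = d at hm hdet
  have hLc : L ≤ 𝓝 c := hL.trans nhdsWithin_le_nhds
  have hne : ∀ᶠ t in L, t ≠ c := hL self_mem_nhdsWithin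
  have hden : ∀ᶠ t in L, γ * t + d ≠ 0 := by
    by_cases h0 : γ * c + d = 0
    · filter_upwards [hne] with t ht h1
      have : γ * (t - c) = 0 := by linear_combination h1 - h0
      rcases mul_eq_zero.1 this with h2 | h2
      · subst h2
        simp only [zero_mul, zero_add] at h0
        subst h0
        simp at hdet
      · exact ht (sub_eq_zero.1 h2)
    · exact hLc ((by fun_prop : Continuous fun t : ℝ => γ * t + d).continuousAt.eventually_ne h0)
  have hmul : ∀ᶠ t in L, h t * (γ * t + d) = a * t + b := by
    filter_upwards [hden, hs] with t ht hts
    rw [hm t hts, div_mul_cancel₀ _ ht]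
  have hlim : c * (γ * c + d) = a * c + b := by
    have h1 : Tendsto (fun t => h t * (γ * t + d)) L (𝓝 (c * (γ * c + d))) := by
      have : Tendsto h L (𝓝 c) := by
        have := hcont.tendsto
        rw [hc] at this
        exact this.mono_left hLc
      exact this.mul
        ((by fun_prop : Continuous fun t : ℝ => γ * t + d).continuousAt.tendsto.mono_left hLc)
    have h2 : Tendsto (fun t => a * t + b) L (𝓝 (a * c + b)) :=
      (by fun_prop : Continuous fun t : ℝ => a * t + b).continuousAt.tendsto.mono_left hLc
    exact tendsto_nhds_unique_of_eventuallyEq h1 h2 hmul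
  have hδ : (a - c * γ) * (γ * c + d) = 1 := by linear_combination hdet - γ * hlim
  have hδ0 : γ * c + d ≠ 0 := right_ne_zero_of_mul_eq_one hδ
  have hα : a - c * γ = (γ * c + d)⁻¹ := eq_inv_of_mul_eq_one_left hδ
  refine ⟨(γ * c + d) ^ 2, (γ * c + d) * γ, pow_ne_zero _ hδ0, ?_⟩
  filter_upwards [hden, hs, hne] with t ht hts htc
  have hsub : h t - c = (γ * c + d)⁻¹ * (t - c) / (γ * t + d) := by
    rw [hm t hts, eq_div_iff ht, sub_mul, div_mul_cancel₀ _ ht, ← hα]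
    linear_combination -hlim
  have htc' : t - c ≠ 0 := sub_ne_zero.2 htc
  rw [hsub, inv_div, ← div_eq_mul_inv]
  field_simp
  ring

/-- A fractional linear germ at infinity fixing infinity is affine. -/
lemma IsFracLinOn.eventually_affine {h : ℝ → ℝ} {L : Filter ℝ} [L.NeBot]
    (hL : L ≤ Bornology.cobounded ℝ) (hlim : Tendsto h L (Bornology.cobounded ℝ)) {s : Set ℝ}
    (hs : s ∈ L) (hh : IsFracLinOn h s) :
    ∃ α β : ℝ, α ≠ 0 ∧ ∀ᶠ t in L, h t = α * t + β := by
  obtain ⟨m, hm⟩ := hh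
  have hdet := m.fin_two_det_eq_one
  generalize m.1 0 0 = a, m.1 0 1 = b, m.1 1 0 = γ, m.1 1 1 = d at hm hdet
  have hinv : Tendsto (fun t : ℝ => t⁻¹) L (𝓝 0) := tendsto_inv₀_cobounded.mono_left hL
  have hne : ∀ᶠ t in L, t ≠ 0 := hL (Bornology.isBounded_def.1 Bornology.isBounded_singleton)
  by_cases hγ : γ = 0
  · subst hγ
    have had : a * d = 1 := by linear_combination hdet
    have hd : d ≠ 0 := right_ne_zero_of_mul_eq_one had
    refine ⟨a / d, b / d, div_ne_zero (left_ne_zero_of_mul_eq_one had) hd, ?_⟩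
    filter_upwards [hs] with t ht
    rw [hm t ht]
    simp only [zero_mul, zero_add]
    ring
  · exfalso
    have h1 : Tendsto (fun t => (a + b * t⁻¹) / (γ + d * t⁻¹)) L (𝓝 ((a + b * 0) / (γ + d * 0))) :=
      ((hinv.const_mul b).const_add a).div ((hinv.const_mul d).const_add γ) (by simpa using hγ)
    have h2 : Tendsto h L (𝓝 ((a + b * 0) / (γ + d * 0))) := by
      refine h1.congr' ?_
      filter_upwards [hs, hne] with t ht ht0
      rw [hm t ht, ← mul_div_mul_right _ _ ht0]
      congr 1 <;> field_simp
    exact h2.not_tendsto (Metric.disjoint_nhds_cobounded _) hlim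

/-- A member of `H(ℝ)` as an order isomorphism. -/
noncomputable def MemH.orderIso {f : Equiv.Perm ℝ} (hf : MemH f) : ℝ ≃o ℝ :=
  hf.1.orderIsoOfSurjective f f.surjective

lemma MemH.coe_orderIso {f : Equiv.Perm ℝ} (hf : MemH f) : ⇑hf.orderIso = f := rfl

lemma MemH.continuous {f : Equiv.Perm ℝ} (hf : MemH f) : Continuous f :=
  hf.orderIso.continuous

lemma MemH.map_nhdsGT {f : Equiv.Perm ℝ} (hf : MemH f) (c : ℝ) :
    map f (𝓝[>] c) = 𝓝[>] (f c) := by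
  rw [← hf.coe_orderIso, ← hf.orderIso.image_Ioi]
  exact hf.orderIso.toHomeomorph.isEmbedding.map_nhdsWithin_eq _ _

lemma MemH.map_nhdsLT {f : Equiv.Perm ℝ} (hf : MemH f) (c : ℝ) :
    map f (𝓝[<] c) = 𝓝[<] (f c) := by
  rw [← hf.coe_orderIso, ← hf.orderIso.image_Iio]
  exact hf.orderIso.toHomeomorph.isEmbedding.map_nhdsWithin_eq _ _

lemma MemH.mem_affineGerm_nhdsGT {f : Equiv.Perm ℝ} (hf : MemH f) {c : ℝ} (hc : f c = c) :
    f ∈ affineGerm (𝓝[>] c) fun t => (t - c)⁻¹ := by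
  obtain ⟨s, hs, h⟩ := hf.2.exists_nhdsGT c
  refine ⟨by rw [hf.map_nhdsGT, hc], ?_⟩
  exact h.eventually_inv_sub hc hf.continuous.continuousAt
    (nhdsWithin_mono _ fun t ht => ne_of_gt ht) hs

lemma MemH.mem_affineGerm_nhdsLT {f : Equiv.Perm ℝ} (hf : MemH f) {c : ℝ} (hc : f c = c) :
    f ∈ affineGerm (𝓝[<] c) fun t => (t - c)⁻¹ := by
  obtain ⟨s, hs, h⟩ := hf.2.exists_nhdsLT c
  refine ⟨by rw [hf.map_nhdsLT, hc], ?_⟩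
  exact h.eventually_inv_sub hc hf.continuous.continuousAt
    (nhdsWithin_mono _ fun t ht => ne_of_lt ht) hs

lemma MemH.mem_affineGerm_atTop {f : Equiv.Perm ℝ} (hf : MemH f) : f ∈ affineGerm atTop id := by
  have h : map f atTop = atTop := hf.orderIso.map_atTop
  refine ⟨h, ?_⟩
  obtain ⟨k, x, -, -, hl, -⟩ := hf.2
  exact hl.eventually_affine IsOrderBornology.atTop_le_cobounded
    (h.le.trans IsOrderBornology.atTop_le_cobounded) (Ioi_mem_atTop _)

lemma MemH.mem_affineGerm_atBot {f : Equiv.Perm ℝ} (hf : MemH f) : f ∈ affineGerm atBot id := by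
  have h : map f atBot = atBot := hf.orderIso.map_atBot
  refine ⟨h, ?_⟩
  obtain ⟨k, x, -, h0, -, -⟩ := hf.2
  exact h0.eventually_affine IsOrderBornology.atBot_le_cobounded
    (h.le.trans IsOrderBornology.atBot_le_cobounded) (Iio_mem_atBot _)

/-! ### Groups of increasing permutations of the line -/

/-- The points that are moved by some element of `G`. -/
def movedSet {X : Type*} (G : Subgroup (Equiv.Perm X)) : Set X := {t | ∃ p ∈ G, p t ≠ t}

/-- The components of the moved set of `G` that contain a point moved by `h`. -/
def movedComponents (G : Subgroup (Equiv.Perm ℝ)) (h : Equiv.Perm ℝ) : Set (Set ℝ) :=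
  (movedSet G).ordConnectedComponent '' {t | h t ≠ t}

lemma apply_eq_of_notMem_movedSet {X : Type*} {G : Subgroup (Equiv.Perm X)} {t : X}
    (ht : t ∉ movedSet G) {p : Equiv.Perm X} (hp : p ∈ G) : p t = t := by
  by_contra h
  exact ht ⟨p, hp, h⟩

lemma isOpen_movedSet {G : Subgroup (Equiv.Perm ℝ)} (hG : ∀ p ∈ G, StrictMono p) :
    IsOpen (movedSet G) := by
  have : movedSet G = ⋃ p ∈ G, {t | p t ≠ t} := by ext; simp [movedSet]
  rw [this]
  refine isOpen_biUnion fun p hp => isOpen_ne_fun ?_ continuous_id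
  exact (hG p hp).monotone.continuous_of_surjective p.surjective

lemma uIcc_apply_subset_movedSet {G : Subgroup (Equiv.Perm ℝ)} (hG : ∀ p ∈ G, StrictMono p)
    {p : Equiv.Perm ℝ} (hp : p ∈ G) {t : ℝ} (ht : t ∈ movedSet G) :
    uIcc t (p t) ⊆ movedSet G := by
  intro c hc
  by_contra hcU
  have hpc := apply_eq_of_notMem_movedSet hcU hp
  rcases lt_trichotomy t c with h | rfl | h
  · have := hG p hp h
    rw [hpc] at this
    exact absurd (hc.2.trans_lt (max_lt h this)) (lt_irrefl _)
  · exact hcU ht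
  · have := hG p hp h
    rw [hpc] at this
    exact absurd ((lt_min h this).trans_le hc.1) (lt_irrefl _)

lemma ordConnectedComponent_apply {G : Subgroup (Equiv.Perm ℝ)} (hG : ∀ p ∈ G, StrictMono p)
    {p : Equiv.Perm ℝ} (hp : p ∈ G) (t : ℝ) :
    (movedSet G).ordConnectedComponent (p t) = (movedSet G).ordConnectedComponent t := by
  by_cases ht : t ∈ movedSet G
  · exact (ordConnectedComponent_eq (uIcc_apply_subset_movedSet hG hp ht)).symm
  · rw [apply_eq_of_notMem_movedSet ht hp]

/-- An interval of moved points can be pushed off itself: its left end can be moved beyond its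
right end. -/
lemma exists_lt_apply {G : Subgroup (Equiv.Perm ℝ)} (hG : ∀ p ∈ G, StrictMono p) {a b : ℝ}
    (hab : Icc a b ⊆ movedSet G) : ∃ p ∈ G, b < p a := by
  by_contra! H
  let O : Set ℝ := {y | ∃ p ∈ G, p a = y}
  have haO : a ∈ O := ⟨1, G.one_mem, rfl⟩
  have hbdd : BddAbove O := ⟨b, by rintro _ ⟨p, hp, rfl⟩; exact H p hp⟩
  have hlub := isLUB_csSup ⟨a, haO⟩ hbdd
  set s := sSup O
  have hle : ∀ p ∈ G, s ≤ p s := by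
    intro p hp
    refine hlub.2 ?_
    rintro _ ⟨q, hq, rfl⟩
    have h1 : (p⁻¹ * q) a ≤ s := hlub.1 ⟨_, G.mul_mem (G.inv_mem hp) hq, rfl⟩
    have h2 := (hG p hp).monotone h1
    rwa [← Equiv.Perm.mul_apply, mul_inv_cancel_left] at h2
  have hs : s ∈ Icc a b := ⟨hlub.1 haO, hlub.2 (by rintro _ ⟨p, hp, rfl⟩; exact H p hp)⟩
  obtain ⟨p, hp, hps⟩ := hab hs
  refine hps ((hle p hp).antisymm' ?_)
  have h2 := (hG p hp).monotone (hle _ (G.inv_mem hp))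
  rwa [← Equiv.Perm.mul_apply, mul_inv_cancel, Equiv.Perm.one_apply] at h2

lemma exists_ordConnectedComponent_eq_nhds {U : Set ℝ} (hU : IsOpen U) {x : ℝ} (hx : x ∈ U) :
    ∃ V ∈ 𝓝 x, ∀ y ∈ V, U.ordConnectedComponent y = U.ordConnectedComponent x := by
  obtain ⟨ε, hε, hball⟩ := Metric.isOpen_iff.1 hU x hx
  refine ⟨_, Metric.ball_mem_nhds x hε, fun y hy => (ordConnectedComponent_eq ?_).symm⟩
  rw [Real.ball_eq_Ioo] at hball hy
  exact (ordConnected_Ioo.uIcc_subset (by simpa using hε) hy).trans hball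

lemma movedComponents_finite {G : Subgroup (Equiv.Perm ℝ)} (hG : ∀ p ∈ G, StrictMono p)
    {h : Equiv.Perm ℝ} (htop : ∀ᶠ t in atTop, h t = t) (hbot : ∀ᶠ t in atBot, h t = t)
    (hfix : ∀ c ∉ movedSet G, ∀ᶠ t in 𝓝 c, h t = t) : (movedComponents G h).Finite := by
  obtain ⟨R, hR⟩ := eventually_atTop.1 htop
  obtain ⟨r, hr⟩ := eventually_atBot.1 hbot
  have key : ((movedSet G).ordConnectedComponent '' (Icc r R ∩ {t | h t ≠ t})).Finite := by
    refine isCompact_Icc.induction_on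
      (p := fun s => ((movedSet G).ordConnectedComponent '' (s ∩ {t | h t ≠ t})).Finite)
      (by simp) (fun s t hst ht => ht.subset (by gcongr)) ?_ ?_
    · intro s t hs ht
      rw [union_inter_distrib_right, image_union]
      exact hs.union ht
    · intro x _
      by_cases hx : x ∈ movedSet G
      · obtain ⟨V, hV, hVx⟩ := exists_ordConnectedComponent_eq_nhds (isOpen_movedSet hG) hx
        refine ⟨V, mem_nhdsWithin_of_mem_nhds hV,
          (finite_singleton ((movedSet G).ordConnectedComponent x)).subset ?_⟩
        rintro _ ⟨y, hy, rfl⟩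
        exact hVx y hy.1
      · refine ⟨_, mem_nhdsWithin_of_mem_nhds (hfix x hx), finite_empty.subset ?_⟩
        rintro _ ⟨y, hy, rfl⟩
        exact hy.2 hy.1
  refine key.subset (image_mono fun t ht => ⟨⟨?_, ?_⟩, ht⟩)
  · by_contra! hlt
    exact ht (hr t hlt.le)
  · by_contra! hlt
    exact ht (hR t hlt.le)

/-- If `h` is the identity near infinity and near the common fixed points of `G`, then the points
moved by `h` in a component of the moved set of `G` lie in a compact subinterval. -/
lemma exists_Icc_subset_movedSet {G : Subgroup (Equiv.Perm ℝ)} {h : Equiv.Perm ℝ} (hh : h ∈ G)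
    (htop : ∀ᶠ t in atTop, h t = t) (hbot : ∀ᶠ t in atBot, h t = t)
    (hfix : ∀ c ∉ movedSet G, ∀ᶠ t in 𝓝 c, h t = t) {x : ℝ} (hx : h x ≠ x) :
    ∃ a b, Icc a b ⊆ movedSet G ∧
      ∀ t, (movedSet G).ordConnectedComponent t = (movedSet G).ordConnectedComponent x →
        h t ≠ t → t ∈ Icc a b := by
  obtain ⟨R, hR⟩ := eventually_atTop.1 htop
  obtain ⟨r, hr⟩ := eventually_atBot.1 hbot
  set S : Set ℝ := {t | uIcc x t ⊆ movedSet G ∧ h t ≠ t}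
  have hxS : x ∈ S := ⟨by rw [uIcc_self, singleton_subset_iff]; exact ⟨h, hh, hx⟩, hx⟩
  have hbelow : BddBelow S := ⟨r, fun t ht => by
    by_contra! hlt
    exact ht.2 (hr t hlt.le)⟩
  have habove : BddAbove S := ⟨R, fun t ht => by
    by_contra! hlt
    exact ht.2 (hR t hlt.le)⟩
  have hglb := isGLB_csInf ⟨x, hxS⟩ hbelow
  have hlub := isLUB_csSup ⟨x, hxS⟩ habove
  refine ⟨sInf S, sSup S, fun c hc => ?_, fun t htx ht => ?_⟩
  · by_contra hcU
    have hev := hfix c hcU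
    rcases le_total c x with hcx | hcx
    · rcases hc.1.eq_or_lt with rfl | hlt
      · obtain ⟨t, hts, ht⟩ := ((hglb.frequently_nhds_mem ⟨x, hxS⟩).and_eventually hev).exists
        exact hts.2 ht
      · obtain ⟨t, hts, ht⟩ := (isGLB_lt_iff hglb).1 hlt
        exact hcU (hts.1 ⟨(min_le_right _ _).trans ht.le, hcx.trans (le_max_left _ _)⟩)
    · rcases hc.2.eq_or_lt with rfl | hlt
      · obtain ⟨t, hts, ht⟩ := ((hlub.frequently_nhds_mem ⟨x, hxS⟩).and_eventually hev).exists
        exact hts.2 ht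
      · obtain ⟨t, hts, ht⟩ := (lt_isLUB_iff hlub).1 hlt
        exact hcU (hts.1 ⟨(min_le_left _ _).trans hcx, ht.le.trans (le_max_right _ _)⟩)
  · have htS : t ∈ S := by
      refine ⟨?_, ht⟩
      rw [← mem_ordConnectedComponent, ← htx]
      exact self_mem_ordConnectedComponent.2 ⟨h, hh, ht⟩
    exact ⟨hglb.1 htS, hlub.1 htS⟩

lemma Equiv.Perm.apply_apply_ne {X : Type*} {p : Equiv.Perm X} {t : X} (h : p t ≠ t) :
    p (p t) ≠ p t := fun h' => h (p.injective h')

lemma Equiv.Perm.commutatorElement_apply_eq {X : Type*} {p q : Equiv.Perm X} {t : X}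
    (h : p (q ((q * p)⁻¹ t)) = q (p ((q * p)⁻¹ t))) : ⁅p, q⁆ t = t := by
  simp only [← Equiv.Perm.mul_apply] at h
  rw [← mul_assoc q, mul_inv_cancel, Equiv.Perm.one_apply] at h
  rwa [commutatorElement_def, mul_assoc, mul_assoc, ← mul_inv_rev]

lemma Equiv.Perm.zpow_eq_zero_of_apply_eq {p : Equiv.Perm ℝ} (hp : StrictMono p) {x : ℝ}
    (hx : p x ≠ x) {z : ℤ} (hz : (p ^ z) x = x) : z = 0 := by
  have hnat : (p ^ z.natAbs) x = x := by
    rcases Int.natAbs_eq z with h | h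
    · rw [h] at hz
      exact_mod_cast hz
    · rw [h, zpow_neg, Equiv.Perm.inv_eq_iff_eq] at hz
      exact_mod_cast hz.symm
  rw [← Equiv.Perm.iterate_eq_pow] at hnat
  rcases lt_or_gt_of_ne hx with h | h
  · simpa using (hp.strictAnti_iterate_of_map_lt h).injective (a₁ := z.natAbs) (a₂ := 0) hnat
  · simpa using (hp.strictMono_iterate_of_lt_map h).injective (a₁ := z.natAbs) (a₂ := 0) hnat

open scoped IsMulCommutative in
/-- Pairwise commuting increasing permutations `c n` generate a free abelian group as soon as each
`c n` moves some point whose `c n`-orbit is fixed by all the others. -/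
lemma exists_injective_hom_of_commute {c : ℕ → Equiv.Perm ℝ} (hc : ∀ m n, c m * c n = c n * c m)
    (hmono : ∀ n, StrictMono (c n)) {x : ℕ → ℝ} (hx : ∀ n, c n (x n) ≠ x n)
    (hfix : ∀ m n, m ≠ n → ∀ j : ℤ, c m ((c n ^ j) (x n)) = (c n ^ j) (x n))
    {G : Subgroup (Equiv.Perm ℝ)} (hG : ∀ n, c n ∈ G) :
    ∃ φ : Multiplicative (ℕ →₀ ℤ) →* Equiv.Perm ℝ, Function.Injective φ ∧ ∀ w, φ w ∈ G := by
  let A : Subgroup (Equiv.Perm ℝ) := Subgroup.closure (range c)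
  have hA : IsMulCommutative A := Subgroup.isMulCommutative_closure (by
    rintro _ ⟨m, rfl⟩ _ ⟨n, rfl⟩
    exact hc m n)
  let d : ℕ → A := fun n => ⟨c n, Subgroup.subset_closure (mem_range_self n)⟩
  let ψ : (ℕ →₀ ℤ) →+ Additive A :=
    (Finsupp.linearCombination ℤ fun n => Additive.ofMul (d n)).toAddMonoidHom
  let φ : Multiplicative (ℕ →₀ ℤ) →* Equiv.Perm ℝ :=
    A.subtype.comp (AddMonoidHom.toMultiplicativeLeft ψ)
  have hsingle : ∀ m z, φ (Multiplicative.ofAdd (Finsupp.single m z)) = c m ^ z := by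
    intro m z
    simp [φ, ψ, d]
  have happly : ∀ (w : ℕ →₀ ℤ) (n : ℕ) (j : ℤ),
      φ (Multiplicative.ofAdd w) ((c n ^ j) (x n)) = (c n ^ (w n + j)) (x n) := by
    intro w n
    induction w using Finsupp.induction_linear with
    | zero => simp
    | add v w hv hw =>
      intro j
      rw [ofAdd_add, map_mul, Equiv.Perm.mul_apply, hw, hv, Finsupp.add_apply, add_assoc]
    | single m z =>
      intro j
      rw [hsingle]
      by_cases hmn : m = n
      · subst hmn
        rw [Finsupp.single_eq_same, zpow_add, Equiv.Perm.mul_apply]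
      · rw [Finsupp.single_eq_of_ne (Ne.symm hmn), zero_add]
        exact Equiv.Perm.zpow_apply_eq_self_of_apply_eq_self (hfix m n hmn j) z
  refine ⟨φ, (injective_iff_map_eq_one φ).2 fun w hw => ?_, fun w => ?_⟩
  · refine Multiplicative.toAdd.injective (Finsupp.ext fun n => ?_)
    have := happly w.toAdd n 0
    rw [ofAdd_toAdd, hw, zpow_zero, add_zero, Equiv.Perm.one_apply, Equiv.Perm.one_apply] at this
    exact Equiv.Perm.zpow_eq_zero_of_apply_eq (hmono n) (hx n) this.symm
  · have : A ≤ G := (Subgroup.closure_le G).2 (by rintro _ ⟨n, rfl⟩; exact hG n)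
    exact this (SetLike.coe_mem _)

lemma conj_mem_second_commutator {Γ : Type*} [Group Γ] {G : Subgroup Γ} {k h : Γ} (hk : k ∈ G)
    (hh : h ∈ ⁅⁅G, G⁆, ⁅G, G⁆⁆) : k * h * k⁻¹ ∈ ⁅⁅G, G⁆, ⁅G, G⁆⁆ := by
  have hG : G.map (MulAut.conj k).toMonoidHom ≤ G := by
    rintro _ ⟨x, hx, rfl⟩
    exact G.mul_mem (G.mul_mem hk hx) (G.inv_mem hk)
  have hD : ⁅⁅G, G⁆, ⁅G, G⁆⁆.map (MulAut.conj k).toMonoidHom ≤ ⁅⁅G, G⁆, ⁅G, G⁆⁆ := by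
    simp only [Subgroup.map_commutator]
    exact Subgroup.commutator_mono (Subgroup.commutator_mono hG hG)
      (Subgroup.commutator_mono hG hG)
  exact hD ⟨h, hh, rfl⟩

/-- A group of increasing permutations of the line contains a free abelian group of infinite rank
as soon as its second commutator subgroup is nontrivial and consists of permutations that are the
identity near infinity and near the common fixed points of the group. -/
lemma exists_injective_hom_of_second_commutator {G : Subgroup (Equiv.Perm ℝ)}
    (hG : ∀ p ∈ G, StrictMono p)
    (htop : ∀ h ∈ ⁅⁅G, G⁆, ⁅G, G⁆⁆, ∀ᶠ t in atTop, h t = t)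
    (hbot : ∀ h ∈ ⁅⁅G, G⁆, ⁅G, G⁆⁆, ∀ᶠ t in atBot, h t = t)
    (hfix : ∀ h ∈ ⁅⁅G, G⁆, ⁅G, G⁆⁆, ∀ c ∉ movedSet G, ∀ᶠ t in 𝓝 c, h t = t)
    (hne : ∃ h ∈ ⁅⁅G, G⁆, ⁅G, G⁆⁆, h ≠ 1) :
    ∃ φ : Multiplicative (ℕ →₀ ℤ) →* Equiv.Perm ℝ, Function.Injective φ ∧ ∀ w, φ w ∈ G := by
  set D : Subgroup (Equiv.Perm ℝ) := ⁅⁅G, G⁆, ⁅G, G⁆⁆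
  have hDG : D ≤ G := (Subgroup.commutator_le_self _).trans (Subgroup.commutator_le_self _)
  obtain ⟨h, ⟨hhD, hh1⟩, hmin⟩ := exists_minimalFor_of_wellFoundedLT (fun h => h ∈ D ∧ h ≠ 1)
    (fun h => (movedComponents G h).ncard) hne
  have hfin := movedComponents_finite hG (htop h hhD) (hbot h hhD) (hfix h hhD)
  obtain ⟨x, hx⟩ : ∃ x, h x ≠ x := by
    by_contra! H
    exact hh1 (Equiv.ext H)
  obtain ⟨a, b, hab, hsupp⟩ :=
    exists_Icc_subset_movedSet (hDG hhD) (htop h hhD) (hbot h hhD) (hfix h hhD) hx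
  obtain ⟨e, he, hea⟩ := exists_lt_apply hG hab
  let comp := (movedSet G).ordConnectedComponent
  have hcomp : ∀ p ∈ G, ∀ t, comp (p t) = comp t := fun p hp t =>
    ordConnectedComponent_apply hG hp t
  have hxab : x ∈ Icc a b := hsupp x rfl hx
  let c : ℕ → Equiv.Perm ℝ := fun n => e ^ n * h * (e ^ n)⁻¹
  have hcD : ∀ n, c n ∈ D := fun n => conj_mem_second_commutator (G.pow_mem he n) hhD
  have hcmove : ∀ n t, c n t ≠ t → h ((e ^ n)⁻¹ t) ≠ (e ^ n)⁻¹ t := by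
    intro n t ht h0
    apply ht
    simp only [c, Equiv.Perm.mul_apply, h0]
    rw [← Equiv.Perm.mul_apply, mul_inv_cancel, Equiv.Perm.one_apply]
  -- Within the component of `x`, the permutation `c n` is supported on the `n`-th translate.
  have hcsupp : ∀ n t, comp t = comp x → c n t ≠ t → t ∈ Icc ((e ^ n) a) ((e ^ n) b) := by
    intro n t htx ht
    have h1 := hsupp _ ((hcomp _ (G.inv_mem (G.pow_mem he n)) t).trans htx) (hcmove n t ht)
    have hmono := (hG _ (G.pow_mem he n)).monotone
    have h2 := hmono h1.1
    have h3 := hmono h1.2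
    rw [← Equiv.Perm.mul_apply, mul_inv_cancel, Equiv.Perm.one_apply] at h2 h3
    exact ⟨h2, h3⟩
  have hsep : ∀ m n, m < n → (e ^ m) b < (e ^ n) a := by
    intro m n hmn
    induction n, hmn using Nat.le_induction with
    | base =>
      rw [pow_succ, Equiv.Perm.mul_apply]
      exact hG _ (G.pow_mem he m) hea
    | succ n _ ih =>
      refine ih.trans ?_
      rw [pow_succ, Equiv.Perm.mul_apply]
      exact hG _ (G.pow_mem he n) ((hxab.1.trans hxab.2).trans_lt hea)
  have hdisj : ∀ m n, m ≠ n → ∀ t, comp t = comp x → c n t ≠ t → c m t = t := by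
    intro m n hmn t htx hn
    by_contra hm
    have h1 := hcsupp n t htx hn
    have h2 := hcsupp m t htx hm
    rcases hmn.lt_or_gt with hlt | hlt
    · exact absurd (h1.1.trans h2.2) (hsep m n hlt).not_ge
    · exact absurd (h2.1.trans h1.2) (hsep n m hlt).not_ge
  have hcommx : ∀ m n t, comp t = comp x → c m (c n t) = c n (c m t) := by
    intro m n t htx
    by_cases hmn : m = n
    · rw [hmn]
    by_cases hn : c n t = t
    · by_cases hm : c m t = t
      · rw [hn, hm, hn]
      · rw [hn, hdisj n m (Ne.symm hmn) (c m t) ((hcomp _ (hDG (hcD m)) t).trans htx)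
          (Equiv.Perm.apply_apply_ne hm)]
    · rw [hdisj m n hmn t htx hn, hdisj m n hmn (c n t) ((hcomp _ (hDG (hcD n)) t).trans htx)
        (Equiv.Perm.apply_apply_ne hn)]
  have hcout : ∀ n t, comp t ∉ movedComponents G h → c n t = t := by
    intro n t ht
    by_contra hn
    exact ht ⟨_, hcmove n t hn, hcomp _ (G.inv_mem (G.pow_mem he n)) t⟩
  -- A commutator of two conjugates moves fewer components than `h`, so it is trivial.
  have hcomm : ∀ m n, c m * c n = c n * c m := by
    intro m n
    rw [← commutatorElement_eq_one_iff_mul_comm]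
    by_contra hk
    have hkD : ⁅c m, c n⁆ ∈ D := by
      rw [commutatorElement_def]
      exact D.mul_mem (D.mul_mem (D.mul_mem (hcD m) (hcD n)) (D.inv_mem (hcD m)))
        (D.inv_mem (hcD n))
    have hkt : ∀ t, (∀ s, comp s = comp t → c m (c n s) = c n (c m s)) → ⁅c m, c n⁆ t = t := by
      intro t ht
      exact Equiv.Perm.commutatorElement_apply_eq (ht _
        (hcomp _ (G.inv_mem (G.mul_mem (hDG (hcD n)) (hDG (hcD m)))) t))
    have hss : movedComponents G ⁅c m, c n⁆ ⊂ movedComponents G h := by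
      refine ssubset_of_subset_of_ne ?_ ?_
      · rintro _ ⟨t, ht, rfl⟩
        by_contra hmem
        refine ht (hkt t fun s hst => ?_)
        have hs : comp s ∉ movedComponents G h := by rwa [hst]
        rw [hcout n s hs, hcout m s hs, hcout n s hs]
      · intro heq
        obtain ⟨t, ht, htx⟩ : comp x ∈ movedComponents G ⁅c m, c n⁆ := by
          rw [heq]
          exact ⟨x, hx, rfl⟩
        exact ht (hkt t fun s hst => hcommx m n s (hst.trans htx))
    have hlt := ncard_lt_ncard hss hfin
    exact absurd (hmin ⟨hkD, hk⟩ hlt.le) hlt.not_ge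
  have hcx : ∀ n, c n ((e ^ n) x) ≠ (e ^ n) x := by
    intro n h0
    apply hx
    have : (e ^ n) (h x) = (e ^ n) x := by
      simpa only [c, ← Equiv.Perm.mul_apply, inv_mul_cancel_right] using h0
    exact (e ^ n).injective this
  refine exists_injective_hom_of_commute hcomm (fun n => hG _ (hDG (hcD n))) hcx ?_
    fun n => hDG (hcD n)
  intro m n hmn j
  refine hdisj m n hmn _ ?_ ?_
  · rw [hcomp _ (G.zpow_mem (hDG (hcD n)) j), hcomp _ (G.pow_mem he n)]
  · intro h0
    rw [← Equiv.Perm.mul_apply, (Commute.self_zpow (c n) j).eq, Equiv.Perm.mul_apply] at h0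
    exact hcx n ((c n ^ j).injective h0)

lemma strictMono_of_mem_closure {f g : Equiv.Perm ℝ} (hf : StrictMono f) (hg : StrictMono g)
    {p : Equiv.Perm ℝ} (hp : p ∈ Subgroup.closure {f, g}) : StrictMono p := by
  induction hp using Subgroup.closure_induction with
  | mem x hx =>
    rcases hx with rfl | rfl
    exacts [hf, hg]
  | one => exact strictMono_id
  | mul x y _ _ hx hy => exact hx.comp hy
  | inv x _ hx =>
    intro s t hst
    rw [← hx.lt_iff_lt]
    simpa only [← Equiv.Perm.mul_apply, mul_inv_cancel, Equiv.Perm.one_apply] using hst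

lemma eventually_eq_of_mem_second_commutator {f g : Equiv.Perm ℝ} {L : Filter ℝ} {u : ℝ → ℝ}
    (hu : Function.Injective u) (hf : f ∈ affineGerm L u) (hg : g ∈ affineGerm L u)
    {h : Equiv.Perm ℝ}
    (hh : h ∈ ⁅⁅Subgroup.closure {f, g}, Subgroup.closure {f, g}⁆,
      ⁅Subgroup.closure {f, g}, Subgroup.closure {f, g}⁆⁆) : ∀ᶠ t in L, h t = t := by
  refine second_commutator_le_trivialGerm hu ((Subgroup.closure_le _).2 ?_) hh
  rintro _ (rfl | rfl)
  exacts [hf, hg]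

end

/-- Monod: For all f, g ∈ H(ℝ), either the subgroup generated by f and g is
metabelian (its commutator subgroup is abelian), or it contains a subgroup isomorphic to the
free abelian group of countably infinite rank ⨁_{n ∈ ℕ} ℤ. -/
theorem metabelian_or_contains_infinite_rank_free_abelian
    (f g : Equiv.Perm ℝ) (hf : MemH f) (hg : MemH g) :
    (∀ x y : ↥⁅Subgroup.closure {f, g}, Subgroup.closure {f, g}⁆, x * y = y * x) ∨
    ∃ φ : Multiplicative (ℕ →₀ ℤ) →* Equiv.Perm ℝ,
      Function.Injective φ ∧ ∀ w, φ w ∈ Subgroup.closure {f, g} := by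
  refine or_iff_not_imp_left.2 fun hnot => ?_
  push Not at hnot
  obtain ⟨x, y, hxy⟩ := hnot
  refine exists_injective_hom_of_second_commutator
    (fun p hp => strictMono_of_mem_closure hf.1 hg.1 hp)
    (fun h hh => eventually_eq_of_mem_second_commutator Function.injective_id
      hf.mem_affineGerm_atTop hg.mem_affineGerm_atTop hh)
    (fun h hh => eventually_eq_of_mem_second_commutator Function.injective_id
      hf.mem_affineGerm_atBot hg.mem_affineGerm_atBot hh) ?_ ?_
  · intro h hh c hc
    have hfc : f c = c := apply_eq_of_notMem_movedSet hc (Subgroup.subset_closure (by simp))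
    have hgc : g c = c := apply_eq_of_notMem_movedSet hc (Subgroup.subset_closure (by simp))
    have hhc : h c = c := apply_eq_of_notMem_movedSet hc
      ((Subgroup.commutator_le_self _).trans (Subgroup.commutator_le_self _) hh)
    have hu : Function.Injective fun t : ℝ => (t - c)⁻¹ :=
      inv_injective.comp (sub_left_injective (b := c))
    rw [← nhdsNE_sup_pure, ← nhdsLT_sup_nhdsGT, Filter.eventually_sup, Filter.eventually_sup,
      Filter.eventually_pure]
    exact ⟨⟨eventually_eq_of_mem_second_commutator hu (hf.mem_affineGerm_nhdsLT hfc)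
      (hg.mem_affineGerm_nhdsLT hgc) hh, eventually_eq_of_mem_second_commutator hu
      (hf.mem_affineGerm_nhdsGT hfc) (hg.mem_affineGerm_nhdsGT hgc) hh⟩, hhc⟩
  · refine ⟨_, Subgroup.commutator_mem_commutator x.2 y.2, fun h1 => hxy (Subtype.ext ?_)⟩
    exact commutatorElement_eq_one_iff_mul_comm.1 h1
end
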